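/- Let d ≥ 2 and k = 2. There exist constants c, c' > 0 depending only on d, and q₀ ∈ (0,1), such that for all 0 < q < q₀ the self-diffusion coefficient satisfies exp(−c (log(1/q))^d q^{−1/(d−1)}) ≤ D(q) ≤ exp(−c' q^{−1/(d−1)}). -/

import Mathlib

open MeasureTheory ENNReal

noncomputable section

namespace KA

open scoped Classical

/-- Sites of the lattice `ℤ^d`. -/
abbrev Site (d : ℕ) := Fin d → ℤ

/-- A configuration: `true` = occupied, `false` = empty. -/
abbrev Config (d : ℕ) := Site d → Bool

variable {d : ℕ}

def origin : Site d := fun _ => 0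

def eVec (d : ℕ) (i : Fin d) : Site d := fun j => if j = i then 1 else 0

/-- Nearest neighbours in `ℤ^d`. -/
def adj (x y : Site d) : Prop := (∑ i, |x i - y i|) = 1

/-- The set of (at most `2d`) nearest neighbours of a site. -/
def neighbors (x : Site d) : Finset (Site d) :=
  Finset.image (fun p : Fin d × Bool =>
    Function.update x p.1 (x p.1 + if p.2 then 1 else -1)) Finset.univ

/-- The Kob-Andersen kinetic constraint `c_{xy}` for parameter `k`:
`x` has at least `k-1` empty neighbours other than `y`, and vice versa. -/
def constraint (k : ℕ) (η : Config d) (x y : Site d) : Prop :=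
  k - 1 ≤ ((neighbors x).filter fun z => z ≠ y ∧ η z = false).card ∧
  k - 1 ≤ ((neighbors y).filter fun z => z ≠ x ∧ η z = false).card

/-- `c_{xy}(η)` as a `{0,1}`-valued quantity. -/
def cval (k : ℕ) (η : Config d) (x y : Site d) : ℝ≥0∞ :=
  if constraint k η x y then 1 else 0

/-- `η^{xy}` : the configuration with the values at `x` and `y` exchanged. -/
def swap (η : Config d) (x y : Site d) : Config d :=
  fun z => if z = x then η y else if z = y then η x else η z

/-- `(τ_y η)(z) = η (z - y)`. -/
def shift (y : Site d) (η : Config d) : Config d := fun z => η (z - y)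

/-- A local function depends on finitely many coordinates. -/
def IsLocal (f : Config d → ℝ) : Prop :=
  ∃ S : Finset (Site d), ∀ η η' : Config d, (∀ x ∈ S, η x = η' x) → f η = f η'

def dotZ (u : Fin d → ℝ) (y : Site d) : ℝ := ∑ i, u i * (y i : ℝ)

/-- The environment part `Σ_{x ≠ 0} Σ_{y ∼ x} c_{xy} (f(η^{xy}) - f(η))²`. -/
def envTerm (k : ℕ) (f : Config d → ℝ) (η : Config d) : ℝ≥0∞ :=
  ∑' p : Site d × Site d,
    if p.1 ≠ origin ∧ adj p.1 p.2 then
      cval k η p.1 p.2 * ENNReal.ofReal ((f (swap η p.1 p.2) - f η) ^ 2)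
    else 0

/-- The tagged-particle part `Σ_{y ∼ 0} c_{0y} (u·y + f(τ_y η^{0y}) - f(η))²`. -/
def tagTerm (k : ℕ) (u : Fin d → ℝ) (f : Config d → ℝ) (η : Config d) : ℝ≥0∞ :=
  ∑' y : Site d,
    if adj origin y then
      cval k η origin y *
        ENNReal.ofReal ((dotZ u y + f (shift y (swap η origin y)) - f η) ^ 2)
    else 0

/-- The variational (Dirichlet) functional `E_u(f)` integrated against `μ₀`. -/
def energy (k : ℕ) (u : Fin d → ℝ) (μ0 : Measure (Config d)) (f : Config d → ℝ) : ℝ≥0∞ :=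
  ∫⁻ η, envTerm k f η + tagTerm k u f η ∂μ0

/-- `μ` is the Bernoulli product measure where each site is independently
occupied with probability `1 - q`. -/
def IsBernoulliProduct (q : ℝ) (μ : Measure (Config d)) : Prop :=
  IsProbabilityMeasure μ ∧
  ∀ (S : Finset (Site d)) (ζ : Site d → Bool),
    μ {η | ∀ x ∈ S, η x = ζ x} = ∏ x ∈ S, ENNReal.ofReal (if ζ x then 1 - q else q)

/-- `μ₀ = μ(· | η(0) = 1)`. -/
def condOcc (μ : Measure (Config d)) : Measure (Config d) :=
  ProbabilityTheory.cond μ {η | η origin = true}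

/-- The first standard basis vector of `ℝ^d`. -/
def e1R (d : ℕ) : Fin d → ℝ := fun i => if (i : ℕ) = 0 then 1 else 0

def basisR (d : ℕ) (i : Fin d) : Fin d → ℝ := fun j => if j = i then 1 else 0

/-- The quadratic form `u ↦ inf over local f of E_u(f)`. -/
def Qform (k : ℕ) (μ : Measure (Config d)) (u : Fin d → ℝ) : ℝ≥0∞ :=
  ⨅ f : {f : Config d → ℝ // IsLocal f}, energy k u (condOcc μ) f.1

/-- The self-diffusion coefficient `D(q) = inf_f E_{e₁}(f)`. -/
def diffCoeff (k : ℕ) (μ : Measure (Config d)) : ℝ≥0∞ := Qform k μ (e1R d)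

/-- `expIter n` is the `n`-fold iterated exponential. -/
def expIter : ℕ → ℝ → ℝ
  | 0, x => x
  | n + 1, x => Real.exp (expIter n x)

/-! ### Frameability, goodness, block-connectedness -/

/-- Fill every site outside `V` with a particle. -/
def fillOutside (V : Set (Site d)) (η : Config d) : Config d :=
  fun z => if z ∈ V then η z else true

/-- A single legal KA-`k`f transition inside `V`. -/
def KAStep (k : ℕ) (V : Set (Site d)) (η η' : Config d) : Prop :=
  ∃ x y, adj x y ∧ x ∈ V ∧ y ∈ V ∧ η x ≠ η y ∧ constraint k η x y ∧ η' = swap η x y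

/-- A generalized box with minimal corner `a`, spanning the directions in `E`,
with side length `m` (coordinates outside `E` are frozen at `a`). -/
def genBox (a : Site d) (E : Finset (Fin d)) (m : ℕ) : Set (Site d) :=
  {x | ∀ i, (i ∈ E → a i ≤ x i ∧ x i < a i + m) ∧ (i ∉ E → x i = a i)}

/-- The `k'`-th frame of the generalized box: the union of all of its
`(k'-1)`-dimensional slices passing through the minimal corner. -/
def genFrame (k' : ℕ) (a : Site d) (E : Finset (Fin d)) (m : ℕ) : Set (Site d) :=
  {x | x ∈ genBox a E m ∧ (E.filter fun i => x i ≠ a i).card ≤ k' - 1}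

/-- The generalized box is frameable for `η` : `η` (with the outside filled by
particles) is connected by legal KA-`k'`f transitions inside the box to a
configuration whose `k'`-th frame is empty. -/
def Frameable (k' : ℕ) (a : Site d) (E : Finset (Fin d)) (m : ℕ) (η : Config d) : Prop :=
  ∃ η', Relation.ReflTransGen (KAStep k' (genBox a E m)) (fillOutside (genBox a E m) η) η' ∧
    ∀ x ∈ genFrame k' a E m, η' x = false

def one (d : ℕ) : Site d := fun _ => 1

/-- minimal corner of the box `b + [m]^d`. -/
def corner (b : Site d) : Site d := fun i => b i + 1

/-- All codimension-one slices of the generalized box are `(k'-1)`-frameable,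
for every configuration differing from `η` in at most one site. -/
def SlicesOK (k' : ℕ) (a : Site d) (E : Finset (Fin d)) (m : ℕ) (η : Config d) : Prop :=
  ∀ η' : Config d, {x | η' x ≠ η x}.Subsingleton →
    ∀ i ∈ E, ∀ t : ℕ, t < m →
      Frameable (k' - 1) (Function.update a i (a i + t)) (E.erase i) m η'

/-- A good box: all codimension-one slices frameable (robustly to one spin flip),
with one extra empty site in addition to the ones required. -/
def GoodBox (k' : ℕ) (a : Site d) (E : Finset (Fin d)) (m : ℕ) (η : Config d) : Prop :=
  SlicesOK k' a E m η ∧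
  ∃ x₀ ∈ genBox a E m, η x₀ = false ∧ SlicesOK k' a E m (Function.update η x₀ true)

/-- The length scale `ℓ = ℓ(q)`. -/
def lscale (d k : ℕ) (c q : ℝ) : ℕ :=
  if k = 2 then ⌈c * Real.log (1 / q) * q ^ (-(1 : ℝ) / ((d : ℝ) - 1))⌉₊
  else ⌈c * expIter (k - 2) (q ^ (-(1 : ℝ) / ((d : ℝ) - (k : ℝ) + 1)))⌉₊

/-- The length scale `L = q^{-cℓ}`. -/
def Lscale (q c : ℝ) (ℓ : ℕ) : ℕ := ⌈q ^ (-(c * (ℓ : ℝ)))⌉₊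

/-- One step between adjacent boxes: the base point moves by `±ℓ e_i`. -/
def pathStep (ℓ : ℕ) (b b' : Site d) : Prop :=
  ∃ i : Fin d, ∃ s : Bool,
    b' = fun j => b j + if j = i then (if s then (ℓ : ℤ) else -(ℓ : ℤ)) else 0

/-- A `(d,k)`-super-good path of boxes of side `ℓ` inside the block `v + [L]^d`,
joining `v + [ℓ]^d` to `v + (L-ℓ)e_α + [ℓ]^d`, of length at most `3L`:
all boxes good and at least one frameable. -/
def SuperGoodPath (k ℓ L : ℕ) (v : Site d) (α : Fin d) (η : Config d) : Prop :=
  ∃ n : ℕ, n ≤ 3 * L ∧ ∃ b : ℕ → Site d,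
    b 0 = v ∧
    (b n = fun j => v j + if j = α then (L : ℤ) - (ℓ : ℤ) else 0) ∧
    (∀ m < n, pathStep ℓ (b m) (b (m + 1))) ∧
    (∀ m ≤ n, genBox (corner (b m)) Finset.univ ℓ ⊆ genBox (corner v) Finset.univ L) ∧
    (∀ m ≤ n, GoodBox k (corner (b m)) Finset.univ ℓ η) ∧
    (∃ m ≤ n, Frameable k (corner (b m)) Finset.univ ℓ η)

/-- minimal corner of the external face of the box `genBox a univ m` in
direction `j`, on the positive (`s = true`) or negative side. -/
def faceBase (a : Site d) (m : ℕ) (j : Fin d) (s : Bool) : Site d :=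
  Function.update a j (if s then a j + m else a j - 1)

/-- The face `F` is adjacent to the vertex `v`. -/
def FaceNear (v : Site d) (F : Set (Site d)) : Prop := ∃ x ∈ F, ∀ i, |x i - v i| ≤ 1

/-- All `(d-1)`-dimensional external faces of the box `genBox a univ m` that are
adjacent to the vertex `v` are `(d-1, k-1)`-good. -/
def GoodFacesAt (k : ℕ) (a : Site d) (m : ℕ) (v : Site d) (η : Config d) : Prop :=
  ∀ (j : Fin d) (s : Bool),
    FaceNear v (genBox (faceBase a m j s) (Finset.univ.erase j) m) →
    GoodBox (k - 1) (faceBase a m j s) (Finset.univ.erase j) m η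

/-- The coarse vertices `v` and `v + (L+1)e_α` are `(d,k)`-block-connected. -/
def BlockConnected (k ℓ L : ℕ) (v : Site d) (α : Fin d) (η : Config d) : Prop :=
  SuperGoodPath k ℓ L v α η ∧
  GoodFacesAt k (corner v) ℓ v η ∧
  GoodFacesAt k (corner (fun j => v j + if j = α then (L : ℤ) - (ℓ : ℤ) else 0)) (ℓ + 1)
    (fun j => v j + if j = α then (L : ℤ) + 1 else 0) η

/-! ### `T`-step moves -/

/-- A `T`-step move with domain determined by the set of configurations `M`,
whose transitions are legal KA-`k`f transitions contained in `V`,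
keeping track of the position of a marked particle. -/
structure TStepMove (d k : ℕ) (M : Set (Config d)) (V : Set (Site d)) (T : ℕ) where
  conf : Config d → ℕ → Config d
  pos : Config d → Site d → ℕ → Site d
  conf_zero : ∀ η ∈ M, conf η 0 = η
  pos_zero : ∀ η ∈ M, ∀ z : Site d, η z = true → pos η z 0 = z
  step : ∀ η ∈ M, ∀ z : Site d, η z = true → ∀ t < T,
    (conf η (t + 1) = conf η t ∧ pos η z (t + 1) = pos η z t) ∨
    ∃ x y, adj x y ∧ x ∈ V ∧ y ∈ V ∧ conf η t x = true ∧ conf η t y = false ∧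
      constraint k (conf η t) x y ∧ conf η (t + 1) = swap (conf η t) x y ∧
      pos η z (t + 1) = if pos η z t = x then y else pos η z t

/-- `Loss(M) ≤ K` : at every step, at most `2^K` configurations of the domain
have a common image. -/
def LossBoundedBy {d k : ℕ} {M : Set (Config d)} {V : Set (Site d)} {T : ℕ}
    (mv : TStepMove d k M V T) (K : ℝ) : Prop :=
  ∀ t < T, ∀ η' ∈ M, ∃ S : Finset (Config d),
    {η ∈ M | mv.conf η t = mv.conf η' t ∧ mv.conf η (t + 1) = mv.conf η' (t + 1)} ⊆ ↑S ∧
    (S.card : ℝ) ≤ (2 : ℝ) ^ K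

/-! ### Bond configurations on the coarse lattice -/

/-- A bond configuration on the coarse lattice: the edge `(i, α)` joins the
coarse vertices of index `i` and `i + e_α`. -/
abbrev BondConfig (d : ℕ) := (Site d × Fin d) → Bool

def IsLocalBond (g : BondConfig d → ℝ) : Prop :=
  ∃ S : Finset (Site d × Fin d), ∀ ω ω' : BondConfig d, (∀ e ∈ S, ω e = ω' e) → g ω = g ω'

/-- Translation of a bond configuration by a coarse index vector. -/
def bondShift (v : Site d) (ω : BondConfig d) : BondConfig d := fun e => (ω (e.1 - v, e.2))

/-- Two coarse indices joined by an open bond. -/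
def bondRel (ω : BondConfig d) (i j : Site d) : Prop :=
  (∃ α, j = i + eVec d α ∧ ω (i, α) = true) ∨ (∃ α, i = j + eVec d α ∧ ω (j, α) = true)

/-- The event `{0 ↔ ∞}`: the origin lies in an infinite open cluster. -/
def InfiniteCluster : Set (BondConfig d) :=
  {ω | {j : Site d | Relation.ReflTransGen (bondRel ω) origin j}.Infinite}

/-- The coarse index of the neighbour `± e_α` of the coarse origin. -/
def coarseIdx (d : ℕ) (α : Fin d) (s : Bool) : Site d :=
  if s then eVec d α else -(eVec d α)

/-- The actual lattice vector `±(L+1) e_α` of a coarse neighbour of the origin. -/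
def coarseVecZ (d L : ℕ) (α : Fin d) (s : Bool) : Site d :=
  fun j => ((L : ℤ) + 1) * coarseIdx d α s j

/-- Indicator of the bond between the coarse origin and its neighbour `± e_α`. -/
def edgeInd (ω : BondConfig d) (α : Fin d) (s : Bool) : ℝ≥0∞ :=
  if (if s then ω (origin, α) else ω (-(eVec d α), α)) = true then 1 else 0

/-- The auxiliary quadratic form `u ↦ u ⬝ D_aux u`. -/
def QauxForm (d L : ℕ) (μstar : Measure (BondConfig d)) (u : Fin d → ℝ) : ℝ≥0∞ :=
  ⨅ g : {g : BondConfig d → ℝ // IsLocalBond g},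
    ∑ α : Fin d, ∑ s : Bool,
      ∫⁻ ω, edgeInd ω α s *
        ENNReal.ofReal (((if s then (1 : ℝ) else -1) * ((L : ℝ) + 1) * u α +
          g.1 (bondShift (coarseIdx d α s) ω) - g.1 ω) ^ 2) ∂μstar

/-- Indicator (on microscopic configurations) that the coarse origin and its
neighbour `± e_α` are block-connected, for an abstract notion `BC`. -/
def microEdgeInd (BC : Site d → Fin d → Config d → Bool) (α : Fin d) (s : Bool)
    (η : Config d) : ℝ≥0∞ :=
  if (if s then BC origin α η else BC (-(eVec d α)) α η) = true then 1 else 0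

/-- The microscopic comparison form
`u ↦ inf_f Σ_{i ∼ 0} μ₀[ η̄_{0i} (u·i + f(τ_i η^{0,i}) - f(η))² ]`. -/
def microForm (d k L : ℕ) (BC : Site d → Fin d → Config d → Bool)
    (μ0 : Measure (Config d)) (u : Fin d → ℝ) : ℝ≥0∞ :=
  ⨅ f : {f : Config d → ℝ // IsLocal f},
    ∑ α : Fin d, ∑ s : Bool,
      ∫⁻ η, microEdgeInd BC α s η *
        ENNReal.ofReal (((if s then (1 : ℝ) else -1) * ((L : ℝ) + 1) * u α +
          f.1 (shift (coarseVecZ d L α s) (swap η origin (coarseVecZ d L α s))) - f.1 η) ^ 2)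
        ∂μ0

/-! ### d = 2 geometry -/

/-- The column `y + {c} × [ℓ]` in `ℤ²`. -/
def col2 (y : Site 2) (c : ℤ) (ℓ : ℕ) : Set (Site 2) :=
  {x | x 0 = y 0 + c ∧ y 1 + 1 ≤ x 1 ∧ x 1 ≤ y 1 + ℓ}

/-- The box `b + [ℓ]²`. -/
def box2 (b : Site 2) (ℓ : ℕ) : Set (Site 2) := genBox (corner b) Finset.univ ℓ

/-- `S` contains at least two empty sites. -/
def TwoEmptyIn (S : Set (Site 2)) (η : Config 2) : Prop :=
  ∃ a ∈ S, ∃ b ∈ S, a ≠ b ∧ η a = false ∧ η b = false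

/-- Every row and every column of the box `b + [ℓ]²` contains at least two
empty sites. -/
def RowsColsOK (b : Site 2) (ℓ : ℕ) (η : Config 2) : Prop :=
  (∀ t : ℕ, 1 ≤ t → t ≤ ℓ → TwoEmptyIn {z | z ∈ box2 b ℓ ∧ z 1 = b 1 + t} η) ∧
  (∀ t : ℕ, 1 ≤ t → t ≤ ℓ → TwoEmptyIn {z | z ∈ box2 b ℓ ∧ z 0 = b 0 + t} η)

/-- The box `b + [ℓ]²` is `(2,2)`-good: two empty sites in every row and
column, plus one additional empty site. -/
def Good22 (b : Site 2) (ℓ : ℕ) (η : Config 2) : Prop :=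
  RowsColsOK b ℓ η ∧
  ∃ w ∈ box2 b ℓ, η w = false ∧ RowsColsOK b ℓ (Function.update η w true)

/-! ### Bootstrap percolation -/

/-- The box `[-ℓ, ℓ]^d`. -/
def bigBox (d ℓ : ℕ) : Set (Site d) := {x | ∀ i, |x i| ≤ (ℓ : ℤ)}

/-- One step of `k`-neighbour bootstrap percolation on `[-ℓ,ℓ]^d` (sites
outside the box are left unchanged). -/
def BPstep (k ℓ : ℕ) (η : Config d) : Config d := fun x =>
  if x ∈ bigBox d ℓ then
    (if η x = true ∧
        ((neighbors x).filter fun z => z ∈ bigBox d ℓ ∧ η z = false).card < k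
      then true else false)
  else η x

/-- The limiting configuration of bootstrap percolation. -/
def BPinf (k ℓ : ℕ) (η : Config d) : Config d := fun x =>
  if ∀ t : ℕ, (BPstep k ℓ)^[t] η x = true then true else false

/-- One step along the bootstrap percolation cluster. -/
def bpRel (k ℓ : ℕ) (η : Config d) (a b : Site d) : Prop :=
  adj a b ∧ b ∈ bigBox d ℓ ∧ BPinf k ℓ η b = false

/-- The bootstrap percolation cluster of the origin. -/
def bpCluster (k ℓ : ℕ) (η : Config d) : Set (Site d) :=
  {x | Relation.ReflTransGen (bpRel k ℓ η) origin x}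

def coord0 (x : Site d) : ℤ := if h : 0 < d then x ⟨0, h⟩ else 0

/-- The first coordinate of the rightmost site of the bootstrap percolation
cluster of the origin. -/
def bpRightmost (k ℓ : ℕ) (η : Config d) : ℝ :=
  sSup ((fun x : Site d => (coord0 x : ℝ)) '' bpCluster k ℓ η)

/-- The test function `f`, computed on the restriction to `[-ℓ,ℓ]^d`. -/
def fTest (d k ℓ : ℕ) (η : Config d) : ℝ :=
  bpRightmost k ℓ (fillOutside (bigBox d ℓ) η)

/-- The event `B` : the bootstrap percolation cluster of the origin contains a
site of `ℓ^∞`-norm at least `ℓ - 1`. -/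
def Bevent (k ℓ : ℕ) (η : Config d) : Prop :=
  ∃ x ∈ bpCluster k ℓ η, ∃ i, (ℓ : ℤ) - 1 ≤ |x i|

set_option linter.all false
set_option linter.deprecated false

section
/-! ### basics -/

lemma adj_comm {x y : Site d} : adj x y ↔ adj y x := by
  unfold adj
  have : (∑ i, |x i - y i|) = ∑ i, |y i - x i| := Finset.sum_congr rfl fun i _ => abs_sub_comm _ _
  rw [this]

lemma adj_ne {x y : Site d} (h : adj x y) : x ≠ y := by
  rintro rfl
  simp [adj] at h

lemma adj_of_update {x : Site d} (i : Fin d) (s : ℤ) (hs : |s| = 1) :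
    adj x (Function.update x i (x i + s)) := by
  unfold adj
  rw [Finset.sum_eq_single i]
  · simp [hs]
  · intro j _ hj; simp [Function.update_of_ne hj]
  · simp

lemma adj_exists {x y : Site d} (h : adj x y) :
    ∃ i, |y i - x i| = 1 ∧ ∀ j, j ≠ i → y j = x j := by
  unfold adj at h
  have h1 : ∃ i, x i ≠ y i := by
    by_contra hc
    push Not at hc
    simp [hc] at h
  obtain ⟨i, hi⟩ := h1
  have hpos : 1 ≤ |x i - y i| := Int.one_le_abs (sub_ne_zero.2 hi)
  have hsplit := Finset.add_sum_erase Finset.univ (fun i => |x i - y i|) (Finset.mem_univ i)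
  have hnn : 0 ≤ ∑ j ∈ Finset.univ.erase i, |x j - y j| := Finset.sum_nonneg fun _ _ => abs_nonneg _
  have h2 : ∑ j ∈ Finset.univ.erase i, |x j - y j| = 0 := by omega
  refine ⟨i, by rw [abs_sub_comm]; omega, fun j hj => ?_⟩
  have := (Finset.sum_eq_zero_iff_of_nonneg (fun _ _ => abs_nonneg _)).1 h2 j
    (Finset.mem_erase.2 ⟨hj, Finset.mem_univ _⟩)
  have := abs_eq_zero.1 this
  omega

lemma mem_neighbors {x y : Site d} : y ∈ neighbors x ↔ adj x y := by
  unfold neighbors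
  simp only [Finset.mem_image, Finset.mem_univ, true_and, Prod.exists]
  constructor
  · rintro ⟨i, b, rfl⟩
    apply adj_of_update
    cases b <;> simp
  · intro h
    obtain ⟨i, hi, hj⟩ := adj_exists h
    rcases (abs_eq (by norm_num : (0:ℤ) ≤ 1)).1 hi with h1 | h1
    · refine ⟨i, true, ?_⟩
      funext j
      by_cases hji : j = i
      · subst hji; simp; omega
      · rw [Function.update_of_ne hji, hj j hji]
    · refine ⟨i, false, ?_⟩
      funext j
      by_cases hji : j = i
      · subst hji; simp; omega
      · rw [Function.update_of_ne hji, hj j hji]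

lemma constraint_two {η : Config d} {x y : Site d} :
    constraint 2 η x y ↔ (∃ z, adj x z ∧ z ≠ y ∧ η z = false) ∧
      (∃ z, adj y z ∧ z ≠ x ∧ η z = false) := by
  unfold constraint
  simp only [Nat.add_one_sub_one, Finset.one_le_card, Finset.Nonempty, Finset.mem_filter,
    mem_neighbors]

lemma constraint_comm {η : Config d} {x y : Site d} :
    constraint 2 η x y ↔ constraint 2 η y x := by
  rw [constraint_two, constraint_two, and_comm]

lemma swap_eq (η : Config d) (x y : Site d) : swap η x y = η ∘ Equiv.swap x y := by
  funext z
  simp only [swap, Function.comp, Equiv.swap_apply_def]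
  split_ifs <;> rfl

lemma swap_comm (η : Config d) (x y : Site d) : swap η x y = swap η y x := by
  rw [swap_eq, swap_eq, Equiv.swap_comm]

lemma swap_self (η : Config d) (x : Site d) : swap η x x = η := by
  rw [swap_eq]; simp

lemma swap_swap (η : Config d) (x y : Site d) : swap (swap η x y) x y = η := by
  rw [swap_eq, swap_eq]; funext z; simp

lemma swap_left (η : Config d) (x y : Site d) : swap η x y x = η y := by simp [swap]
lemma swap_right (η : Config d) (x y : Site d) : swap η x y y = η x := by
  rw [swap_comm]; simp [swap]
lemma swap_of_ne (η : Config d) {x y z : Site d} (h1 : z ≠ x) (h2 : z ≠ y) :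
    swap η x y z = η z := by simp [swap, h1, h2]

lemma swap_of_eq (η : Config d) {x y : Site d} (h : η x = η y) : swap η x y = η := by
  funext z
  by_cases h1 : z = x
  · subst h1; rw [swap_left, h]
  by_cases h2 : z = y
  · subst h2; rw [swap_right, h]
  rw [swap_of_ne _ h1 h2]

lemma constraint_swap {η : Config d} {x y : Site d} :
    constraint 2 (swap η x y) x y ↔ constraint 2 η x y := by
  rw [constraint_two, constraint_two]
  have : ∀ z, adj x z → z ≠ y → swap η x y z = η z := fun z h1 h2 =>
    swap_of_ne _ (adj_ne h1).symm h2
  have h' : ∀ z, adj y z → z ≠ x → swap η x y z = η z := fun z h1 h2 =>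
    swap_of_ne _ h2 (adj_ne h1).symm
  constructor
  · rintro ⟨⟨z, a, b, c⟩, ⟨w, a', b', c'⟩⟩
    exact ⟨⟨z, a, b, by rw [← this z a b, c]⟩, ⟨w, a', b', by rw [← h' w a' b', c']⟩⟩
  · rintro ⟨⟨z, a, b, c⟩, ⟨w, a', b', c'⟩⟩
    exact ⟨⟨z, a, b, by rw [this z a b, c]⟩, ⟨w, a', b', by rw [h' w a' b', c']⟩⟩

lemma adj_sub {x y v : Site d} : adj (x - v) (y - v) ↔ adj x y := by
  simp [adj]

lemma adj_add {x y v : Site d} : adj (x + v) (y + v) ↔ adj x y := by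
  simp [adj]

lemma constraint_shift {η : Config d} {x y v : Site d} :
    constraint 2 (shift (-v) η) (x - v) (y - v) ↔ constraint 2 η x y := by
  rw [constraint_two, constraint_two]
  constructor
  · rintro ⟨⟨z, a, b, c⟩, ⟨w, a', b', c'⟩⟩
    refine ⟨⟨z + v, ?_, fun h => b (by rw [← h]; simp), by simpa [shift] using c⟩,
      ⟨w + v, ?_, fun h => b' (by rw [← h]; simp), by simpa [shift] using c'⟩⟩
    · rw [← adj_sub (v := v)]; simpa using a
    · rw [← adj_sub (v := v)]; simpa using a'
  · rintro ⟨⟨z, a, b, c⟩, ⟨w, a', b', c'⟩⟩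
    refine ⟨⟨z - v, adj_sub.2 a, fun h => b (by simpa using h), by simpa [shift] using c⟩,
      ⟨w - v, adj_sub.2 a', fun h => b' (by simpa using h), by simpa [shift] using c'⟩⟩

lemma swap_shift {η : Config d} {x y v : Site d} :
    swap (shift (-v) η) (x - v) (y - v) = shift (-v) (swap η x y) := by
  funext z
  simp only [swap, shift]
  have h1 : z = x - v ↔ z - -v = x := by
    rw [sub_neg_eq_add, eq_sub_iff_add_eq]
  have h2 : z = y - v ↔ z - -v = y := by
    rw [sub_neg_eq_add, eq_sub_iff_add_eq]
  simp [h1, h2]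

lemma shift_shift {η : Config d} {x y : Site d} : shift x (shift y η) = shift (x + y) η := by
  funext z; simp only [shift]; congr 1; abel

/-! ### measure -/

lemma measurable_of_finite (S : Finset (Site d)) {α : Type*} [MeasurableSpace α]
    (f : Config d → α) (h : ∀ η η' : Config d, (∀ x ∈ S, η x = η' x) → f η = f η') :
    Measurable f := by
  have : f = (fun ζ : S → Bool => f (fun x => if hx : x ∈ S then ζ ⟨x, hx⟩ else true)) ∘
      S.restrict := by
    funext η
    apply h
    intro x hx
    simp [hx]
  rw [this]
  exact (_root_.measurable_of_finite _).comp (Finset.measurable_restrict S)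

lemma IsLocal.measurable {f : Config d → ℝ} (h : IsLocal f) : Measurable f := by
  obtain ⟨S, hS⟩ := h
  exact measurable_of_finite S f hS

lemma IsLocal.bounded {f : Config d → ℝ} (h : IsLocal f) : ∃ B : ℝ, 0 ≤ B ∧ ∀ η, |f η| ≤ B := by
  obtain ⟨S, hS⟩ := h
  let g : (S → Bool) → ℝ := fun ζ => |f (fun x => if hx : x ∈ S then ζ ⟨x, hx⟩ else true)|
  refine ⟨∑ ζ, g ζ, Finset.sum_nonneg fun _ _ => abs_nonneg _, fun η => ?_⟩
  have : |f η| = g (S.restrict η) := by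
    simp only [g]
    congr 1
    apply hS
    intro x hx
    simp [hx]
  rw [this]
  exact Finset.single_le_sum (f := g) (fun _ _ => abs_nonneg _) (Finset.mem_univ _)

lemma bern_unique {q : ℝ} {μ ν : Measure (Config d)} (hμ : IsBernoulliProduct q μ)
    (hν : IsBernoulliProduct q ν) : μ = ν := by
  haveI := hμ.1
  haveI := hν.1
  let P : (I : Finset (Site d)) → Measure ((i : I) → Bool) := fun I => μ.map I.restrict
  haveI : ∀ I, IsFiniteMeasure (P I) := fun I => by simp only [P]; infer_instance
  apply IsProjectiveLimit.unique (P := P)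
  · intro I; rfl
  · intro I
    simp only [P]
    apply Measure.ext_of_singleton
    intro ζ
    rw [Measure.map_apply (Finset.measurable_restrict I) (measurableSet_singleton ζ),
      Measure.map_apply (Finset.measurable_restrict I) (measurableSet_singleton ζ)]
    have : (I.restrict (π := fun _ => Bool)) ⁻¹' {ζ} = {η : Config d | ∀ x ∈ I, η x =
        (fun x => if hx : x ∈ I then ζ ⟨x, hx⟩ else true) x} := by
      ext η
      simp only [Set.mem_preimage, Set.mem_singleton_iff, Set.mem_setOf_eq]
      constructor
      · rintro rfl x hx
        simp [hx]
      · intro h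
        funext x
        have := h x.1 x.2
        simpa using this
    rw [this, hμ.2, hν.2]

/-- relabelling of sites as a measurable equivalence -/
def reidx (e : Site d ≃ Site d) : Config d ≃ᵐ Config d :=
  MeasurableEquiv.arrowCongr' e.symm (MeasurableEquiv.refl Bool)

@[simp] lemma reidx_apply (e : Site d ≃ Site d) (η : Config d) : reidx e η = η ∘ e := by
  rfl

lemma bern_map {q : ℝ} {μ : Measure (Config d)} (hμ : IsBernoulliProduct q μ)
    (e : Site d ≃ Site d) : μ.map (reidx e) = μ := by
  haveI := hμ.1
  apply bern_unique (q := q) _ hμ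
  refine ⟨Measure.isProbabilityMeasure_map (reidx e).measurable.aemeasurable, fun S ζ => ?_⟩
  rw [MeasurableEquiv.map_apply]
  have : (reidx e) ⁻¹' {η | ∀ x ∈ S, η x = ζ x} =
      {η | ∀ x ∈ S.map e.toEmbedding, η x = (ζ ∘ e.symm) x} := by
    ext η
    simp only [Set.mem_preimage, Set.mem_setOf_eq, reidx_apply, Finset.mem_map]
    constructor
    · rintro h x ⟨y, hy, rfl⟩
      simpa using h y hy
    · intro h x hx
      simpa using h (e x) ⟨x, hx, rfl⟩
  rw [this, hμ.2, Finset.prod_map]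
  simp

lemma lintegral_reidx {q : ℝ} {μ : Measure (Config d)} (hμ : IsBernoulliProduct q μ)
    (e : Site d ≃ Site d) (g : Config d → ℝ≥0∞) : ∫⁻ η, g (η ∘ e) ∂μ = ∫⁻ η, g η ∂μ := by
  conv_rhs => rw [← bern_map hμ e]
  rw [lintegral_map_equiv]
  simp

lemma shift_eq (v : Site d) (η : Config d) : shift v η = η ∘ (Equiv.subRight v) := by
  funext z; simp [shift]

lemma lintegral_shift {q : ℝ} {μ : Measure (Config d)} (hμ : IsBernoulliProduct q μ)
    (v : Site d) (g : Config d → ℝ≥0∞) : ∫⁻ η, g (shift v η) ∂μ = ∫⁻ η, g η ∂μ := by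
  simp_rw [shift_eq]; exact lintegral_reidx hμ _ g

lemma lintegral_swap {q : ℝ} {μ : Measure (Config d)} (hμ : IsBernoulliProduct q μ)
    (x y : Site d) (g : Config d → ℝ≥0∞) : ∫⁻ η, g (swap η x y) ∂μ = ∫⁻ η, g η ∂μ := by
  simp_rw [swap_eq]; exact lintegral_reidx hμ _ g

lemma measurableSet_finite (S : Finset (Site d)) (A : Set (Config d))
    (h : ∀ η η' : Config d, (∀ x ∈ S, η x = η' x) → (η ∈ A ↔ η' ∈ A)) : MeasurableSet A := by
  have := measurable_of_finite S (fun η => (η ∈ A : Prop)) (fun η η' hh => propext (h η η' hh))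
  exact measurableSet_setOf.2 this

lemma measurableSet_occ (x : Site d) (b : Bool) : MeasurableSet {η : Config d | η x = b} :=
  measurableSet_finite {x} _ (fun η η' h => by simp [h x (by simp)])

/-- restriction of `μ` to occupied origin is below `condOcc` -/
lemma restrict_le_condOcc {q : ℝ} {μ : Measure (Config d)} (hμ : IsBernoulliProduct q μ)
    (g : Config d → ℝ≥0∞) :
    ∫⁻ η, (if η origin = true then g η else 0) ∂μ ≤ ∫⁻ η, g η ∂(condOcc μ) := by
  haveI := hμ.1
  have h0 : MeasurableSet {η : Config d | η origin = true} := measurableSet_occ _ _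
  have : (fun η : Config d => if η origin = true then g η else 0) =
      Set.indicator {η : Config d | η origin = true} g := by
    funext η; simp [Set.indicator]
  rw [this, lintegral_indicator h0, condOcc, ProbabilityTheory.cond, lintegral_smul_measure]
  have h1 : 1 ≤ (μ {η : Config d | η origin = true})⁻¹ := by
    rw [ENNReal.one_le_inv]; exact prob_le_one
  calc _ = 1 * ∫⁻ η in {η : Config d | η origin = true}, g η ∂μ := by rw [one_mul]
    _ ≤ _ := by rw [smul_eq_mul]; gcongr
end

section
/-! ### edges and analytic bounds -/

/-- labelled test function -/
def lab (f : Config d → ℝ) (ω : Config d) (X : Site d) : ℝ :=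
  f (shift (-X) ω) - dotZ (e1R d) X

lemma dotZ_sub (u : Fin d → ℝ) (x y : Site d) : dotZ u (x - y) = dotZ u x - dotZ u y := by
  simp [dotZ, mul_sub, Finset.sum_sub_distrib]

lemma dotZ_add (u : Fin d → ℝ) (x y : Site d) : dotZ u (x + y) = dotZ u x + dotZ u y := by
  simp [dotZ, mul_add, Finset.sum_add_distrib]

def envG (f : Config d → ℝ) (X x y : Site d) (ω : Config d) : ℝ :=
  if ω X = true ∧ constraint 2 ω x y then |lab f (swap ω x y) X - lab f ω X| else 0

lemma envG_nonneg (f : Config d → ℝ) (X x y : Site d) (ω : Config d) : 0 ≤ envG f X x y ω := by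
  unfold envG; split_ifs <;> positivity

lemma measurable_shift (v : Site d) : Measurable (shift (d := d) v) := by
  have : shift (d := d) v = reidx (Equiv.subRight v) := by
    funext η; rw [shift_eq, reidx_apply]
  rw [this]; exact (reidx _).measurable

lemma measurable_swap (x y : Site d) : Measurable (fun η : Config d => swap η x y) := by
  have : (fun η : Config d => swap η x y) = reidx (Equiv.swap x y) := by
    funext η; rw [swap_eq, reidx_apply]
  rw [this]; exact (reidx _).measurable

lemma measurableSet_constraint (x y : Site d) :
    MeasurableSet {η : Config d | constraint 2 η x y} := by
  apply measurableSet_finite (neighbors x ∪ neighbors y)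
  intro η η' h
  simp only [Set.mem_setOf_eq, constraint_two]
  have h1 : ∀ z, adj x z → η z = η' z := fun z hz => h z (by simp [mem_neighbors, hz])
  have h2 : ∀ z, adj y z → η z = η' z := fun z hz => h z (by simp [mem_neighbors, hz])
  constructor
  · rintro ⟨⟨z, a, b, c⟩, ⟨w, a', b', c'⟩⟩
    exact ⟨⟨z, a, b, by rw [← h1 z a, c]⟩, ⟨w, a', b', by rw [← h2 w a', c']⟩⟩
  · rintro ⟨⟨z, a, b, c⟩, ⟨w, a', b', c'⟩⟩
    exact ⟨⟨z, a, b, by rw [h1 z a, c]⟩, ⟨w, a', b', by rw [h2 w a', c']⟩⟩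

lemma measurable_lab {f : Config d → ℝ} (hf : IsLocal f) (X : Site d) :
    Measurable (fun ω => lab f ω X) :=
  (hf.measurable.comp (measurable_shift _)).sub_const _

lemma measurable_envG {f : Config d → ℝ} (hf : IsLocal f) (X x y : Site d) :
    Measurable (envG f X x y) := by
  unfold envG
  apply Measurable.ite ((measurableSet_occ X true).inter (measurableSet_constraint x y))
  · exact measurable_norm.comp
      (((measurable_lab hf X).comp (measurable_swap x y)).sub (measurable_lab hf X))
  · exact measurable_const

lemma env_edge {q : ℝ} {μ : Measure (Config d)} (hμ : IsBernoulliProduct q μ)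
    (f : Config d → ℝ) {X x y : Site d} (hxy : adj x y) :
    ∫⁻ ω, ENNReal.ofReal (envG f X x y ω ^ 2) ∂μ ≤ energy 2 (e1R d) (condOcc μ) f := by
  -- reduce to `x ≠ X`
  wlog hx : x ≠ X generalizing x y
  · have hy : y ≠ X := by
      have h5 := adj_ne hxy
      push Not at hx
      subst hx; exact h5.symm
    have := this (adj_comm.1 hxy) hy
    refine le_trans (le_of_eq ?_) this
    congr 1; funext ω
    simp only [envG]
    rw [swap_comm ω x y]
    simp only [constraint_comm (x := x)]
  let g : Config d → ℝ≥0∞ := fun η => cval 2 η (x - X) (y - X) *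
    ENNReal.ofReal ((f (swap η (x - X) (y - X)) - f η) ^ 2)
  have h1 : ∫⁻ ω, ENNReal.ofReal (envG f X x y ω ^ 2) ∂μ =
      ∫⁻ η, (if η origin = true then g η else 0) ∂μ := by
    rw [← lintegral_shift hμ (-X) (fun η => if η origin = true then g η else 0)]
    congr 1; funext ω
    have h0 : shift (-X) ω origin = ω X := by
      simp only [shift]; congr 1; funext i; simp [origin]
    simp only [envG, g, cval, constraint_shift, swap_shift, h0]
    by_cases ha : ω X = true <;> by_cases hb : constraint 2 ω x y <;> simp [ha, hb, lab]
  rw [h1]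
  refine (restrict_le_condOcc hμ g).trans ?_
  unfold energy
  apply lintegral_mono
  intro η
  refine le_trans ?_ (le_add_right (le_refl (envTerm 2 f η)))
  unfold envTerm
  refine le_trans ?_ (ENNReal.le_tsum (x - X, y - X))
  have : x - X ≠ origin := by
    intro h; apply hx
    have : x - X = 0 := h
    exact sub_eq_zero.1 this
  simp only [g]
  rw [if_pos ⟨this, adj_sub.2 hxy⟩]

def tagG (f : Config d → ℝ) (X y : Site d) (ω : Config d) : ℝ :=
  if ω X = true ∧ constraint 2 ω X (X + y) then |lab f (swap ω X (X + y)) (X - y) - lab f ω X|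
  else 0

lemma tag_edge {q : ℝ} {μ : Measure (Config d)} (hμ : IsBernoulliProduct q μ)
    (f : Config d → ℝ) {X y : Site d} (hy : adj origin y) :
    ∫⁻ ω, ENNReal.ofReal (tagG f X y ω ^ 2) ∂μ ≤ energy 2 (e1R d) (condOcc μ) f := by
  let g : Config d → ℝ≥0∞ := fun η => cval 2 η origin y *
    ENNReal.ofReal ((dotZ (e1R d) y + f (shift y (swap η origin y)) - f η) ^ 2)
  have h1 : ∫⁻ ω, ENNReal.ofReal (tagG f X y ω ^ 2) ∂μ =
      ∫⁻ η, (if η origin = true then g η else 0) ∂μ := by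
    rw [← lintegral_shift hμ (-X) (fun η => if η origin = true then g η else 0)]
    congr 1; funext ω
    have h0 : shift (-X) ω origin = ω X := by
      simp only [shift]; congr 1; funext i; simp [origin]
    have e1 : (origin : Site d) = X - X := by simp; rfl
    have e2 : y = (X + y) - X := by simp
    have hc : constraint 2 (shift (-X) ω) origin y ↔ constraint 2 ω X (X + y) := by
      have := constraint_shift (η := ω) (x := X) (y := X + y) (v := X)
      rwa [← e1, ← e2] at this
    have hs : swap (shift (-X) ω) origin y = shift (-X) (swap ω X (X + y)) := by
      have := swap_shift (η := ω) (x := X) (y := X + y) (v := X)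
      rwa [← e1, ← e2] at this
    simp only [tagG, g, cval, hc, hs, h0]
    by_cases ha : ω X = true <;> by_cases hb : constraint 2 ω X (X + y) <;> simp [ha, hb]
    congr 2
    simp only [lab, shift_shift, dotZ_sub]
    rw [show y + -X = -(X - y) by abel]
    ring
  rw [h1]
  refine (restrict_le_condOcc hμ g).trans ?_
  unfold energy
  apply lintegral_mono
  intro η
  refine le_trans ?_ (le_add_left (le_refl (tagTerm 2 (e1R d) f η)))
  unfold tagTerm
  refine le_trans ?_ (ENNReal.le_tsum y)
  simp only [g]
  rw [if_pos hy]

/-! ### chains of legal moves with bounded deviation -/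

def app (ω : Config d) (l : List (Site d × Site d)) : Config d :=
  l.foldl (fun η p => swap η p.1 p.2) ω

def Near (U : Finset (Site d)) (r : ℕ) (ω ω' : Config d) : Prop :=
  ∃ l : List (Site d × Site d), l.length ≤ r ∧ (∀ p ∈ l, p.1 ∈ U ∧ p.2 ∈ U) ∧ ω' = app ω l

def Step (U : Finset (Site d)) (ω ω' : Config d) : Prop :=
  ∃ x ∈ U, ∃ y ∈ U, adj x y ∧ constraint 2 ω x y ∧ ω' = swap ω x y

def Conn (U : Finset (Site d)) (r : ℕ) (ω ω' : Config d) : Prop :=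
  Relation.ReflTransGen (fun a b => Step U a b ∧ Near U r ω a ∧ Near U r ω b) ω ω'

def Lists (U : Finset (Site d)) : ℕ → Finset (List (Site d × Site d))
  | 0 => {[]}
  | r + 1 => insert [] (Finset.image (fun p : (Site d × Site d) × List (Site d × Site d) =>
      p.1 :: p.2) ((U ×ˢ U) ×ˢ Lists U r))

lemma card_Lists (U : Finset (Site d)) (r : ℕ) : (Lists U r).card ≤ (U.card ^ 2 + 1) ^ r := by
  induction r with
  | zero => simp [Lists]
  | succ r ih =>
    unfold Lists
    refine (Finset.card_insert_le _ _).trans ?_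
    have h1 := Finset.card_image_le (s := (U ×ˢ U) ×ˢ Lists U r)
      (f := fun p : (Site d × Site d) × List (Site d × Site d) => p.1 :: p.2)
    rw [Finset.card_product, Finset.card_product] at h1
    have h2 : 1 ≤ (U.card ^ 2 + 1) ^ r := Nat.one_le_pow _ _ (by positivity)
    calc _ ≤ U.card * U.card * (Lists U r).card + 1 := by omega
      _ ≤ U.card * U.card * (U.card ^ 2 + 1) ^ r + (U.card ^ 2 + 1) ^ r := by gcongr
      _ = _ := by ring

lemma mem_Lists {U : Finset (Site d)} {r : ℕ} {l : List (Site d × Site d)}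
    (h : l.length ≤ r) (h2 : ∀ p ∈ l, p.1 ∈ U ∧ p.2 ∈ U) : l ∈ Lists U r := by
  induction r generalizing l with
  | zero =>
    have : l = [] := by simpa using h
    simp [Lists, this]
  | succ r ih =>
    unfold Lists
    cases l with
    | nil => simp
    | cons a l =>
      simp only [Finset.mem_insert, Finset.mem_image, Finset.mem_product]
      right
      refine ⟨(a, l), ⟨h2 a (by simp), ih (by simpa using h) fun p hp => h2 p (by simp [hp])⟩, rfl⟩

lemma lists_mem {U : Finset (Site d)} {r : ℕ} {l : List (Site d × Site d)}
    (h : l ∈ Lists U r) : ∀ p ∈ l, p.1 ∈ U ∧ p.2 ∈ U := by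
  induction r generalizing l with
  | zero => simp [Lists] at h; simp [h]
  | succ r ih =>
    unfold Lists at h
    simp only [Finset.mem_insert, Finset.mem_image, Finset.mem_product] at h
    rcases h with rfl | ⟨⟨a, l'⟩, ⟨ha, hl⟩, rfl⟩
    · simp
    · intro p hp
      rcases List.mem_cons.1 hp with rfl | hp
      · exact ha
      · exact ih hl p hp

lemma lintegral_app {q : ℝ} {μ : Measure (Config d)} (hμ : IsBernoulliProduct q μ)
    (l : List (Site d × Site d)) (g : Config d → ℝ≥0∞) :
    ∫⁻ η, g (app η l) ∂μ = ∫⁻ η, g η ∂μ := by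
  induction l with
  | nil => rfl
  | cons p l ih => exact (lintegral_swap hμ p.1 p.2 (fun η => g (app η l))).trans ih

lemma measurable_app (l : List (Site d × Site d)) : Measurable (fun η : Config d => app η l) := by
  induction l with
  | nil => exact measurable_id
  | cons p l ih => exact ih.comp (measurable_swap p.1 p.2)

lemma app_of_notMem {X : Site d} (l : List (Site d × Site d)) (ω : Config d)
    (h : ∀ p ∈ l, p.1 ≠ X ∧ p.2 ≠ X) : app ω l X = ω X := by
  induction l generalizing ω with
  | nil => rfl
  | cons p l ih =>
    have := ih (swap ω p.1 p.2) (fun p hp => h p (by simp [hp]))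
    have h1 := h p (by simp)
    exact this.trans (swap_of_ne _ h1.1.symm h1.2.symm)

/-- a chain inside a finite set of states: last exit decomposition -/
lemma chain_bound {α : Type*} (F : α → ℝ) (G : α → ℝ) (hG : ∀ a, 0 ≤ G a) (R : α → α → Prop)
    (hR : ∀ a b, R a b → |F a - F b| ≤ G a) (n : ℕ) :
    ∀ (V : Finset α), V.card = n → ∀ a b, a ∈ V → b ∈ V →
      Relation.ReflTransGen (fun s t => R s t ∧ s ∈ V ∧ t ∈ V) a b →
      |F a - F b| ≤ ∑ s ∈ V, G s := by
  induction n with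
  | zero => intro V hV a b ha; simp at hV; simp [hV] at ha
  | succ n ih =>
    intro V hV a b ha hb hc
    by_cases hab : a = b
    · subst hab; simp; exact Finset.sum_nonneg fun _ _ => hG _
    have key : ∀ x, Relation.ReflTransGen (fun s t => R s t ∧ s ∈ V ∧ t ∈ V) x b →
        (x ≠ a ∧ Relation.ReflTransGen (fun s t => R s t ∧ s ∈ V.erase a ∧ t ∈ V.erase a) x b) ∨
        ∃ t, R a t ∧ t ∈ V.erase a ∧
          Relation.ReflTransGen (fun s t => R s t ∧ s ∈ V.erase a ∧ t ∈ V.erase a) t b := by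
      intro x hx
      induction hx using Relation.ReflTransGen.head_induction_on with
      | refl => left; exact ⟨Ne.symm hab, .refl⟩
      | head h1 h2 ih2 =>
        rename_i x y
        rcases ih2 with ⟨h3, h4⟩ | h5
        · by_cases hxa : x = a
          · subst hxa
            right; exact ⟨y, h1.1, Finset.mem_erase.2 ⟨h3, h1.2.2⟩, h4⟩
          · left
            exact ⟨hxa, .head ⟨h1.1, Finset.mem_erase.2 ⟨hxa, h1.2.1⟩,
              Finset.mem_erase.2 ⟨h3, h1.2.2⟩⟩ h4⟩
        · right; exact h5
    rcases key a hc with ⟨h, _⟩ | ⟨t, h1, h2, h3⟩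
    · exact absurd rfl h
    · have h4 := ih (V.erase a) (by rw [Finset.card_erase_of_mem ha, hV]; rfl) t b h2
        (Finset.mem_erase.2 ⟨Ne.symm hab, hb⟩) h3
      rw [← Finset.add_sum_erase V G ha]
      calc |F a - F b| ≤ |F a - F t| + |F t - F b| := abs_sub_le _ _ _
        _ ≤ _ := add_le_add (hR _ _ h1) h4

lemma Near.refl (U : Finset (Site d)) (r : ℕ) (ω : Config d) : Near U r ω ω :=
  ⟨[], by simp, by simp, rfl⟩

lemma conn_pointwise {U : Finset (Site d)} {r : ℕ} {X : Site d} (hX : X ∉ U)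
    (f : Config d → ℝ) {ω ω' : Config d} (h : Conn U r ω ω') (hω : ω X = true) :
    |lab f ω' X - lab f ω X| ≤
      ∑ l ∈ Lists U r, ∑ p ∈ (U ×ˢ U).filter (fun p => adj p.1 p.2), envG f X p.1 p.2 (app ω l) := by
  set G : Config d → ℝ := fun η => ∑ p ∈ (U ×ˢ U).filter (fun p => adj p.1 p.2), envG f X p.1 p.2 η
    with hGd
  have hG : ∀ η, 0 ≤ G η := fun η => Finset.sum_nonneg fun _ _ => envG_nonneg _ _ _ _ _
  set V := (Lists U r).image (fun l => app ω l) with hV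
  have hXV : ∀ η ∈ V, η X = true := by
    intro η hη
    obtain ⟨l, hl, rfl⟩ := Finset.mem_image.1 hη
    rw [app_of_notMem, hω]
    intro p hp
    have := lists_mem hl p hp
    exact ⟨fun h => hX (h ▸ this.1), fun h => hX (h ▸ this.2)⟩
  have hnear : ∀ η, Near U r ω η → η ∈ V := by
    rintro η ⟨l, h1, h2, rfl⟩
    exact Finset.mem_image.2 ⟨l, mem_Lists h1 h2, rfl⟩
  have hω' : ω' ∈ V := by
    cases h.cases_tail with
    | inl h => subst h; exact hnear _ (Near.refl _ _ _)
    | inr h => obtain ⟨c, _, h⟩ := h; exact hnear _ h.2.2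
  have := chain_bound (fun η => lab f η X) G hG (fun a b => Step U a b ∧ a X = true) ?_ _ V rfl
    ω ω' (hnear _ (Near.refl _ _ _)) hω' ?_
  · rw [abs_sub_comm]
    refine this.trans ?_
    exact Finset.sum_image_le_of_nonneg fun η hη => hG _
  · rintro a b ⟨⟨x, hx, y, hy, hadj, hc, rfl⟩, ha⟩
    rw [abs_sub_comm]
    have : |lab f (swap a x y) X - lab f a X| = envG f X x y a := by simp [envG, ha, hc]
    rw [this]
    exact Finset.single_le_sum (f := fun p : Site d × Site d => envG f X p.1 p.2 a)
      (fun _ _ => envG_nonneg _ _ _ _ _) (a := (x, y)) (by simp [hx, hy, hadj])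
  · refine Relation.ReflTransGen.mono (fun a b hab => ?_) _ _ h
    obtain ⟨h1, h2, h3⟩ := hab
    exact ⟨⟨h1, hXV _ (hnear _ h2)⟩, hnear _ h2, hnear _ h3⟩

/-- cost constant of a chain -/
def cost (u r : ℕ) : ℕ := ((u ^ 2 + 1) ^ (r + 1)) ^ 2

lemma sq_sum_sum_le {ι κ : Type*} (s : Finset ι) (t : Finset κ) (g : ι → κ → ℝ) :
    (∑ i ∈ s, ∑ j ∈ t, g i j) ^ 2 ≤ (s.card * t.card : ℕ) * ∑ i ∈ s, ∑ j ∈ t, g i j ^ 2 := by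
  rw [← Finset.sum_product', ← Finset.sum_product', ← Finset.card_product]
  exact sq_sum_le_card_mul_sum_sq

lemma conn_bound {q : ℝ} {μ : Measure (Config d)} (hμ : IsBernoulliProduct q μ)
    {f : Config d → ℝ} (hf : IsLocal f) {U : Finset (Site d)} {r : ℕ} {X : Site d} (hX : X ∉ U)
    (Ev : Set (Config d)) (tgt : Config d → Config d)
    (h : ∀ ω ∈ Ev, ω X = true ∧ Conn U r ω (tgt ω)) :
    ∫⁻ ω, (if ω ∈ Ev then ENNReal.ofReal ((lab f (tgt ω) X - lab f ω X) ^ 2) else 0) ∂μ ≤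
      cost U.card r * energy 2 (e1R d) (condOcc μ) f := by
  set P := (U ×ˢ U).filter (fun p => adj p.1 p.2) with hP
  set L := Lists U r with hL
  have hPc : P.card ≤ U.card ^ 2 + 1 := by
    refine (Finset.card_filter_le _ _).trans ?_
    rw [Finset.card_product]; nlinarith
  have hLc : L.card ≤ (U.card ^ 2 + 1) ^ r := card_Lists U r
  calc _ ≤ ∫⁻ ω, ((L.card * P.card : ℕ) : ℝ≥0∞) *
        ∑ l ∈ L, ∑ p ∈ P, ENNReal.ofReal (envG f X p.1 p.2 (app ω l) ^ 2) ∂μ := by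
        apply lintegral_mono
        intro ω
        simp only
        split_ifs with hω
        · obtain ⟨h1, h2⟩ := h ω hω
          have h3 := conn_pointwise hX f h2 h1
          have h4 : (lab f (tgt ω) X - lab f ω X) ^ 2 ≤
              (L.card * P.card : ℕ) * ∑ l ∈ L, ∑ p ∈ P, envG f X p.1 p.2 (app ω l) ^ 2 := by
            refine le_trans ?_ (sq_sum_sum_le L P _)
            rw [← sq_abs]
            exact pow_le_pow_left₀ (abs_nonneg _) h3 2
          refine (ENNReal.ofReal_le_ofReal h4).trans (le_of_eq ?_)
          rw [ENNReal.ofReal_mul (by positivity), ENNReal.ofReal_natCast,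
            ENNReal.ofReal_sum_of_nonneg (fun _ _ => Finset.sum_nonneg fun _ _ => sq_nonneg _)]
          congr 1
          apply Finset.sum_congr rfl
          intro l _
          rw [ENNReal.ofReal_sum_of_nonneg (fun _ _ => sq_nonneg _)]
        · exact zero_le
    _ = ((L.card * P.card : ℕ) : ℝ≥0∞) * ∑ l ∈ L, ∑ p ∈ P,
        ∫⁻ ω, ENNReal.ofReal (envG f X p.1 p.2 (app ω l) ^ 2) ∂μ := by
        have hm : ∀ l p, Measurable fun ω =>
            ENNReal.ofReal (envG f X (p : Site d × Site d).1 p.2 (app ω l) ^ 2) := fun l p =>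
          (((measurable_envG hf X p.1 p.2).comp (measurable_app l)).pow_const 2).ennreal_ofReal
        rw [lintegral_const_mul _ (Finset.measurable_sum _ fun l _ =>
          Finset.measurable_sum _ fun p _ => hm l p),
          lintegral_finset_sum _ (fun l _ => Finset.measurable_sum _ fun p _ => hm l p)]
        congr 1
        apply Finset.sum_congr rfl
        intro l _
        rw [lintegral_finset_sum _ (fun p _ => hm l p)]
    _ ≤ ((L.card * P.card : ℕ) : ℝ≥0∞) * ∑ l ∈ L, ∑ p ∈ P, energy 2 (e1R d) (condOcc μ) f := by
        gcongr with l hl p hp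
        rw [lintegral_app hμ l (fun ω => ENNReal.ofReal (envG f X p.1 p.2 ω ^ 2))]
        exact env_edge hμ f (Finset.mem_filter.1 hp).2
    _ = ((L.card * P.card : ℕ) : ℝ≥0∞) * ((L.card * P.card : ℕ) : ℝ≥0∞) *
        energy 2 (e1R d) (condOcc μ) f := by
        simp only [Finset.sum_const, nsmul_eq_mul]; push_cast; ring
    _ ≤ _ := by
        gcongr
        rw [← Nat.cast_mul]
        gcongr
        unfold cost
        have : L.card * P.card ≤ (U.card ^ 2 + 1) ^ (r + 1) := by
          rw [pow_succ]; exact Nat.mul_le_mul hLc hPc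
        rw [sq]; exact Nat.mul_le_mul this this
end

section
/-! ### calculus of chains -/

lemma app_append (ω : Config d) (l l' : List (Site d × Site d)) :
    app ω (l ++ l') = app (app ω l) l' := by simp [app, List.foldl_append]

lemma app_cons (ω : Config d) (p : Site d × Site d) (l : List (Site d × Site d)) :
    app ω (p :: l) = app (swap ω p.1 p.2) l := rfl

lemma Near.trans {U : Finset (Site d)} {a b : ℕ} {ω σ τ : Config d} (h : Near U a ω σ)
    (h' : Near U b σ τ) : Near U (a + b) ω τ := by
  obtain ⟨l, h1, h2, rfl⟩ := h
  obtain ⟨l', h1', h2', rfl⟩ := h'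
  refine ⟨l ++ l', by simp; omega, ?_, (app_append _ _ _).symm⟩
  intro p hp
  rcases List.mem_append.1 hp with h | h
  · exact h2 p h
  · exact h2' p h

lemma Near.mono {U V : Finset (Site d)} {a b : ℕ} {ω σ : Config d} (h : Near U a ω σ)
    (hab : a ≤ b) (hUV : U ⊆ V) : Near V b ω σ := by
  obtain ⟨l, h1, h2, rfl⟩ := h
  exact ⟨l, h1.trans hab, fun p hp => ⟨hUV (h2 p hp).1, hUV (h2 p hp).2⟩, rfl⟩

lemma near_swap {U : Finset (Site d)} {ω : Config d} {x y : Site d} (hx : x ∈ U) (hy : y ∈ U) :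
    Near U 1 ω (swap ω x y) := ⟨[(x, y)], by simp, by simp [hx, hy], rfl⟩

/-- chains with deviation measured from a base -/
def Chain (U : Finset (Site d)) (r : ℕ) (ω s t : Config d) : Prop :=
  Relation.ReflTransGen (fun a b => Step U a b ∧ Near U r ω a ∧ Near U r ω b) s t

lemma Conn.chain {U : Finset (Site d)} {r : ℕ} {ω ω' : Config d} (h : Conn U r ω ω') :
    Chain U r ω ω ω' := h

lemma Chain.trans {U : Finset (Site d)} {r : ℕ} {ω a b c : Config d} (h : Chain U r ω a b)
    (h' : Chain U r ω b c) : Chain U r ω a c := Relation.ReflTransGen.trans h h'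

lemma Step.symm {U : Finset (Site d)} {a b : Config d} (h : Step U a b) : Step U b a := by
  obtain ⟨x, hx, y, hy, h1, h2, rfl⟩ := h
  exact ⟨x, hx, y, hy, h1, constraint_swap.2 h2, (swap_swap _ _ _).symm⟩

lemma Chain.symm {U : Finset (Site d)} {r : ℕ} {ω a b : Config d} (h : Chain U r ω a b) :
    Chain U r ω b a := by
  have : Std.Symm (fun a b => Step U a b ∧ Near U r ω a ∧ Near U r ω b) :=
    ⟨fun a b ⟨h1, h2, h3⟩ => ⟨h1.symm, h3, h2⟩⟩
  exact (Relation.ReflTransGen.symmetric (r := fun a b => Step U a b ∧ Near U r ω a ∧ Near U r ω b)).symm _ _ h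

lemma Chain.rebase {U : Finset (Site d)} {r b R : ℕ} {ω σ s t : Config d} (h : Chain U r σ s t)
    (hn : Near U b ω σ) (hR : b + r ≤ R) : Chain U R ω s t := by
  refine Relation.ReflTransGen.mono (fun x y hxy => ?_) _ _ h
  exact ⟨hxy.1, (hn.trans hxy.2.1).mono hR (Finset.Subset.refl _),
    (hn.trans hxy.2.2).mono hR (Finset.Subset.refl _)⟩

lemma Chain.mono {U : Finset (Site d)} {r R : ℕ} {ω s t : Config d} (h : Chain U r ω s t)
    (hR : r ≤ R) : Chain U R ω s t := h.rebase (Near.refl U 0 ω) (by omega)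

lemma Chain.single {U : Finset (Site d)} {r : ℕ} {ω s : Config d} {x y : Site d}
    (hx : x ∈ U) (hy : y ∈ U) (ha : adj x y) (hc : constraint 2 s x y)
    (h1 : Near U r ω s) : Chain U (r + 1) ω s (swap s x y) :=
  Relation.ReflTransGen.single ⟨⟨x, hx, y, hy, ha, hc, rfl⟩, h1.mono (by omega) (Finset.Subset.refl _),
    h1.trans (near_swap hx hy)⟩

def Holes (Q : Set (Site d)) (ω : Config d) : Prop := ∀ z ∈ Q, ω z = false

def Ex (U : Finset (Site d)) (r : ℕ) (Q D : Set (Site d)) : Prop :=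
  ∀ ω, Holes Q ω → ∀ x ∈ D, ∀ y ∈ D, Conn U r ω (swap ω x y)

lemma Holes.swap {Q : Set (Site d)} {ω : Config d} (h : Holes Q ω) {x y : Site d}
    (hx : x ∉ Q) (hy : y ∉ Q) : Holes Q (KA.swap ω x y) := by
  intro z hz
  rw [KA.swap_of_ne ω (x := x) (y := y) (z := z) (by rintro rfl; exact hx hz) (by rintro rfl; exact hy hz)]
  exact h z hz

lemma Holes.swap' {Q : Set (Site d)} {ω : Config d} (h : Holes Q ω) {x y : Site d}
    (hx : ω x = false) (hy : ω y = false) : Holes Q (KA.swap ω x y) := by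
  rw [swap_of_eq _ (by rw [hx, hy])]; exact h

lemma Holes.app {Q : Set (Site d)} {ω : Config d} (h : Holes Q ω) {l : List (Site d × Site d)}
    (hl : ∀ p ∈ l, p.1 ∉ Q ∧ p.2 ∉ Q) : Holes Q (app ω l) := by
  induction l generalizing ω with
  | nil => exact h
  | cons p l ih =>
    exact ih (h.swap (hl p (by simp)).1 (hl p (by simp)).2) fun p hp => hl p (by simp [hp])

lemma Holes.mono {Q Q' : Set (Site d)} {ω : Config d} (h : Holes Q ω) (hq : Q' ⊆ Q) :
    Holes Q' ω := fun z hz => h z (hq hz)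

lemma swap_swap_comm (ω : Config d) {x y p q : Site d} (h1 : x ≠ p) (h2 : x ≠ q) (h3 : y ≠ p)
    (h4 : y ≠ q) : swap (swap ω x y) p q = swap (swap ω p q) x y := by
  funext z
  simp only [swap]
  split_ifs <;> simp_all

lemma app_swap_comm (ω : Config d) {x y : Site d} {l : List (Site d × Site d)}
    (h : ∀ p ∈ l, x ≠ p.1 ∧ x ≠ p.2 ∧ y ≠ p.1 ∧ y ≠ p.2) :
    app (swap ω x y) l = swap (app ω l) x y := by
  induction l generalizing ω with
  | nil => rfl
  | cons p l ih =>
    rw [app_cons, app_cons, ← ih _ fun p hp => h p (by simp [hp])]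
    obtain ⟨h1, h2, h3, h4⟩ := h p (by simp)
    rw [swap_swap_comm _ h1 h2 h3 h4]

/-- conjugation by a list, then a single legal swap -/
lemma conj_step {U : Finset (Site d)} {ρ m : ℕ} {ω : Config d} {x y : Site d}
    {l : List (Site d × Site d)} (hlU : ∀ p ∈ l, p.1 ∈ U ∧ p.2 ∈ U) (hlen : l.length ≤ m)
    (hmρ : m ≤ ρ)
    (hl : ∀ p ∈ l, x ≠ p.1 ∧ x ≠ p.2 ∧ y ≠ p.1 ∧ y ≠ p.2)
    (hx : x ∈ U) (hy : y ∈ U) (ha : adj x y) (hc : constraint 2 (app ω l) x y)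
    (h1 : Chain U ρ ω ω (app ω l))
    (h2 : Chain U ρ (swap ω x y) (swap ω x y) (app (swap ω x y) l)) :
    Conn U (ρ + 1) ω (swap ω x y) := by
  have hn : Near U m ω (app ω l) := ⟨l, hlen, hlU, rfl⟩
  have c1 : Chain U (ρ + 1) ω ω (app ω l) := h1.mono (by omega)
  have c2 : Chain U (ρ + 1) ω (app ω l) (swap (app ω l) x y) :=
    (Chain.single hx hy ha hc hn).mono (by omega)
  have c3 : Chain U (ρ + 1) ω (app (swap ω x y) l) (swap ω x y) :=
    h2.symm.rebase (near_swap hx hy) (by omega)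
  rw [app_swap_comm ω hl] at c3
  exact (c1.trans c2).trans c3

/-! ### relay -/

section relay
variable {U : Finset (Site d)} {ρ : ℕ} {L : Set (Site d)} {G : Set (Config d)}

lemma relay_run (hLU : ∀ z ∈ L, z ∈ U) (hG : ∀ σ ∈ G, ∀ x ∈ L, ∀ y ∈ L, swap σ x y ∈ G)
    (hadj : ∀ σ ∈ G, ∀ x ∈ L, ∀ y ∈ L, adj x y → Conn U ρ σ (swap σ x y))
    {ω σ : Config d} (hσ : σ ∈ G) (hn : Near U 1 ω σ) (f : ℕ → Site d) (u : Bool) (n i j : ℕ)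
    (hij : i + n = j)
    (hf : ∀ k, i ≤ k → k ≤ j → f k ∈ L) (hfa : ∀ k, i ≤ k → k < j → adj (f k) (f (k + 1)))
    (hu : ∀ k, i ≤ k → k < j → σ (f k) = u) (hj : σ (f j) = !u) :
    Chain U (ρ + 2) ω σ (swap σ (f i) (f j)) := by
  induction n generalizing i with
  | zero =>
    simp at hij; subst hij
    rw [swap_self]; exact .refl
  | succ n ih =>
    have h1 := ih (i + 1) (by omega) (fun k hk => hf k (by omega)) (fun k hk => hfa k (by omega))
      (fun k hk => hu k (by omega))
    refine h1.trans ?_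
    set σ' := swap σ (f (i + 1)) (f j) with hσ'
    have hi : f i ∈ L := hf i le_rfl (by omega)
    have hi1 : f (i + 1) ∈ L := hf _ (by omega) (by omega)
    have hjL : f j ∈ L := hf j (by omega) le_rfl
    have hσ'G : σ' ∈ G := hG _ hσ _ hi1 _ hjL
    have hn' : Near U 2 ω σ' := hn.trans (near_swap (hLU _ hi1) (hLU _ hjL))
    have h2 := (hadj σ' hσ'G _ hi _ hi1 (hfa i le_rfl (by omega))).chain.rebase hn'
      (show 2 + ρ ≤ ρ + 2 by omega)
    have e : swap σ' (f i) (f (i + 1)) = swap σ (f i) (f j) := by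
      have hui := hu i le_rfl (by omega)
      have hne1 : f i ≠ f (i + 1) := adj_ne (hfa i le_rfl (by omega))
      have hne2 : f i ≠ f j := by intro h; rw [h, hj] at hui; simp at hui
      by_cases hc : i + 1 = j
      · rw [hσ', hc, swap_self]
      · have hui1 := hu (i + 1) (by omega) (by omega)
        have hne3 : f (i + 1) ≠ f j := by intro h; rw [h, hj] at hui1; simp at hui1
        rw [hσ']
        funext z
        simp only [swap]
        split_ifs <;> simp_all
    rwa [e] at h2

lemma relay_aux {ω : Config d} {a x y : Site d} {u : Bool} (ha : ω a = u) (hne : y ≠ x)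
    (hx : ω x = (!u) ∨ x = a) (hy : ω y = (!u) ∨ y = a) :
    swap (swap ω a x) x y = swap ω a y := by
  rcases hx with hx | rfl
  · rcases hy with hy | rfl
    · have h1 : x ≠ a := by rintro rfl; rw [hx] at ha; simp at ha
      have h2 : y ≠ a := by rintro rfl; rw [hy] at ha; simp at ha
      funext z
      by_cases z1 : z = x
      · subst z1
        rw [swap_left, swap_of_ne _ h2 hne, swap_of_ne _ h1 hne.symm, hx, hy]
      · by_cases z2 : z = y
        · subst z2; rw [swap_right, swap_right, swap_right]
        · rw [swap_of_ne _ z1 z2]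
          by_cases z3 : z = a
          · subst z3; rw [swap_left, swap_left, hx, hy]
          · rw [swap_of_ne _ z3 z1, swap_of_ne _ z3 z2]
    · rw [swap_comm _ x y, swap_swap, swap_self]
  · rw [swap_self]

lemma relay_main (hLU : ∀ z ∈ L, z ∈ U) (hG : ∀ σ ∈ G, ∀ x ∈ L, ∀ y ∈ L, swap σ x y ∈ G)
    (hadj : ∀ σ ∈ G, ∀ x ∈ L, ∀ y ∈ L, adj x y → Conn U ρ σ (swap σ x y))
    {ω : Config d} (hω : ω ∈ G) (f : ℕ → Site d) (m : ℕ)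
    (hf : ∀ k ≤ m, f k ∈ L) (hfa : ∀ k < m, adj (f k) (f (k + 1))) :
    Conn U (ρ + 2) ω (swap ω (f 0) (f m)) := by
  by_cases hne : ω (f 0) = ω (f m)
  · rw [swap_of_eq _ hne]; exact Relation.ReflTransGen.refl
  set u := ω (f 0) with hu
  have hm : ω (f m) = !u := by revert hne; cases u <;> cases ω (f m) <;> simp
  have key : ∀ n i, i + n = m → (ω (f i) = (!u) ∨ f i = f 0) →
      Chain U (ρ + 2) ω (swap ω (f 0) (f i)) (swap ω (f 0) (f m)) := by
    intro n
    induction n using Nat.strong_induction_on with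
    | _ n ih =>
      intro i hi hv
      set σ := swap ω (f 0) (f i) with hσ
      have hσi : σ (f i) = u := by rw [hσ, swap_right]
      by_cases hmi : f m = f i
      · rw [hmi]; exact .refl
      have hσm : σ (f m) = !u := by
        rw [hσ, swap_of_ne _ _ hmi, hm]
        intro h; rw [h, ← hu] at hm; simp at hm
      have hex : ∃ k, i + k ≤ m ∧ σ (f (i + k)) = !u := ⟨n, by omega, by rw [hi]; exact hσm⟩
      set k := Nat.find hex with hk
      have hk1 : i + k ≤ m := (Nat.find_spec hex).1
      have hk2 : σ (f (i + k)) = !u := (Nat.find_spec hex).2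
      have hk3 : ∀ k' < k, σ (f (i + k')) = u := by
        intro k' hk'
        have := Nat.find_min hex hk'
        simp only [not_and] at this
        have h2 := this (by omega)
        revert h2; cases σ (f (i + k')) <;> cases u <;> simp
      have hkpos : 0 < k := by
        rcases Nat.eq_zero_or_pos k with h | h
        · rw [h] at hk2; simp [hσi] at hk2
        · exact h
      have hf0 : f 0 ∈ L := hf 0 (by omega)
      have hfi : f i ∈ L := hf i (by omega)
      have hrun := relay_run hLU hG hadj (hG _ hω _ hf0 _ hfi)
        (near_swap (hLU _ hf0) (hLU _ hfi)) f u k i (i + k) rfl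
        (fun k' _ h2 => hf k' (by omega)) (fun k' _ h2 => hfa k' (by omega))
        (fun k' h1 h2 => by
          have := hk3 (k' - i) (by omega)
          rwa [show i + (k' - i) = k' by omega] at this) hk2
      have hne' : f (i + k) ≠ f i := by
        intro h; rw [h, hσi] at hk2; simp at hk2
      have hval : ω (f (i + k)) = (!u) ∨ f (i + k) = f 0 := by
        by_cases h0 : f (i + k) = f 0
        · right; exact h0
        · left; rw [hσ, swap_of_ne _ h0 hne'] at hk2; exact hk2
      have e : swap (swap ω (f 0) (f i)) (f i) (f (i + k)) = swap ω (f 0) (f (i + k)) := by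
        exact relay_aux hu.symm hne' hv hval
      rw [e] at hrun
      exact hrun.trans (ih (n - k) (by omega) (i + k) (by omega) hval)
  have := key m 0 (by omega) (Or.inr rfl)
  rwa [swap_self] at this

def LConn (L : Set (Site d)) : Prop :=
  ∀ x ∈ L, ∀ y ∈ L, Relation.ReflTransGen (fun a b => adj a b ∧ a ∈ L ∧ b ∈ L) x y

lemma path_of_rtg {x y : Site d} (hx : x ∈ L)
    (h : Relation.ReflTransGen (fun a b => adj a b ∧ a ∈ L ∧ b ∈ L) x y) :
    ∃ (f : ℕ → Site d) (m : ℕ), f 0 = x ∧ f m = y ∧ (∀ k ≤ m, f k ∈ L) ∧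
      ∀ k < m, adj (f k) (f (k + 1)) := by
  induction h with
  | refl => exact ⟨fun _ => x, 0, rfl, rfl, fun _ _ => hx, by simp⟩
  | tail h1 h2 ih =>
    rename_i b c
    obtain ⟨f, m, h3, h4, h5, h6⟩ := ih
    refine ⟨fun k => if k ≤ m then f k else c, m + 1, by simp [h3], by simp, ?_, ?_⟩
    · intro k hk
      by_cases hkm : k ≤ m
      · simp [hkm, h5]
      · simp [hkm, h2.2.2]
    · intro k hk
      rcases Nat.lt_or_ge k m with h | h
      · simp [h.le, Nat.succ_le_of_lt h, h6 k h]
      · have : k = m := by omega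
        subst this
        simp [h4, h2.1]

lemma relay (hLU : ∀ z ∈ L, z ∈ U) (hG : ∀ σ ∈ G, ∀ x ∈ L, ∀ y ∈ L, swap σ x y ∈ G)
    (hadj : ∀ σ ∈ G, ∀ x ∈ L, ∀ y ∈ L, adj x y → Conn U ρ σ (swap σ x y)) (hL : LConn L)
    {ω : Config d} (hω : ω ∈ G) {x y : Site d} (hx : x ∈ L) (hy : y ∈ L) :
    Conn U (ρ + 2) ω (swap ω x y) := by
  obtain ⟨f, m, rfl, rfl, h1, h2⟩ := path_of_rtg hx (hL x hx y hy)
  exact relay_main hLU hG hadj hω f m h1 h2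

end relay
end

section
/-! ### the layer lemma -/

lemma Holes.of_swap_disj {Q : Set (Site d)} {ω : Config d} (h : Holes Q ω) {x y : Site d}
    (hx : x ∉ Q) (hy : y ∉ Q) : Holes Q (KA.swap ω x y) := h.swap hx hy

lemma Ex.list {U : Finset (Site d)} {r : ℕ} {Q D : Set (Site d)} (h : Ex U r Q D)
    (hDU : ∀ z ∈ D, z ∈ U) (hDQ : ∀ z ∈ D, z ∉ Q) {ω : Config d} (hω : Holes Q ω)
    (l : List (Site d × Site d)) (hl : ∀ p ∈ l, p.1 ∈ D ∧ p.2 ∈ D) :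
    Chain U (r + l.length) ω ω (app ω l) := by
  induction l generalizing ω with
  | nil => exact .refl
  | cons p l ih =>
    obtain ⟨h1, h2⟩ := hl p (by simp)
    have c1 := (h ω hω _ h1 _ h2).chain
    have c2 := ih (hω.swap (hDQ _ h1) (hDQ _ h2)) (fun p hp => hl p (by simp [hp]))
    rw [app_cons]
    exact (c1.mono (by simp)).trans
      (c2.rebase (near_swap (hDU _ h1) (hDU _ h2)) (by simp; omega))

lemma Ex.weaken {U : Finset (Site d)} {r r' : ℕ} {Q D Q' D' : Set (Site d)} (h : Ex U r Q D)
    (hr : r ≤ r') (hQ : Q ⊆ Q') (hD : D' ⊆ D) : Ex U r' Q' D' := by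
  intro ω hω x hx y hy
  exact (h ω (hω.mono hQ) x (hD hx) y (hD hy)).chain.mono hr

lemma make_holes {Q D : Set (Site d)} {a b x x' : Site d} (ha : a ∈ D) (hb : b ∈ D) (hab : a ≠ b)
    (hDQ : ∀ z ∈ D, z ∉ Q) (hx : x ∈ Q ∪ D) (hx' : x' ∈ Q ∪ D) (hne : x ≠ x') :
    ∃ l : List (Site d × Site d), l.length ≤ 2 ∧ (∀ p ∈ l, p.1 ∈ D ∧ p.2 ∈ D) ∧
      ∀ ω, Holes (Q ∪ {a, b}) ω → app ω l x = false ∧ app ω l x' = false := by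
  have aux : ∀ {x x' : Site d}, x ∈ Q → x' ∈ D → ∀ ω, Holes (Q ∪ {a, b}) ω →
      app ω [(a, x')] x = false ∧ app ω [(a, x')] x' = false := by
    intro x x' hx hx' ω hω
    have e : app ω [(a, x')] = swap ω a x' := rfl
    rw [e, swap_right, swap_of_ne]
    · exact ⟨hω x (by simp [hx]), hω a (by simp)⟩
    · rintro rfl; exact hDQ _ ha hx
    · rintro rfl; exact hDQ _ hx' hx
  rcases hx with hx | hx <;> rcases hx' with hx' | hx'
  · exact ⟨[], by simp, by simp, fun ω hω => ⟨hω x (by simp [hx]), hω x' (by simp [hx'])⟩⟩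
  · exact ⟨[(a, x')], by simp, by simp [ha, hx'], aux hx hx'⟩
  · exact ⟨[(a, x)], by simp, by simp [ha, hx], fun ω hω => (aux hx' hx ω hω).symm⟩
  · by_cases hxb : x = b
    · refine ⟨[(a, x')], by simp, by simp [ha, hx'], fun ω hω => ?_⟩
      have e : app ω [(a, x')] = swap ω a x' := rfl
      rw [e, swap_right, swap_of_ne]
      · exact ⟨hω x (by simp [hxb]), hω a (by simp)⟩
      · rw [hxb]; exact hab.symm
      · exact hne
    · refine ⟨[(a, x), (b, x')], by simp, by simp [ha, hx', hb, hx], fun ω hω => ?_⟩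
      have e : app ω [(a, x), (b, x')] = swap (swap ω a x) b x' := rfl
      rw [e, swap_right, swap_of_ne _ hxb hne, swap_right, swap_of_ne _ hab.symm (Ne.symm hxb)]
      exact ⟨hω a (by simp), hω b (by simp)⟩

lemma conj_swap (ω : Config d) {x y s t : Site d} (h1 : x ≠ y) (h2 : x ≠ t) (h3 : s ≠ y)
    (h4 : s ≠ t) :
    swap (swap (swap (swap (swap ω x s) y t) s t) y t) x s = swap ω x y := by
  simp only [swap_eq]
  funext z
  simp only [Function.comp]
  have e : (Equiv.swap x s) ((Equiv.swap y t) ((Equiv.swap s t) ((Equiv.swap y t)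
      ((Equiv.swap x s) z)))) = Equiv.swap x y z := by
    have e1 : (Equiv.swap x s * Equiv.swap y t) * Equiv.swap s t =
        Equiv.swap x y * (Equiv.swap x s * Equiv.swap y t) := by
      rw [Equiv.mul_swap_eq_swap_mul]
      congr 2
      · simp [Equiv.swap_apply_of_ne_of_ne h3 h4]
      · simp [Equiv.swap_apply_of_ne_of_ne h1.symm h3.symm]
    have e2 := congrArg (fun σ => σ ((Equiv.swap y t) ((Equiv.swap x s) z))) e1
    simpa [Equiv.Perm.mul_apply] using e2
  rw [e]

lemma layer_step {U : Finset (Site d)} {r : ℕ} {Q D L : Set (Site d)} {a b p ys y2 : Site d}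
    {β : Site d → Site d}
    (hEx : Ex U r Q D) (hDU : ∀ z ∈ D, z ∈ U) (hDQ : ∀ z ∈ D, z ∉ Q)
    (ha : a ∈ D) (hb : b ∈ D) (hab : a ≠ b)
    (hLU : ∀ z ∈ L, z ∈ U) (hLQ : ∀ z ∈ L, z ∉ Q) (hLD : ∀ z ∈ L, z ∉ D) (hLC : LConn L)
    (hβ : ∀ y ∈ L, β y ∈ Q ∪ D) (hβa : ∀ y ∈ L, adj y (β y))
    (hβi : ∀ y ∈ L, ∀ y' ∈ L, y ≠ y' → β y ≠ β y')
    (hp : p ∈ L) (hys : ys ∈ L) (hysp : ys ≠ p) (hxD : β ys ∈ D) (hxa : β ys ≠ a)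
    (hxb : β ys ≠ b) (hy2 : y2 ∈ L) (hy2a : adj ys y2) (hβ2 : adj (β ys) (β y2)) :
    Ex U (r + 10) (Q ∪ {a, b, p}) ((D \ {a, b}) ∪ (L \ {p})) := by
  -- in-layer exchanges
  have hLa : a ∉ L := fun h => hLD _ h ha
  have hLb : b ∉ L := fun h => hLD _ h hb
  have hpD : p ∉ D := hLD _ hp
  have hpQ : p ∉ Q := hLQ _ hp
  have haQ := hDQ _ ha
  have hbQ := hDQ _ hb
  have hβL : ∀ y ∈ L, β y ∉ L := by
    intro y hy h
    rcases hβ y hy with h' | h'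
    · exact hLQ _ h h'
    · exact hLD _ h h'
  have hL0 : ∀ σ, Holes (Q ∪ {a, b}) σ → ∀ x ∈ L, ∀ y ∈ L, Holes (Q ∪ {a, b}) (swap σ x y) := by
    intro σ hσ x hx y hy
    have : ∀ z ∈ L, z ∉ Q ∪ {a, b} := by
      intro z hz
      simp only [Set.mem_union, Set.mem_insert_iff, Set.mem_singleton_iff, not_or]
      exact ⟨hLQ z hz, by rintro rfl; exact hLa hz, by rintro rfl; exact hLb hz⟩
    exact hσ.swap (this x hx) (this y hy)
  have hin : ∀ ω, Holes (Q ∪ {a, b}) ω → ∀ x ∈ L, ∀ y ∈ L, Conn U (r + 5) ω (swap ω x y) := by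
    intro ω hω x hx y hy
    refine relay (ρ := r + 3) (G := {σ | Holes (Q ∪ {a, b}) σ}) hLU hL0 ?_ hLC hω hx hy
    intro σ hσ x hx y hy hxy
    have hne := adj_ne hxy
    obtain ⟨l, hl1, hl2, hl3⟩ := make_holes ha hb hab hDQ (hβ x hx) (hβ y hy) (hβi x hx y hy hne)
    have hQ' : ∀ σ, Holes (Q ∪ {a, b}) σ → Holes Q σ :=
      fun σ h => h.mono Set.subset_union_left
    refine conj_step (ρ := r + 2) (m := 2) (l := l)
      (fun p hp => ⟨hDU _ (hl2 p hp).1, hDU _ (hl2 p hp).2⟩) hl1 (by omega) ?_ (hLU _ hx)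
      (hLU _ hy) hxy ?_ ?_ ?_
    · intro p hp
      obtain ⟨h1, h2⟩ := hl2 p hp
      refine ⟨?_, ?_, ?_, ?_⟩ <;> rintro rfl
      exacts [hLD _ hx h1, hLD _ hx h2, hLD _ hy h1, hLD _ hy h2]
    · rw [constraint_two]
      obtain ⟨h1, h2⟩ := hl3 σ hσ
      exact ⟨⟨β x, hβa x hx, fun h => hβL x hx (h ▸ hy), h1⟩,
        ⟨β y, hβa y hy, fun h => hβL y hy (h ▸ hx), h2⟩⟩
    · exact (hEx.list hDU hDQ (hQ' _ hσ) l hl2).mono (by omega)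
    · exact (hEx.list hDU hDQ (hQ' _ (hL0 σ hσ x hx y hy)) l hl2).mono (by omega)
  -- vertical
  have hsub1 : Q ∪ {a, b} ⊆ Q ∪ {a, b, p} := by
    intro z; simp; tauto
  have hsub2 : Q ⊆ Q ∪ {a, b, p} := Set.subset_union_left
  have hxQ : β ys ∉ Q := hDQ _ hxD
  have hxp : β ys ≠ p := by rintro h; exact hpD (h ▸ hxD)
  have hysQ : ys ∉ Q := hLQ _ hys
  have hysD : ys ∉ D := hLD _ hys
  have hne2 : y2 ≠ ys := (adj_ne hy2a).symm
  have hβne : β y2 ≠ β ys := hβi _ hy2 _ hys hne2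
  have hyspec : ys ∉ Q ∪ {a, b, p} := by
    simp only [Set.mem_union, Set.mem_insert_iff, Set.mem_singleton_iff, not_or]
    exact ⟨hysQ, by rintro rfl; exact hysD ha, by rintro rfl; exact hysD hb, hysp⟩
  have hxspec : β ys ∉ Q ∪ {a, b, p} := by
    simp only [Set.mem_union, Set.mem_insert_iff, Set.mem_singleton_iff, not_or]
    exact ⟨hxQ, hxa, hxb, hxp⟩
  have hvert : ∀ ω, Holes (Q ∪ {a, b, p}) ω → Conn U (r + 8) ω (swap ω (β ys) ys) := by
    obtain ⟨l1, hl1, hl2, hl3, hl4⟩ : ∃ l : List (Site d × Site d), l.length ≤ 1 ∧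
        (∀ q ∈ l, q.1 ∈ D ∧ q.2 ∈ D) ∧ (∀ q ∈ l, β ys ≠ q.1 ∧ β ys ≠ q.2) ∧
        ∀ ω, Holes (Q ∪ {a, b}) ω → app ω l (β y2) = false := by
      rcases hβ y2 hy2 with h | h
      · exact ⟨[], by simp, by simp, by simp, fun ω hω => hω _ (by simp [h])⟩
      · refine ⟨[(a, β y2)], by simp, by simp [ha, h], by simp [hxa, hβne.symm], fun ω hω => ?_⟩
        have e : app ω [(a, β y2)] = swap ω a (β y2) := rfl
        rw [e, swap_right]; exact hω a (by simp)
    intro ω hω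
    have chain : ∀ ω, Holes (Q ∪ {a, b, p}) ω →
        Chain U (r + 5) ω ω (app ω ((p, y2) :: l1)) := by
      intro ω hω
      have h1 := (hin ω (hω.mono hsub1) p hp y2 hy2).chain
      have h2 := hEx.list hDU hDQ ((hL0 ω (hω.mono hsub1) p hp y2 hy2).mono
        (Set.subset_union_left)) l1 hl2
      rw [app_cons]
      exact h1.trans (h2.rebase (near_swap (hLU _ hp) (hLU _ hy2)) (by omega))
    have hl1L : ∀ q ∈ l1, ∀ z ∈ L, z ≠ q.1 ∧ z ≠ q.2 := by
      intro q hq z hz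
      exact ⟨by rintro rfl; exact hLD _ hz (hl2 q hq).1, by rintro rfl; exact hLD _ hz (hl2 q hq).2⟩
    refine Chain.mono (r := r + 5 + 1) ?_ (by omega)
    refine conj_step (m := 2) (l := (p, y2) :: l1) ?_ (by simp; omega) (by omega) ?_ (hDU _ hxD)
      (hLU _ hys) (adj_comm.1 (hβa _ hys)) ?_ (chain ω hω) (chain _ (hω.swap hxspec hyspec))
    · intro q hq
      rcases List.mem_cons.1 hq with rfl | hq
      · exact ⟨hLU _ hp, hLU _ hy2⟩
      · exact ⟨hDU _ (hl2 q hq).1, hDU _ (hl2 q hq).2⟩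
    · intro q hq
      rcases List.mem_cons.1 hq with rfl | hq
      · exact ⟨hxp, fun h => hβL _ hys (by rw [h]; exact hy2), hysp, hne2.symm⟩
      · exact ⟨(hl3 q hq).1, (hl3 q hq).2, (hl1L q hq ys hys).1, (hl1L q hq ys hys).2⟩
    · rw [constraint_two]
      refine ⟨⟨β y2, hβ2, fun h => hβL y2 hy2 (h ▸ hys), ?_⟩,
        ⟨y2, hy2a, fun h => hβL ys hys (by rw [← h]; exact hy2), ?_⟩⟩
      · rw [app_cons]
        exact hl4 _ (hL0 ω (hω.mono hsub1) p hp y2 hy2)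
      · rw [app_cons, app_of_notMem, swap_right]
        · exact hω p (by simp)
        · intro q hq
          exact ⟨(hl1L q hq y2 hy2).1.symm, (hl1L q hq y2 hy2).2.symm⟩
  -- general
  have hDspec : ∀ z ∈ D \ {a, b}, z ∉ Q ∪ {a, b, p} := by
    rintro z ⟨h1, h2⟩
    simp only [Set.mem_union, Set.mem_insert_iff, Set.mem_singleton_iff, not_or] at h2 ⊢
    exact ⟨hDQ _ h1, h2.1, h2.2, by rintro rfl; exact hpD h1⟩
  have hLspec : ∀ z ∈ L \ {p}, z ∉ Q ∪ {a, b, p} := by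
    rintro z ⟨h1, h2⟩
    simp only [Set.mem_union, Set.mem_insert_iff, Set.mem_singleton_iff, not_or] at h2 ⊢
    exact ⟨hLQ _ h1, by rintro rfl; exact hLa h1, by rintro rfl; exact hLb h1, h2⟩
  have hmix : ∀ ω, Holes (Q ∪ {a, b, p}) ω → ∀ x ∈ D \ {a, b}, ∀ y ∈ L \ {p},
      Conn U (r + 10) ω (swap ω x y) := by
    intro ω hω x hx y hy
    have hne : ∀ x ∈ D, ∀ y ∈ L, x ≠ y := by rintro x hx y hy rfl; exact hLD _ hy hx
    have n1 : Near U 1 ω (swap ω x (β ys)) := near_swap (hDU _ hx.1) (hDU _ hxD)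
    have c1 := (hEx ω (hω.mono hsub2) x hx.1 _ hxD).chain
    have H1 := hω.swap (hDspec x hx) hxspec
    have c2 := (hin _ (H1.mono hsub1) y hy.1 ys hys).chain
    have n2 := n1.trans (near_swap (ω := swap ω x (β ys)) (hLU _ hy.1) (hLU _ hys))
    have H2 := H1.swap (hLspec y hy) hyspec
    have c3 := (hvert _ H2).chain
    have n3 := n2.trans (near_swap (ω := swap (swap ω x (β ys)) y ys) (hDU _ hxD) (hLU _ hys))
    have H3 := H2.swap hxspec hyspec
    have c4 := (hin _ (H3.mono hsub1) y hy.1 ys hys).chain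
    have H4 := H3.swap (hLspec y hy) hyspec
    have n4 := n3.trans (near_swap (hLU _ hy.1) (hLU _ hys))
    have c5 := (hEx _ (H4.mono hsub2) x hx.1 _ hxD).chain
    have := (((((c1.mono (show r ≤ r + 10 by omega)).trans
      (c2.rebase n1 (show 1 + (r + 5) ≤ r + 10 by omega))).trans
      (c3.rebase n2 (show 1 + 1 + (r + 8) ≤ r + 10 by omega))).trans
      (c4.rebase n3 (show 1 + 1 + 1 + (r + 5) ≤ r + 10 by omega))).trans
      (c5.rebase n4 (show 1 + 1 + 1 + 1 + r ≤ r + 10 by omega)))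
    rwa [conj_swap ω (hne _ hx.1 _ hy.1) (hne _ hx.1 _ hys) (hne _ hxD _ hy.1)
      (hne _ hxD _ hys)] at this
  intro ω hω x hx y hy
  rcases hx with hx | hx <;> rcases hy with hy | hy
  · exact (hEx ω (hω.mono hsub2) x hx.1 y hy.1).chain.mono (by omega)
  · exact hmix ω hω x hx y hy
  · rw [swap_comm]; exact hmix ω hω y hy x hx
  · exact (hin ω (hω.mono hsub1) x hx.1 y hy.1).chain.mono (by omega)

lemma layer_base {U : Finset (Site d)} {Q L : Set (Site d)} {β : Site d → Site d}
    (hLU : ∀ z ∈ L, z ∈ U) (hLQ : ∀ z ∈ L, z ∉ Q) (hLC : LConn L)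
    (hβ : ∀ y ∈ L, β y ∈ Q) (hβa : ∀ y ∈ L, adj y (β y)) : Ex U 3 Q L := by
  intro ω hω x hx y hy
  refine relay (ρ := 1) (G := {σ | Holes Q σ}) hLU ?_ ?_ hLC hω hx hy
  · intro σ hσ x hx y hy
    exact Holes.swap hσ (hLQ _ hx) (hLQ _ hy)
  · intro σ hσ x hx y hy hxy
    refine conj_step (ρ := 0) (m := 0) (l := []) (by simp) (by simp) le_rfl (by simp) (hLU _ hx)
      (hLU _ hy) hxy ?_ .refl .refl
    rw [constraint_two]
    exact ⟨⟨β x, hβa x hx, fun h => hLQ _ hy (h ▸ hβ x hx), hσ _ (hβ x hx)⟩,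
        ⟨β y, hβa y hy, fun h => hLQ _ hx (h ▸ hβ y hy), hσ _ (hβ y hy)⟩⟩
end

section
/-! ### growth of boxes -/

lemma adj_update_step (x : Site d) (i : Fin d) (t : ℤ) (h : |t - x i| = 1) :
    adj x (Function.update x i t) := by
  unfold adj
  rw [Finset.sum_eq_single i]
  · simp [abs_sub_comm, h]
  · intro b _ hb; simp [hb]
  · simp

lemma lconn_Icc (lo hi : Site d) : LConn (Set.Icc lo hi) := by
  intro x hx y hy
  have : ∀ n : ℕ, ∀ x ∈ Set.Icc lo hi, (∑ l, (x l - y l).natAbs) = n →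
      Relation.ReflTransGen (fun a b => adj a b ∧ a ∈ Set.Icc lo hi ∧ b ∈ Set.Icc lo hi) x y := by
    intro n
    induction n with
    | zero =>
      intro x hx h
      have : x = y := by
        funext l
        have := (Finset.sum_eq_zero_iff.1 h) l (Finset.mem_univ _)
        omega
      rw [this]
    | succ n ih =>
      intro x hx h
      have : ∃ l, x l ≠ y l := by
        by_contra hc
        push Not at hc
        rw [Finset.sum_eq_zero (by intro l _; simp [hc l])] at h
        omega
      obtain ⟨l, hl⟩ := this
      set t : ℤ := if x l < y l then x l + 1 else x l - 1 with ht
      have h1l : lo l ≤ x l := hx.1 l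
      have h2l : x l ≤ hi l := hx.2 l
      have h3l : lo l ≤ y l := hy.1 l
      have h4l : y l ≤ hi l := hy.2 l
      have htl : lo l ≤ t ∧ t ≤ hi l := by
        rw [ht]; split_ifs <;> constructor <;> omega
      have hx' : Function.update x l t ∈ Set.Icc lo hi := by
        constructor
        · intro k
          by_cases hk : k = l
          · subst hk; simp [htl.1]
          · simp [hk]; exact hx.1 k
        · intro k
          by_cases hk : k = l
          · subst hk; simp [htl.2]
          · simp [hk]; exact hx.2 k
      refine Relation.ReflTransGen.head ⟨adj_update_step x l t ?_, hx, hx'⟩ (ih _ hx' ?_)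
      · rw [ht]; split_ifs <;> simp
      · rw [← Finset.add_sum_erase _ _ (Finset.mem_univ l)] at h ⊢
        have e : ∑ k ∈ Finset.univ.erase l, (Function.update x l t k - y k).natAbs =
            ∑ k ∈ Finset.univ.erase l, (x k - y k).natAbs := by
          refine Finset.sum_congr rfl fun k hk => ?_
          rw [Function.update_of_ne (Finset.ne_of_mem_erase hk)]
        rw [e, Function.update_self]
        have : (t - y l).natAbs + 1 = (x l - y l).natAbs := by
          rw [ht]; split_ifs <;> omega
        omega
  exact this _ x hx rfl

def sgn (s : Bool) : ℤ := if s then 1 else -1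

lemma sgn_true : sgn true = 1 := rfl
lemma sgn_false : sgn false = -1 := rfl

def bLo (e : Fin d × Bool → ℕ) : Site d := fun l => -(e (l, false) : ℤ)
def bHi (e : Fin d × Bool → ℕ) : Site d := fun l => (e (l, true) : ℤ)

def Bx (e : Fin d × Bool → ℕ) : Set (Site d) := Set.Icc (bLo e) (bHi e)

lemma mem_Bx {e : Fin d × Bool → ℕ} {x : Site d} :
    x ∈ Bx e ↔ ∀ l, -(e (l, false) : ℤ) ≤ x l ∧ x l ≤ e (l, true) :=
  ⟨fun h l => ⟨h.1 l, h.2 l⟩, fun h => ⟨fun l => (h l).1, fun l => (h l).2⟩⟩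

def Core (R : ℕ) : Set (Site d) := {x | ∀ l, |x l| ≤ (R : ℤ)}
def Bdry (R : ℕ) : Set (Site d) := {x | (∀ l, |x l| ≤ (R : ℤ)) ∧ ∃ l, |x l| = (R : ℤ)}

def CatS (R M : ℕ) (cat : Fin d × Bool → ℕ → Fin 3 → Site d) : Set (Site d) :=
  {z | ∃ g n c, R < n ∧ n ≤ M ∧ z = cat g n c}

def QS (R M : ℕ) (cat : Fin d × Bool → ℕ → Fin 3 → Site d) (e : Fin d × Bool → ℕ)
    (a b : Site d) : Set (Site d) := ((Bdry R ∪ CatS R M cat) ∩ Bx e) \ {a, b}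

def DS (R M : ℕ) (cat : Fin d × Bool → ℕ → Fin 3 → Site d) (e : Fin d × Bool → ℕ)
    (a b : Site d) : Set (Site d) := (Bx e \ (Core R ∪ CatS R M cat)) ∪ {a, b}

/-- reachable boxes -/
def Reach (R M : ℕ) (cat : Fin d × Bool → ℕ → Fin 3 → Site d) (U : Finset (Site d))
    (e : Fin d × Bool → ℕ) : Prop :=
  ∃ g m, R < m ∧ m ≤ M ∧ cat g m 0 ∈ Bx e ∧ cat g m 1 ∈ Bx e ∧
    Ex U (10 * ∑ g, e g) (QS R M cat e (cat g m 0) (cat g m 1))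
      (DS R M cat e (cat g m 0) (cat g m 1))

structure CatOK (R M : ℕ) (cat : Fin d × Bool → ℕ → Fin 3 → Site d) (U : Finset (Site d)) : Prop where
  coord : ∀ g n c, R < n → n ≤ M → cat g n c g.1 = sgn g.2 * n
  inj : ∀ g n c c', R < n → n ≤ M → c ≠ c' → cat g n c ≠ cat g n c'
  hU : ∀ z, z ∈ U ↔ z ∈ Bx (fun _ => M) ∧ z ∉ Core R

/-- new layer -/
def LyLo (e : Fin d × Bool → ℕ) (g : Fin d × Bool) : Site d :=
  Function.update (bLo e) g.1 (sgn g.2 * (e g + 1))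
def LyHi (e : Fin d × Bool → ℕ) (g : Fin d × Bool) : Site d :=
  Function.update (bHi e) g.1 (sgn g.2 * (e g + 1))
def Ly (e : Fin d × Bool → ℕ) (g : Fin d × Bool) : Set (Site d) := Set.Icc (LyLo e g) (LyHi e g)

lemma mem_Ly {e : Fin d × Bool → ℕ} {g : Fin d × Bool} {x : Site d} :
    x ∈ Ly e g ↔ x g.1 = sgn g.2 * (e g + 1) ∧
      ∀ l, l ≠ g.1 → -(e (l, false) : ℤ) ≤ x l ∧ x l ≤ e (l, true) := by
  constructor
  · intro h
    refine ⟨?_, ?_⟩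
    · have h1 := h.1 g.1
      have h2 := h.2 g.1
      simp only [LyLo, LyHi, Function.update_self] at h1 h2
      exact le_antisymm h2 h1
    · intro l hl
      have h1 := h.1 l
      have h2 := h.2 l
      simp only [LyLo, LyHi, Function.update_of_ne hl, bLo, bHi] at h1 h2
      exact ⟨h1, h2⟩
  · rintro ⟨h1, h2⟩
    constructor <;> intro l <;> by_cases hl : l = g.1
    · subst hl; simp [LyLo, h1]
    · simp [LyLo, hl, bLo, (h2 l hl).1]
    · subst hl; simp [LyHi, h1]
    · simp [LyHi, hl, bHi, (h2 l hl).2]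

lemma mem_Bx_succ {e : Fin d × Bool → ℕ} {g : Fin d × Bool} {x : Site d} :
    x ∈ Bx (Function.update e g (e g + 1)) ↔ x ∈ Bx e ∨ x ∈ Ly e g := by
  obtain ⟨i, s⟩ := g
  rw [mem_Bx, mem_Bx, mem_Ly]
  constructor
  · intro h
    by_cases hx : x i = sgn s * (e (i, s) + 1)
    · right
      refine ⟨hx, fun l hl => ?_⟩
      have := h l
      simpa [Function.update_apply, hl] using this
    · left
      intro l
      have := h l
      by_cases hl : l = i
      · subst hl
        cases s
        · simp [Function.update_apply, sgn] at this hx ⊢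
          omega
        · simp [Function.update_apply, sgn] at this hx ⊢
          omega
      · simpa [Function.update_apply, hl] using this
  · rintro (h | ⟨h1, h2⟩) l
    · have := h l
      by_cases hl : l = i
      · subst hl
        cases s <;> simp [Function.update_apply] <;> omega
      · simpa [Function.update_apply, hl] using this
    · by_cases hl : l = i
      · subst hl
        cases s <;> simp [Function.update_apply, sgn] at h1 ⊢ <;> omega
      · simpa [Function.update_apply, hl] using h2 l hl

lemma abs_sgn_mul (s : Bool) (n : ℤ) : |sgn s * n| = |n| := by cases s <;> simp [sgn]

lemma Ly_notin_Bx {e : Fin d × Bool → ℕ} {g : Fin d × Bool} {x : Site d} (h : x ∈ Ly e g) :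
    x ∉ Bx e := by
  intro h'
  have h1 := (mem_Ly.1 h).1
  have h2 := mem_Bx.1 h' g.1
  obtain ⟨i, s⟩ := g
  cases s <;> simp [sgn] at h1 h2 <;> omega

def below (g : Fin d × Bool) (y : Site d) : Site d := Function.update y g.1 (y g.1 - sgn g.2)

lemma below_mem {e : Fin d × Bool → ℕ} {g : Fin d × Bool} {x : Site d} (h : x ∈ Ly e g) :
    below g x ∈ Bx e := by
  rw [mem_Ly] at h
  rw [mem_Bx]
  intro l
  obtain ⟨i, s⟩ := g
  by_cases hl : l = i
  · subst hl
    have := h.1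
    cases s <;> simp [below, sgn] at this ⊢ <;> omega
  · have := h.2 l hl
    simpa [below, hl] using this

lemma adj_below (g : Fin d × Bool) (y : Site d) : adj y (below g y) := by
  refine adj_update_step y g.1 _ ?_
  obtain ⟨i, s⟩ := g
  cases s <;> simp [sgn]

lemma below_inj (g : Fin d × Bool) {y y' : Site d} (h : below g y = below g y') : y = y' := by
  funext l
  have := congrFun h l
  by_cases hl : l = g.1
  · subst hl; simp [below] at this; exact this
  · simpa [below, hl] using this

lemma below_adj (g : Fin d × Bool) {y y' : Site d} (h : adj y y') :
    adj (below g y) (below g y') := by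
  have e : ∀ y, below g y = y + (fun l => if l = g.1 then - sgn g.2 else 0) := by
    intro y; funext l
    by_cases hl : l = g.1
    · subst hl; simp [below]; ring
    · simp [below, hl]
  unfold adj at *
  rw [e, e]
  simpa using h

lemma catS_bound {R M L' : ℕ} {cat : Fin d × Bool → ℕ → Fin 3 → Site d} {U : Finset (Site d)}
    (hc : CatOK R M cat U) {e : Fin d × Bool → ℕ} (he : ∀ g, e g ≤ L') {z : Site d}
    (hz : z ∈ CatS R M cat) (hz' : z ∈ Bx e) :
    ∃ g n c, R < n ∧ n ≤ M ∧ n ≤ e g ∧ z = cat g n c ∧ z g.1 = sgn g.2 * n := by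
  obtain ⟨g, n, c, h1, h2, rfl⟩ := hz
  refine ⟨g, n, c, h1, h2, ?_, rfl, hc.coord g n c h1 h2⟩
  have h3 := mem_Bx.1 hz' g.1
  rw [hc.coord g n c h1 h2] at h3
  obtain ⟨i, s⟩ := g
  cases s <;> simp [sgn] at h3 ⊢ <;> omega

lemma sum_update_succ (e : Fin d × Bool → ℕ) (g : Fin d × Bool) :
    ∑ h, Function.update e g (e g + 1) h = (∑ h, e h) + 1 := by
  rw [Finset.sum_update_of_mem (Finset.mem_univ g), ← Finset.add_sum_erase _ e (Finset.mem_univ g)]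
  rw [Finset.sdiff_singleton_eq_erase]
  ring

/-- the distinguished site of the layer -/
def star (e : Fin d × Bool → ℕ) (g : Fin d × Bool) (j : Fin d) (t : ℤ) : Site d :=
  fun l => if l = g.1 then sgn g.2 * (e g + 1) else if l = j then (e (j, true) : ℤ) - t else 0

lemma star_mem {e : Fin d × Bool → ℕ} {g : Fin d × Bool} {j : Fin d} {t : ℤ} (ht : 0 ≤ t)
    (ht' : t ≤ 1) (hj : 1 ≤ e (j, true)) : star e g j t ∈ Ly e g := by
  rw [mem_Ly]
  refine ⟨by simp [star], fun l hl => ?_⟩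
  by_cases hlj : l = j
  · subst hlj; simp [star, hl]; omega
  · simp [star, hl, hlj]

lemma grow_step {R M L L' : ℕ} {cat : Fin d × Bool → ℕ → Fin 3 → Site d} {U : Finset (Site d)}
    (hc : CatOK R M cat U) (hR : 1 ≤ R) (hRL : R ≤ L) (hLM : L' ≤ M)
    (hb : ∀ g n c, R < n → n ≤ L' → ∀ l, l ≠ g.1 → |cat g n c l| < (L : ℤ))
    {e : Fin d × Bool → ℕ} (he : ∀ g, L ≤ e g) (he' : ∀ g, e g ≤ L') (g : Fin d × Bool)
    (hg : e g + 1 ≤ L') (j : Fin d) (hj : j ≠ g.1) (hjR : R < e g ∨ R < e (j, true))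
    (hr : Reach R M cat U e) : Reach R M cat U (Function.update e g (e g + 1)) := by
  obtain ⟨g0, m, hm1, hm2, hA, hB, hEx⟩ := hr
  have hng : R < e g + 1 := by have := he g; omega
  have hcatL : ∀ c, cat g (e g + 1) c ∈ Ly e g := by
    intro c
    rw [mem_Ly]
    refine ⟨by rw [hc.coord _ _ _ hng (by omega)]; push_cast; rfl, fun l hl => ?_⟩
    have h1 := abs_lt.1 (hb g (e g + 1) c hng hg l hl)
    have h2 := he (l, false)
    have h3 := he (l, true)
    constructor <;> omega
  have hcatS : ∀ c, cat g (e g + 1) c ∈ CatS R M cat := fun c =>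
    ⟨g, e g + 1, c, hng, by omega, rfl⟩
  have hAS : cat g0 m 0 ∈ CatS R M cat := ⟨g0, m, 0, hm1, hm2, rfl⟩
  have hBS : cat g0 m 1 ∈ CatS R M cat := ⟨g0, m, 1, hm1, hm2, rfl⟩
  have hcatCore : ∀ z ∈ CatS R M cat, z ∉ Core R := by
    rintro z ⟨g, n, c, h1, h2, rfl⟩ h
    have := h g.1
    rw [hc.coord _ _ _ h1 h2, abs_sgn_mul, Nat.abs_cast] at this
    omega
  have hLyCore : ∀ z ∈ Ly e g, z ∉ Core R := by
    intro z hz h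
    have := h g.1
    rw [(mem_Ly.1 hz).1, abs_sgn_mul] at this
    rw [abs_of_nonneg (by positivity)] at this
    omega
  have hBxM : ∀ z ∈ Bx (Function.update e g (e g + 1)), z ∈ Bx (fun _ => M) := by
    intro z hz
    rw [mem_Bx] at hz ⊢
    intro l
    have h1 := hz l
    have h2 : ∀ h, Function.update e g (e g + 1) h ≤ L' := by
      intro h
      rw [Function.update_apply]; split_ifs
      · exact hg
      · exact he' h
    have h3 := h2 (l, true)
    have h4 := h2 (l, false)
    constructor <;> omega
  have hBxM' : ∀ z ∈ Bx e, z ∈ Bx (fun _ => M) := fun z hz => hBxM z (mem_Bx_succ.2 (Or.inl hz))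
  have hLyM : ∀ z ∈ Ly e g, z ∈ Bx (fun _ => M) := fun z hz => hBxM z (mem_Bx_succ.2 (Or.inr hz))
  have hj1 : 1 ≤ e (j, true) := by have := he (j, true); omega
  have hystar : star e g j 0 ∈ Ly e g := star_mem le_rfl (by norm_num) hj1
  have hystar2 : star e g j 1 ∈ Ly e g := star_mem (by norm_num) le_rfl hj1
  have hsadj : adj (star e g j 0) (star e g j 1) := by
    have : star e g j 1 = Function.update (star e g j 0) j ((e (j, true) : ℤ) - 1) := by
      funext l
      by_cases h1 : l = j
      · subst h1; simp [star, hj]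
      · simp [star, h1]
    rw [this]
    refine adj_update_step _ _ _ ?_
    simp [star, hj]
  have hbS : below g (star e g j 0) ∉ CatS R M cat := by
    intro h
    obtain ⟨g', n, c, h1, h2, h3, h4, h5⟩ := catS_bound hc he' h (below_mem hystar)
    have hbd := hb g' n c h1 (h3.trans (he' g'))
    rw [← h4] at hbd
    by_cases hi : g'.1 = g.1
    · have := hbd j (by rw [hi]; exact hj)
      simp only [below, star, Function.update_of_ne hj, hj, if_false, if_true] at this
      rw [sub_zero, Nat.abs_cast] at this
      have := he (j, true)
      omega
    · by_cases hi2 : g'.1 = j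
      · have := hbd g.1 (fun h => hi h.symm)
        simp only [below, star, Function.update_self, if_true] at this
        have e1 : sgn g.2 * ((e g : ℤ) + 1) - sgn g.2 = sgn g.2 * e g := by ring
        rw [e1, abs_sgn_mul, Nat.abs_cast] at this
        have := he g
        omega
      · simp only [below, star, Function.update_of_ne hi, hi, hi2, if_false] at h5
        have : |sgn g'.2 * (n : ℤ)| = 0 := by rw [← h5]; simp
        rw [abs_sgn_mul, Nat.abs_cast] at this
        omega
  have hbC : below g (star e g j 0) ∉ Core R := by
    intro h
    rcases hjR with h1 | h1
    · have := h g.1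
      simp only [below, star, Function.update_self, if_true] at this
      have e1 : sgn g.2 * ((e g : ℤ) + 1) - sgn g.2 = sgn g.2 * e g := by ring
      rw [e1, abs_sgn_mul, Nat.abs_cast] at this
      omega
    · have := h j
      simp only [below, star, Function.update_of_ne hj, hj, if_false, if_true] at this
      rw [sub_zero, Nat.abs_cast] at this
      omega
  have hDU : ∀ z ∈ DS R M cat e (cat g0 m 0) (cat g0 m 1), z ∈ U := by
    rintro z (h | h | h)
    · rw [hc.hU]; exact ⟨hBxM' _ h.1, fun h' => h.2 (Or.inl h')⟩
    · rw [h, hc.hU]; exact ⟨hBxM' _ hA, hcatCore _ hAS⟩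
    · rw [h, hc.hU]; exact ⟨hBxM' _ hB, hcatCore _ hBS⟩
  have hcore : Bdry R ⊆ (Core R : Set (Site d)) := fun z hz => hz.1
  have hDQ : ∀ z ∈ DS R M cat e (cat g0 m 0) (cat g0 m 1),
      z ∉ QS R M cat e (cat g0 m 0) (cat g0 m 1) := by
    rintro z (h | h) h'
    · rcases h'.1.1 with h1 | h1
      · exact h.2 (Or.inl (hcore h1))
      · exact h.2 (Or.inr h1)
    · exact h'.2 h
  have hstarD : below g (star e g j 0) ∈ DS R M cat e (cat g0 m 0) (cat g0 m 1) :=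
    Or.inl ⟨below_mem hystar, by rintro (h | h); exacts [hbC h, hbS h]⟩
  have hstarp : star e g j 0 ≠ cat g (e g + 1) 2 := by
    intro h
    have := hb g (e g + 1) 2 hng hg j hj
    rw [← h] at this
    simp only [star, hj, if_false, if_true, sub_zero, Nat.abs_cast] at this
    have := he (j, true)
    omega
  have key := layer_step (U := U) (L := Ly e g) (p := cat g (e g + 1) 2) (ys := star e g j 0)
    (y2 := star e g j 1) (β := below g) hEx hDU hDQ (Or.inr (by simp)) (Or.inr (by simp))
    (hc.inj g0 m 0 1 hm1 hm2 (by decide))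
    (fun z hz => (hc.hU z).2 ⟨hLyM z hz, hLyCore z hz⟩)
    (fun z hz h => Ly_notin_Bx hz h.1.2)
    (by
      rintro z hz (h | h | h)
      · exact Ly_notin_Bx hz h.1
      · rw [h] at hz; exact Ly_notin_Bx hz hA
      · rw [h] at hz; exact Ly_notin_Bx hz hB)
    (lconn_Icc _ _)
    (by
      intro y hy
      have h1 := below_mem hy
      by_cases h2 : below g y ∈ ({cat g0 m 0, cat g0 m 1} : Set (Site d))
      · exact Or.inr (Or.inr h2)
      by_cases h3 : below g y ∈ CatS R M cat
      · exact Or.inl ⟨⟨Or.inr h3, h1⟩, h2⟩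
      by_cases h4 : below g y ∈ Core R
      · refine Or.inl ⟨⟨Or.inl ⟨h4, g.1, ?_⟩, h1⟩, h2⟩
        have h5 := h4 g.1
        have h6 : below g y g.1 = sgn g.2 * e g := by
          simp only [below, Function.update_self]
          rw [(mem_Ly.1 hy).1]; ring
        rw [h6, abs_sgn_mul, Nat.abs_cast] at h5 ⊢
        have := he g
        omega
      · exact Or.inr (Or.inl ⟨h1, by rintro (h | h); exacts [h4 h, h3 h]⟩))
    (fun y _ => adj_below g y) (fun y _ y' _ hne h => hne (below_inj g h))
    (hcatL 2) hystar hstarp hstarD (by intro h; exact hbS (h ▸ hAS)) (by intro h; exact hbS (h ▸ hBS))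
    hystar2 hsadj (below_adj g hsadj)
  refine ⟨g, e g + 1, hng, by omega, mem_Bx_succ.2 (Or.inr (hcatL 0)),
    mem_Bx_succ.2 (Or.inr (hcatL 1)), ?_⟩
  rw [sum_update_succ]
  refine key.weaken (by omega) ?_ ?_
  · have hnot : ∀ z ∈ Bx e, z ∉ ({cat g (e g + 1) 0, cat g (e g + 1) 1} : Set (Site d)) := by
      rintro z hz (h | h)
      · exact Ly_notin_Bx (hcatL 0) (h ▸ hz)
      · exact Ly_notin_Bx (hcatL 1) (h ▸ hz)
    rintro z (h | h | h | h)
    · exact ⟨⟨h.1.1, mem_Bx_succ.2 (Or.inl h.1.2)⟩, hnot z h.1.2⟩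
    · rw [h]; exact ⟨⟨Or.inr hAS, mem_Bx_succ.2 (Or.inl hA)⟩, hnot _ hA⟩
    · rw [h]; exact ⟨⟨Or.inr hBS, mem_Bx_succ.2 (Or.inl hB)⟩, hnot _ hB⟩
    · rw [h]
      refine ⟨⟨Or.inr (hcatS 2), mem_Bx_succ.2 (Or.inr (hcatL 2))⟩, ?_⟩
      rintro (h | h)
      · exact hc.inj g (e g + 1) 2 0 hng (by omega) (by decide) h
      · exact hc.inj g (e g + 1) 2 1 hng (by omega) (by decide) h
  · rintro z (h | h | h)
    · rcases mem_Bx_succ.1 h.1 with h1 | h1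
      · refine Or.inl ⟨Or.inl ⟨h1, h.2⟩, ?_⟩
        rintro (h3 | h3)
        · exact h.2 (Or.inr (h3 ▸ hAS))
        · exact h.2 (Or.inr (h3 ▸ hBS))
      · refine Or.inr ⟨h1, ?_⟩
        intro h3
        exact h.2 (Or.inr (h3 ▸ hcatS 2))
    · rw [h]
      exact Or.inr ⟨hcatL 0, hc.inj g (e g + 1) 0 2 hng (by omega) (by decide)⟩
    · rw [h]
      exact Or.inr ⟨hcatL 1, hc.inj g (e g + 1) 1 2 hng (by omega) (by decide)⟩
end

section
lemma raise {R M L L' : ℕ} {cat : Fin d × Bool → ℕ → Fin 3 → Site d} {U : Finset (Site d)}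
    (hc : CatOK R M cat U) (hR : 1 ≤ R) (hRL : R ≤ L) (hLM : L' ≤ M)
    (hb : ∀ g n c, R < n → n ≤ L' → ∀ l, l ≠ g.1 → |cat g n c l| < (L : ℤ))
    {e : Fin d × Bool → ℕ} (he : ∀ g, L ≤ e g) (he' : ∀ g, e g ≤ L') (g : Fin d × Bool)
    (j : Fin d) (hj : j ≠ g.1) (hjR : R < e (j, true))
    (hr : Reach R M cat U e) (t : ℕ) (ht : e g ≤ t) (ht' : t ≤ L') :
    Reach R M cat U (Function.update e g t) := by
  induction t, ht using Nat.le_induction with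
  | base => simpa using hr
  | succ t ht ih =>
    have h1 := ih (by omega)
    have hgj : (j, true) ≠ g := by rintro rfl; exact hj rfl
    have h2 := grow_step (L := L) (L' := L') hc hR hRL hLM hb (e := Function.update e g t)
      (by
        intro h; rw [Function.update_apply]; split_ifs
        · have := he g; omega
        · exact he h)
      (by
        intro h; rw [Function.update_apply]; split_ifs
        · omega
        · exact he' h) g (by simp; omega) j hj (Or.inr (by simp [hgj, hjR])) h1
    simpa using h2

lemma phase {R M L L' : ℕ} {cat : Fin d × Bool → ℕ → Fin 3 → Site d} {U : Finset (Site d)}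
    (hc : CatOK R M cat U) (hR : 1 ≤ R) (hRL : R ≤ L) (hLM : L' ≤ M)
    (hb : ∀ g n c, R < n → n ≤ L' → ∀ l, l ≠ g.1 → |cat g n c l| < (L : ℤ))
    {e : Fin d × Bool → ℕ} (he : ∀ g, L ≤ e g) (he' : ∀ g, e g ≤ L')
    {i0 i1 : Fin d} (hi : i0 ≠ i1) (h0 : R < e (i0, true)) (h1 : R < e (i1, true))
    (hr : Reach R M cat U e) : Reach R M cat U (fun _ => L') := by
  have key : ∀ s : Finset (Fin d × Bool),
      Reach R M cat U (fun g => if g ∈ s then L' else e g) := by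
    intro s
    induction s using Finset.induction_on with
    | empty => simpa using hr
    | insert g s hg ih =>
      set e' : Fin d × Bool → ℕ := fun g => if g ∈ s then L' else e g with he0
      have hle : ∀ h, e h ≤ e' h := by
        intro h; simp only [he0]; split_ifs
        · exact he' h
        · exact le_rfl
      have hle' : ∀ h, e' h ≤ L' := by
        intro h; simp only [he0]; split_ifs
        · exact le_rfl
        · exact he' h
      have : (fun h => if h ∈ insert g s then L' else e h) = Function.update e' g L' := by
        funext h
        by_cases hh : h = g
        · subst hh; simp
        · simp [hh, he0]
      rw [this]
      by_cases hgi : g.1 = i0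
      · exact raise hc hR hRL hLM hb (fun h => (he h).trans (hle h)) hle' g i1
          (by rw [hgi]; exact hi.symm) (lt_of_lt_of_le h1 (hle _)) ih L' (hle' g) le_rfl
      · exact raise hc hR hRL hLM hb (fun h => (he h).trans (hle h)) hle' g i0
          (fun h => hgi h.symm) (lt_of_lt_of_le h0 (hle _)) ih L' (hle' g) le_rfl
  simpa using key Finset.univ

lemma reach_base {R M : ℕ} {cat : Fin d × Bool → ℕ → Fin 3 → Site d} {U : Finset (Site d)}
    (hc : CatOK R M cat U) (hR : 1 ≤ R) (hRM : R + 1 ≤ M) (g : Fin d × Bool)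
    (hb : ∀ c, ∀ l, l ≠ g.1 → |cat g (R + 1) c l| < (R : ℤ)) :
    Reach R M cat U (Function.update (fun _ => R) g (R + 1)) := by
  set e0 : Fin d × Bool → ℕ := fun _ => R with he0
  have hcatL : ∀ c, cat g (R + 1) c ∈ Ly e0 g := by
    intro c
    rw [mem_Ly]
    refine ⟨by rw [hc.coord _ _ _ (by omega) (by omega)]; push_cast; rfl, fun l hl => ?_⟩
    have h1 := abs_lt.1 (hb c l hl)
    simp only [he0]
    constructor <;> omega
  have hup : Function.update e0 g (R + 1) = Function.update e0 g (e0 g + 1) := rfl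
  have hLyCore : ∀ z ∈ Ly e0 g, z ∉ Core R := by
    intro z hz h
    have := h g.1
    rw [(mem_Ly.1 hz).1, abs_sgn_mul] at this
    rw [abs_of_nonneg (by positivity)] at this
    simp only [he0] at this
    omega
  have hCore : ∀ z, z ∈ Bx e0 ↔ z ∈ (Core R : Set (Site d)) := by
    intro z
    rw [mem_Bx]
    simp only [Core, Set.mem_setOf_eq, abs_le, he0]
  have key := layer_base (U := U) (Q := Bdry R) (L := Ly e0 g) (β := below g)
    (by
      intro z hz
      rw [hc.hU]
      refine ⟨?_, hLyCore z hz⟩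
      rw [mem_Bx]
      intro l
      by_cases hl : l = g.1
      · subst hl
        have := (mem_Ly.1 hz).1
        obtain ⟨i, s⟩ := g
        cases s <;> simp [sgn, he0] at this ⊢ <;> omega
      · have := (mem_Ly.1 hz).2 l hl
        simp only [he0] at this
        constructor <;> omega)
    (fun z hz h => hLyCore z hz h.1) (lconn_Icc _ _)
    (by
      intro y hy
      refine ⟨(hCore _).1 (below_mem hy), g.1, ?_⟩
      have h6 : below g y g.1 = sgn g.2 * R := by
        simp only [below, Function.update_self]
        rw [(mem_Ly.1 hy).1]; simp only [he0]; ring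
      rw [h6, abs_sgn_mul, Nat.abs_cast])
    (fun y _ => adj_below g y)
  refine ⟨g, R + 1, by omega, hRM, ?_, ?_, ?_⟩
  · rw [hup, mem_Bx_succ]; exact Or.inr (hcatL 0)
  · rw [hup, mem_Bx_succ]; exact Or.inr (hcatL 1)
  refine key.weaken ?_ ?_ ?_
  · rw [hup, sum_update_succ]; omega
  · intro z hz
    refine ⟨⟨Or.inl hz, ?_⟩, ?_⟩
    · rw [hup, mem_Bx_succ]; exact Or.inl ((hCore z).2 hz.1)
    · rintro (h | h)
      · exact hLyCore _ (hcatL 0) (h ▸ hz.1)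
      · exact hLyCore _ (hcatL 1) (h ▸ hz.1)
  · rintro z (h | h | h)
    · have h1 := h.1
      rw [hup, mem_Bx_succ] at h1
      rcases h1 with h1 | h1
      · exact absurd (Or.inl ((hCore z).1 h1)) h.2
      · exact h1
    · rw [h]; exact hcatL 0
    · rw [h]; exact hcatL 1

lemma reach_all {R N M : ℕ} {cat : Fin d × Bool → ℕ → Fin 3 → Site d} {U : Finset (Site d)}
    (hc : CatOK R M cat U) (hR : 1 ≤ R) (hRN : R + 1 ≤ N) (hNM : 3 * N ≤ M)
    (hb0 : ∀ g n c, R < n → n ≤ N → ∀ l, l ≠ g.1 → |cat g n c l| < (R : ℤ))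
    (hb1 : ∀ g n c, N < n → n ≤ 3 * N → ∀ l, l ≠ g.1 → |cat g n c l| < (N : ℤ))
    (hb2 : ∀ g n c, 3 * N < n → n ≤ M → ∀ l, l ≠ g.1 → |cat g n c l| < (3 * N : ℤ))
    {i0 i1 : Fin d} (hi : i0 ≠ i1) : Reach R M cat U (fun _ => M) := by
  have h0 := reach_base hc hR (by omega) (i0, true)
    (fun c l hl => hb0 (i0, true) (R + 1) c (by omega) (by omega) l hl)
  have hne : ((i1, true) : Fin d × Bool) ≠ (i0, true) := by
    intro h; exact hi (Prod.ext_iff.1 h).1.symm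
  have hne2 : ((i0, true) : Fin d × Bool) ≠ (i1, true) := hne.symm
  have h1 := grow_step (L := R) (L' := N) hc hR le_rfl (by omega) hb0
    (e := Function.update (fun _ => R) (i0, true) (R + 1))
    (by intro h; rw [Function.update_apply]; split_ifs <;> omega)
    (by intro h; rw [Function.update_apply]; split_ifs <;> omega)
    (i1, true) (by simp [hne]; omega) i0 hi (Or.inr (by simp)) h0
  have h2 := phase (L := R) (L' := N) hc hR le_rfl (by omega) hb0
    (by
      intro h
      simp only [Function.update_apply]
      split_ifs <;> omega)
    (by
      intro h
      simp only [Function.update_apply]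
      split_ifs <;> omega)
    hi (by simp [hne2]) (by simp [hne]) h1
  have hb1' : ∀ g n c, R < n → n ≤ 3 * N → ∀ l, l ≠ g.1 → |cat g n c l| < (N : ℤ) := by
    intro g n c h3 h4 l hl
    by_cases h : n ≤ N
    · have := hb0 g n c h3 h l hl; omega
    · exact hb1 g n c (by omega) h4 l hl
  have h3 := phase (L := N) (L' := 3 * N) hc hR (by omega) (by omega) hb1'
    (fun _ => le_rfl) (fun _ => by omega) hi (by omega) (by omega) h2
  have hb2' : ∀ g n c, R < n → n ≤ M → ∀ l, l ≠ g.1 → |cat g n c l| < ((3 * N : ℕ) : ℤ) := by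
    intro g n c h3 h4 l hl
    push_cast
    by_cases h : n ≤ 3 * N
    · have := hb1' g n c h3 h l hl; omega
    · exact hb2 g n c (by omega) h4 l hl
  exact phase (L := 3 * N) (L' := M) hc hR (by omega) le_rfl hb2'
    (fun _ => le_rfl) (fun _ => by omega) hi (by omega) (by omega) h3

/-- free exchange outside the core and the catalysts -/
lemma machine {R N M : ℕ} {cat : Fin d × Bool → ℕ → Fin 3 → Site d} {U : Finset (Site d)}
    (hc : CatOK R M cat U) (hR : 1 ≤ R) (hRN : R + 1 ≤ N) (hNM : 3 * N ≤ M)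
    (hb0 : ∀ g n c, R < n → n ≤ N → ∀ l, l ≠ g.1 → |cat g n c l| < (R : ℤ))
    (hb1 : ∀ g n c, N < n → n ≤ 3 * N → ∀ l, l ≠ g.1 → |cat g n c l| < (N : ℤ))
    (hb2 : ∀ g n c, 3 * N < n → n ≤ M → ∀ l, l ≠ g.1 → |cat g n c l| < (3 * N : ℤ))
    {i0 i1 : Fin d} (hi : i0 ≠ i1) {ω : Config d} (hω : Holes (Bdry R ∪ CatS R M cat) ω)
    (l : List (Site d × Site d))
    (hl : ∀ p ∈ l, (p.1 ∈ Bx (fun _ => M) ∧ p.1 ∉ Core R ∧ p.1 ∉ CatS R M cat) ∧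
      (p.2 ∈ Bx (fun _ => M) ∧ p.2 ∉ Core R ∧ p.2 ∉ CatS R M cat)) :
    Conn U (20 * d * M + l.length) ω (app ω l) := by
  obtain ⟨g, m, h1, h2, h3, h4, h5⟩ := reach_all hc hR hRN hNM hb0 hb1 hb2 hi
  have hsum : ∑ g : Fin d × Bool, M = 2 * d * M := by
    rw [Finset.sum_const, Finset.card_univ, Fintype.card_prod, Fintype.card_fin, Fintype.card_bool, smul_eq_mul]; ring
  have h6 := Ex.list (h5.weaken (r' := 20 * d * M) (Q' := Bdry R ∪ CatS R M cat)
      (D' := Bx (fun _ => M) \ (Core R ∪ CatS R M cat)) (by rw [hsum]; nlinarith)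
      (fun z hz => hz.1.1) (fun z hz => Or.inl hz))
    (by
      rintro z ⟨h, h'⟩
      exact (hc.hU z).2 ⟨h, fun h2 => h' (Or.inl h2)⟩)
    (by
      rintro z ⟨h, h'⟩ (h2 | h2)
      · exact h' (Or.inl h2.1)
      · exact h' (Or.inr h2)) hω l
    (by
      intro p hp
      obtain ⟨⟨a, b, c⟩, ⟨a', b', c'⟩⟩ := hl p hp
      exact ⟨⟨a, by rintro (h | h); exacts [b h, c h]⟩, ⟨a', by rintro (h | h); exacts [b' h, c' h]⟩⟩)
  exact h6
end

section
/-! ### parameters and geometry of the slots -/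

structure Par (d : ℕ) where
  i0 : Fin d
  i1 : Fin d
  hi : i0 ≠ i1
  N : ℕ
  κ : ℕ
  hκ : 1 ≤ κ
  hN : 10 + 3 * κ ≤ N

namespace Par

def S (P : Par d) : ℕ := 20 * P.N
def M (P : Par d) : ℕ := 2 * P.S

lemma N10 (P : Par d) : 13 ≤ P.N := by have := P.hN; have := P.hκ; omega

/-- points of the coordinate plane -/
def pt (P : Par d) (a b : ℤ) : Site d := fun l => if l = P.i0 then a else if l = P.i1 then b else 0

@[simp] lemma pt_i0 (P : Par d) (a b : ℤ) : P.pt a b P.i0 = a := by simp [pt]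
@[simp] lemma pt_i1 (P : Par d) (a b : ℤ) : P.pt a b P.i1 = b := by simp [pt, P.hi.symm]

lemma pt_of_ne (P : Par d) (a b : ℤ) {l : Fin d} (h0 : l ≠ P.i0) (h1 : l ≠ P.i1) :
    P.pt a b l = 0 := by simp [pt, h0, h1]

lemma pt_add (P : Par d) (a b a' b' : ℤ) : P.pt a b + P.pt a' b' = P.pt (a + a') (b + b') := by
  funext l; simp only [pt, Pi.add_apply]; split_ifs <;> simp

lemma pt_sub (P : Par d) (a b a' b' : ℤ) : P.pt a b - P.pt a' b' = P.pt (a - a') (b - b') := by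
  funext l; simp only [pt, Pi.sub_apply]; split_ifs <;> simp

lemma pt_neg (P : Par d) (a b : ℤ) : - P.pt a b = P.pt (-a) (-b) := by
  funext l; simp only [pt, Pi.neg_apply]; split_ifs <;> simp

lemma pt_inj (P : Par d) {a b a' b' : ℤ} : P.pt a b = P.pt a' b' ↔ a = a' ∧ b = b' := by
  constructor
  · intro h
    exact ⟨by simpa using congrFun h P.i0, by simpa using congrFun h P.i1⟩
  · rintro ⟨rfl, rfl⟩; rfl

lemma pt_zero (P : Par d) : P.pt 0 0 = origin := by
  funext l; simp [pt, origin]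

lemma adj_pt0 (P : Par d) (a a' b : ℤ) (h : |a' - a| = 1) : adj (P.pt a b) (P.pt a' b) := by
  have : P.pt a' b = Function.update (P.pt a b) P.i0 a' := by
    funext l
    by_cases hl : l = P.i0
    · subst hl; simp
    · simp [pt, hl]
  rw [this]
  exact adj_update_step _ _ _ (by simpa using h)

lemma adj_pt1 (P : Par d) (a b b' : ℤ) (h : |b' - b| = 1) : adj (P.pt a b) (P.pt a b') := by
  have : P.pt a b' = Function.update (P.pt a b) P.i1 b' := by
    funext l
    by_cases hl : l = P.i1
    · subst hl; simp
    · simp [pt, hl]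
  rw [this]
  exact adj_update_step _ _ _ (by simpa using h)

/-- rods -/
def St (P : Par d) : Finset (Site d) :=
  (Finset.Icc (fun _ => -(P.N : ℤ)) (fun _ => (P.N : ℤ))).filter
    fun x => ∃ i, |x i| ≤ P.N ∧ ∀ l, l ≠ i → |x l| ≤ 3

lemma mem_St (P : Par d) {x : Site d} : x ∈ P.St ↔ ∃ i, |x i| ≤ P.N ∧ ∀ l, l ≠ i → |x l| ≤ 3 := by
  unfold St
  rw [Finset.mem_filter, Finset.mem_Icc]
  constructor
  · exact fun h => h.2
  · intro h
    refine ⟨?_, h⟩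
    obtain ⟨i, h1, h2⟩ := h
    have := P.N10
    have key : ∀ l, |x l| ≤ (P.N : ℤ) := by
      intro l
      by_cases hl : l = i
      · rw [hl]; exact h1
      · have := h2 l hl; omega
    exact ⟨fun l => (abs_le.1 (key l)).1, fun l => (abs_le.1 (key l)).2⟩

lemma St_le (P : Par d) {x : Site d} (h : x ∈ P.St) (l : Fin d) : |x l| ≤ P.N := by
  obtain ⟨i, h1, h2⟩ := P.mem_St.1 h
  have := P.N10
  by_cases hl : l = i
  · rw [hl]; exact h1
  · have := h2 l hl; omega

/-- pattern on the rods -/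
def patS (P : Par d) (x : Site d) : Bool :=
  decide ((∃ t : ℤ, |t| ≠ 3 ∧ x = P.pt t 0) ∨ x = P.pt 2 (-1) ∨ x = P.pt (-2) (-1))

/-- corner column -/
def T (P : Par d) (s : ℤ) : ℤ := if s = -1 then 3 * P.N else P.S - 3 * P.N
def sg (s : ℤ) : ℤ := if s = -1 then -1 else 1

def occC (P : Par d) (s a b : ℤ) : Prop :=
  (b = 0 ∧ a ≤ P.T s) ∨ (a = P.T s ∧ s ≠ 0 ∧ -1 ≤ s * b ∧ s * b ≤ P.S) ∨
    (b = s * P.S ∧ P.T s - 1 ≤ a)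

def regC (P : Par d) (s a b : ℤ) : Prop :=
  (|b| ≤ 1 ∧ P.N < a ∧ a ≤ P.T s + 1) ∨
  (s ≠ 0 ∧ P.T s - 1 ≤ a ∧ a ≤ P.T s + 1 ∧ -1 ≤ s * b ∧ s * b ≤ P.S + 1) ∨
  (|b - s * P.S| ≤ 1 ∧ P.T s - 1 ≤ a ∧ a < P.S - P.N)

def Cor (P : Par d) (s : ℤ) : Finset (Site d) :=
  ((Finset.Icc (-(2 * P.S : ℤ)) (2 * P.S) ×ˢ Finset.Icc (-(2 * P.S : ℤ)) (2 * P.S)).filter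
    fun p => P.regC s p.1 p.2).image fun p => P.pt p.1 p.2

def patC (P : Par d) (s : ℤ) (x : Site d) : Bool := decide (P.occC s (x P.i0) (x P.i1))

def IsS (s : ℤ) : Prop := s = -1 ∨ s = 0 ∨ s = 1

lemma regC_bd (P : Par d) {s a b : ℤ} (hs : IsS s) (h : P.regC s a b) :
    P.N < a ∧ a < P.S - P.N ∧ -(P.S + 1 : ℤ) ≤ b ∧ b ≤ P.S + 1 := by
  have := P.N10
  have hS : P.S = 20 * P.N := rfl
  rcases hs with rfl | rfl | rfl <;> simp [regC, T, abs_le] at h ⊢ <;> omega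

lemma mem_Cor (P : Par d) {s : ℤ} (hs : IsS s) {x : Site d} :
    x ∈ P.Cor s ↔ ∃ a b, P.regC s a b ∧ x = P.pt a b := by
  unfold Cor
  simp only [Finset.mem_image, Finset.mem_filter, Finset.mem_product, Finset.mem_Icc, Prod.exists]
  constructor
  · rintro ⟨a, b, ⟨_, h⟩, rfl⟩; exact ⟨a, b, h, rfl⟩
  · rintro ⟨a, b, h, rfl⟩
    have h1 := P.regC_bd hs h
    have := P.N10
    have hS : P.S = 20 * P.N := rfl
    exact ⟨a, b, ⟨⟨by omega, by omega⟩, h⟩, rfl⟩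

/-- resource zone -/
def resZ (P : Par d) : Finset (Site d) :=
  ((Finset.Ico (4 * P.N : ℤ) (P.S - 4 * P.N)) ×ˢ (Finset.Ico (3 * P.N : ℤ) (P.S - 3 * P.N))).image
    fun p => P.pt p.1 p.2

lemma mem_resZ (P : Par d) {x : Site d} : x ∈ P.resZ ↔ ∃ a b : ℤ, (4 * P.N : ℤ) ≤ a ∧
    a < P.S - 4 * P.N ∧ (3 * P.N : ℤ) ≤ b ∧ b < P.S - 3 * P.N ∧ x = P.pt a b := by
  unfold resZ
  simp only [Finset.mem_image, Finset.mem_product, Finset.mem_Ico, Prod.exists]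
  constructor
  · rintro ⟨a, b, ⟨⟨h1, h2⟩, h3, h4⟩, rfl⟩; exact ⟨a, b, h1, h2, h3, h4, rfl⟩
  · rintro ⟨a, b, h1, h2, h3, h4, rfl⟩; exact ⟨a, b, ⟨⟨h1, h2⟩, h3, h4⟩, rfl⟩

/-- candidate boxes -/
def base (P : Par d) (n : ℕ) : ℤ := if n ≤ 3 * P.N then 4 else P.N + 1
def cLo (P : Par d) (g : Fin d × Bool) (n : ℕ) (c : Fin 3) : Site d := fun l =>
  if l = g.1 then sgn g.2 * n else
    if n < 4 * P.N then P.base n + P.κ * (c : ℕ) else -(P.base n + P.κ * (c : ℕ) + P.κ - 1)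
def cHi (P : Par d) (g : Fin d × Bool) (n : ℕ) (c : Fin 3) : Site d := fun l =>
  if l = g.1 then sgn g.2 * n else
    if n < 4 * P.N then P.base n + P.κ * (c : ℕ) + P.κ - 1 else -(P.base n + P.κ * (c : ℕ))
def cand (P : Par d) (g : Fin d × Bool) (n : ℕ) (c : Fin 3) : Finset (Site d) :=
  Finset.Icc (P.cLo g n c) (P.cHi g n c)

lemma mem_cand (P : Par d) {g : Fin d × Bool} {n : ℕ} {c : Fin 3} {z : Site d} :
    z ∈ P.cand g n c ↔ z g.1 = sgn g.2 * n ∧ ∀ l, l ≠ g.1 →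
      if n < 4 * P.N then P.base n + P.κ * (c : ℕ) ≤ z l ∧ z l ≤ P.base n + P.κ * (c : ℕ) + P.κ - 1
      else -(P.base n + P.κ * (c : ℕ) + P.κ - 1) ≤ z l ∧ z l ≤ -(P.base n + P.κ * (c : ℕ)) := by
  unfold cand
  rw [Finset.mem_Icc]
  constructor
  · rintro ⟨h1, h2⟩
    refine ⟨?_, fun l hl => ?_⟩
    · have a := h1 g.1
      have b := h2 g.1
      simp only [cLo, cHi, if_true] at a b
      omega
    · have a := h1 l
      have b := h2 l
      simp only [cLo, cHi, hl, if_false] at a b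
      split_ifs at a b ⊢
      · exact ⟨a, b⟩
      · exact ⟨a, b⟩
  · rintro ⟨h1, h2⟩
    constructor <;> intro l <;> by_cases hl : l = g.1
    · subst hl; simp [cLo, h1]
    · have := h2 l hl
      simp only [cLo, hl, if_false]
      split_ifs at this ⊢
      · exact this.1
      · exact this.1
    · subst hl; simp [cHi, h1]
    · have := h2 l hl
      simp only [cHi, hl, if_false]
      split_ifs at this ⊢
      · exact this.2
      · exact this.2

lemma cand_card (P : Par d) (g : Fin d × Bool) (n : ℕ) (c : Fin 3) :
    (P.cand g n c).card = P.κ ^ (d - 1) := by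
  unfold cand
  rw [Pi.card_Icc]
  have h1 : ∀ l, (Finset.Icc (P.cLo g n c l) (P.cHi g n c l)).card = if l = g.1 then 1 else P.κ := by
    intro l
    rw [Int.card_Icc]
    by_cases hl : l = g.1
    · simp [cLo, cHi, hl]
    · simp only [cLo, cHi, hl, if_false]
      split_ifs <;> omega
  simp only [h1]
  rw [Finset.prod_ite]
  simp [Finset.filter_ne']

lemma cand_bd (P : Par d) {g : Fin d × Bool} {n : ℕ} {c : Fin 3} {z : Site d}
    (h : z ∈ P.cand g n c) {l : Fin d} (hl : l ≠ g.1) :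
    if n ≤ 3 * P.N then 4 ≤ z l ∧ z l < P.N else
      if n < 4 * P.N then (P.N : ℤ) < z l ∧ z l < 2 * P.N else
        (P.N : ℤ) < - z l ∧ - z l < 2 * P.N := by
  have h1 := (P.mem_cand.1 h).2 l hl
  have := P.hN
  have hc : (P.κ * (c : ℕ) : ℤ) ≤ 2 * P.κ := by
    have : (c : ℕ) ≤ 2 := by omega
    have := Nat.mul_le_mul_left P.κ this
    have h3 : ((P.κ * (c : ℕ) : ℕ) : ℤ) ≤ ((P.κ * 2 : ℕ) : ℤ) := by exact_mod_cast this
    push_cast at h3; omega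
  have hc0 : (0 : ℤ) ≤ (P.κ * (c : ℕ) : ℤ) := by positivity
  generalize (P.κ * (c : ℕ) : ℤ) = w at *
  unfold base at h1
  split_ifs at h1 ⊢ <;> constructor <;> omega

lemma cand_coord (P : Par d) {g : Fin d × Bool} {n : ℕ} {c : Fin 3} {z : Site d}
    (h : z ∈ P.cand g n c) : z g.1 = n ∨ z g.1 = -n := by
  rw [(P.mem_cand.1 h).1]
  cases g.2 <;> simp [sgn]

/-- all candidates -/
def AllC (P : Par d) : Set (Site d) := {z | ∃ g n c, P.N < n ∧ n ≤ P.M ∧ z ∈ P.cand g n c}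

end Par
end

section
namespace Par

lemma mulS (P : Par d) (m : ℤ) : (P.S * m : ℤ) = 0 ∨ (P.S : ℤ) ≤ P.S * m ∨ (P.S * m : ℤ) ≤ -P.S := by
  have : (0 : ℤ) ≤ P.S := by positivity
  rcases lt_trichotomy m 0 with h | h | h
  · right; right; nlinarith
  · left; simp [h]
  · right; left; nlinarith

lemma ex_other (P : Par d) (i : Fin d) : ∃ l, l ≠ i ∧ (l = P.i0 ∨ l = P.i1) := by
  by_cases h : i = P.i0
  · exact ⟨P.i1, by rw [h]; exact P.hi.symm, Or.inr rfl⟩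
  · exact ⟨P.i0, fun h' => h h'.symm, Or.inl rfl⟩

lemma pt_mult (P : Par d) (w0 w1 : ℤ) (l : Fin d) :
    ∃ m : ℤ, P.pt (P.S * w0) (P.S * w1) l = P.S * m := by
  by_cases h0 : l = P.i0
  · exact ⟨w0, by rw [h0]; simp⟩
  by_cases h1 : l = P.i1
  · exact ⟨w1, by rw [h1]; simp⟩
  exact ⟨0, by rw [P.pt_of_ne _ _ h0 h1]; simp⟩

lemma AllC_St (P : Par d) {z : Site d} (hz : z ∈ P.AllC) (w0 w1 : ℤ) :
    z - P.pt (P.S * w0) (P.S * w1) ∉ P.St := by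
  intro h
  obtain ⟨g, n, c, hn, hn', hzc⟩ := hz
  obtain ⟨j, h1, h2⟩ := P.mem_St.1 h
  have h10 := P.N10
  have hS : P.S = 20 * P.N := rfl
  have hMM : P.M = 2 * P.S := rfl
  by_cases hj : j = g.1
  · obtain ⟨l, hl, -⟩ := P.ex_other g.1
    have h3 := h2 l (by rw [hj]; exact hl)
    obtain ⟨m, hm⟩ := P.pt_mult w0 w1 l
    rw [Pi.sub_apply, hm, abs_le] at h3
    have h4 := P.cand_bd hzc hl
    have h5 := P.mulS m
    generalize (P.S * m : ℤ) = u at *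
    split_ifs at h4 <;> omega
  · have h3 := h2 g.1 (fun h => hj h.symm)
    obtain ⟨m, hm⟩ := P.pt_mult w0 w1 g.1
    obtain ⟨m', hm'⟩ := P.pt_mult w0 w1 j
    rw [Pi.sub_apply, hm, abs_le] at h3
    rw [Pi.sub_apply, hm', abs_le] at h1
    have h4 := P.cand_bd hzc hj
    have h5 := P.mulS m
    have h6 := P.mulS m'
    have h7 := P.cand_coord hzc
    generalize (P.S * m : ℤ) = u at *
    generalize (P.S * m' : ℤ) = u' at *
    split_ifs at h4 <;> omega

lemma AllC_res (P : Par d) {z : Site d} (hz : z ∈ P.AllC) (w0 w1 : ℤ) :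
    z - P.pt (P.S * w0) (P.S * w1) ∉ P.resZ := by
  intro h
  obtain ⟨g, n, c, hn, hn', hzc⟩ := hz
  obtain ⟨a, b, h1, h2, h3, h4, h5⟩ := P.mem_resZ.1 h
  have h10 := P.N10
  have hS : P.S = 20 * P.N := rfl
  obtain ⟨l, hl, hl'⟩ := P.ex_other g.1
  obtain ⟨m, hm⟩ := P.pt_mult w0 w1 l
  have h6 := congrFun h5 l
  rw [Pi.sub_apply, hm] at h6
  have h7 := P.cand_bd hzc hl
  have h8 := P.mulS m
  have h9 : (3 * P.N : ℤ) ≤ P.pt a b l ∧ P.pt a b l < P.S - 3 * P.N := by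
    rcases hl' with rfl | rfl
    · simp; omega
    · simp; omega
  generalize (P.S * m : ℤ) = u at *
  split_ifs at h7 <;> omega

lemma AllC_Cor (P : Par d) {z : Site d} (hz : z ∈ P.AllC) {s : ℤ} (hs : IsS s) : z ∉ P.Cor s := by
  intro h
  obtain ⟨g, n, c, hn, hn', hzc⟩ := hz
  obtain ⟨a, b, h1, rfl⟩ := (P.mem_Cor hs).1 h
  have h10 := P.N10
  have hS : P.S = 20 * P.N := rfl
  have hMM : P.M = 2 * P.S := rfl
  have h7 := P.cand_coord hzc
  by_cases hg0 : g.1 = P.i0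
  · have h4 := P.cand_bd hzc (l := P.i1) (by rw [hg0]; exact P.hi.symm)
    rw [hg0] at h7
    simp only [pt_i0, pt_i1] at h4 h7
    rcases hs with rfl | rfl | rfl <;> simp [regC, T, abs_le] at h1 <;> split_ifs at h4 <;> omega
  by_cases hg1 : g.1 = P.i1
  · have h4 := P.cand_bd hzc (l := P.i0) (by rw [hg1]; exact P.hi)
    rw [hg1] at h7
    simp only [pt_i0, pt_i1] at h4 h7
    rcases hs with rfl | rfl | rfl <;> simp [regC, T, abs_le] at h1 <;> split_ifs at h4 <;> omega
  rw [P.pt_of_ne _ _ hg0 hg1] at h7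
  omega

lemma AllC_Cor' (P : Par d) {z : Site d} (hz : z ∈ P.AllC) {s : ℤ} (hs : IsS s) :
    z + P.pt P.S (s * P.S) ∉ P.Cor s := by
  intro h
  obtain ⟨g, n, c, hn, hn', hzc⟩ := hz
  obtain ⟨a, b, h1, hz'⟩ := (P.mem_Cor hs).1 h
  have hz2 : z = P.pt (a - P.S) (b - s * P.S) := by
    rw [← P.pt_sub, ← hz']; simp
  rw [hz2] at hzc
  have h10 := P.N10
  have hS : P.S = 20 * P.N := rfl
  have hMM : P.M = 2 * P.S := rfl
  have h7 := P.cand_coord hzc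
  by_cases hg0 : g.1 = P.i0
  · have h4 := P.cand_bd hzc (l := P.i1) (by rw [hg0]; exact P.hi.symm)
    rw [hg0] at h7
    simp only [pt_i0, pt_i1] at h4 h7
    rcases hs with rfl | rfl | rfl <;> simp [regC, T, abs_le] at h1 <;> split_ifs at h4 <;> omega
  by_cases hg1 : g.1 = P.i1
  · have h4 := P.cand_bd hzc (l := P.i0) (by rw [hg1]; exact P.hi)
    rw [hg1] at h7
    simp only [pt_i0, pt_i1] at h4 h7
    rcases hs with rfl | rfl | rfl <;> simp [regC, T, abs_le] at h1 <;> split_ifs at h4 <;> omega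
  rw [P.pt_of_ne _ _ hg0 hg1] at h7
  omega

/-! catalysts -/

/-- explicit catalysts -/
def off (c : Fin 3) : ℤ := if c = 0 then -1 else if c = 1 then 1 else 2
def tr (P : Par d) (i : Fin d) : Fin d := if i = P.i0 then P.i1 else P.i0
def ecat (P : Par d) (g : Fin d × Bool) (n : ℕ) (c : Fin 3) : Site d := fun l =>
  if l = g.1 then sgn g.2 * n else if l = P.tr g.1 then off c else 0

lemma tr_ne (P : Par d) (i : Fin d) : P.tr i ≠ i := by
  unfold tr; split_ifs with h
  · rw [h]; exact P.hi.symm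
  · exact fun h' => h h'.symm

lemma off_bd (c : Fin 3) : |off c| < 3 ∧ off c ≠ 0 := by
  fin_cases c <;> simp [off]

lemma off_inj {c c' : Fin 3} (h : off c = off c') : c = c' := by
  revert h; fin_cases c <;> fin_cases c' <;> simp [off]

lemma ecat_bd (P : Par d) (g : Fin d × Bool) (n : ℕ) (c : Fin 3) {l : Fin d} (hl : l ≠ g.1) :
    |P.ecat g n c l| < 3 := by
  simp only [ecat, hl, if_false]
  split_ifs
  · exact (off_bd c).1
  · simp

lemma ecat_St (P : Par d) (g : Fin d × Bool) {n : ℕ} (hn : n ≤ P.N) (c : Fin 3) :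
    P.ecat g n c ∈ P.St := by
  rw [mem_St]
  refine ⟨g.1, ?_, fun l hl => (P.ecat_bd g n c hl).le⟩
  simp only [ecat, if_true, abs_sgn_mul, Nat.abs_cast]
  exact_mod_cast hn

lemma ecat_pat (P : Par d) (g : Fin d × Bool) {n : ℕ} (hn : 3 < n) (c : Fin 3) :
    P.patS (P.ecat g n c) = false := by
  have h0 : |P.ecat g n c g.1| = n := by
    simp only [ecat, if_true]; rw [abs_sgn_mul, Nat.abs_cast]
  have h1 : P.ecat g n c (P.tr g.1) = off c := by simp [ecat, P.tr_ne]
  have hoff := off_bd c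
  have hn' : (3 : ℤ) < n := by exact_mod_cast hn
  have hsmall : ∀ a b, P.ecat g n c = P.pt a b → |a| ≤ 3 → |b| ≤ 3 → False := by
    intro a b h ha hb
    rw [h] at h0
    by_cases hg0 : g.1 = P.i0
    · rw [hg0] at h0; simp at h0; omega
    by_cases hg1 : g.1 = P.i1
    · rw [hg1] at h0; simp at h0; omega
    rw [P.pt_of_ne _ _ hg0 hg1] at h0; simp at h0; omega
  unfold patS
  rw [decide_eq_false_iff_not]
  rintro (⟨t, ht, h⟩ | h | h)
  · by_cases hg0 : g.1 = P.i0
    · have h2 : P.tr g.1 = P.i1 := by simp [tr, hg0]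
      rw [h, h2] at h1; simp at h1; exact hoff.2 h1.symm
    · have h2 : P.tr g.1 = P.i0 := by simp [tr, hg0]
      rw [h, h2] at h1; simp at h1
      exact hsmall _ _ h (by rw [h1]; exact hoff.1.le) (by simp)
  · exact hsmall _ _ h (by norm_num) (by norm_num)
  · exact hsmall _ _ h (by norm_num) (by norm_num)

lemma bdry_St (P : Par d) {x : Site d} (hx : x ∈ (Core 3 : Set (Site d))) : x ∈ P.St := by
  rw [mem_St]
  have := P.N10
  refine ⟨P.i0, ?_, fun l _ => hx l⟩
  have := hx P.i0
  push_cast at this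
  omega

lemma bdry_pat (P : Par d) {x : Site d} (hx : x ∈ (Bdry 3 : Set (Site d))) : P.patS x = false := by
  obtain ⟨h1, l, hl⟩ := hx
  have hkey : ∀ a b, x = P.pt a b → |a| ≠ 3 → |b| ≠ 3 → False := by
    intro a b h ha hb
    rw [h] at hl
    push_cast at hl
    by_cases hg0 : l = P.i0
    · rw [hg0] at hl; simp at hl; exact ha hl
    by_cases hg1 : l = P.i1
    · rw [hg1] at hl; simp at hl; exact hb hl
    rw [P.pt_of_ne _ _ hg0 hg1] at hl; simp at hl
  unfold patS
  rw [decide_eq_false_iff_not]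
  rintro (⟨t, ht, h⟩ | h | h)
  · exact hkey _ _ h ht (by norm_num)
  · exact hkey _ _ h (by norm_num) (by norm_num)
  · exact hkey _ _ h (by norm_num) (by norm_num)

/-- goodness of the environment around `0` -/
def Good (P : Par d) : Set (Config d) :=
  {ω | ∀ g n c, P.N < n → n ≤ P.M → ∃ z ∈ P.cand g n c, ω z = false}

def HasSt (P : Par d) : Set (Config d) := {ω | ∀ x ∈ P.St, ω x = P.patS x}

def catOf (P : Par d) (ω : Config d) (g : Fin d × Bool) (n : ℕ) (c : Fin 3) : Site d :=
  if n ≤ P.N then P.ecat g n c else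
    if h : ∃ z ∈ P.cand g n c, ω z = false then h.choose else origin

lemma catOf_spec (P : Par d) {ω : Config d} (hω : ω ∈ P.Good) {g : Fin d × Bool} {n : ℕ} {c : Fin 3}
    (hn : P.N < n) (hn' : n ≤ P.M) :
    P.catOf ω g n c ∈ P.cand g n c ∧ ω (P.catOf ω g n c) = false := by
  have h := hω g n c hn hn'
  unfold catOf
  rw [if_neg (by omega), dif_pos h]
  exact h.choose_spec

def Uset (P : Par d) : Finset (Site d) :=
  (Finset.Icc (fun _ => -(P.M : ℤ)) (fun _ => (P.M : ℤ))).filter fun x => x ∉ (Core 3 : Set (Site d))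

lemma catOK (P : Par d) {ω : Config d} (hω : ω ∈ P.Good) : CatOK 3 P.M (P.catOf ω) P.Uset := by
  refine ⟨?_, ?_, ?_⟩
  · intro g n c h1 h2
    by_cases hn : n ≤ P.N
    · simp [catOf, hn, ecat]
    · exact (P.mem_cand.1 (P.catOf_spec hω (by omega) h2).1).1
  · intro g n c c' h1 h2 hcc h
    by_cases hn : n ≤ P.N
    · simp only [catOf, hn, if_true] at h
      have := congrFun h (P.tr g.1)
      simp only [ecat, P.tr_ne, if_false, if_true] at this
      exact hcc (off_inj this)
    · have a1 := (P.catOf_spec hω (g := g) (c := c) (by omega : P.N < n) h2).1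
      have a2 := (P.catOf_spec hω (g := g) (c := c') (by omega : P.N < n) h2).1
      rw [← h] at a2
      obtain ⟨l, hl, -⟩ := P.ex_other g.1
      have b1 := (P.mem_cand.1 a1).2 l hl
      have b2 := (P.mem_cand.1 a2).2 l hl
      have hk := P.hκ
      have hc : (c : ℕ) ≠ c' := fun h => hcc (Fin.ext h)
      rcases lt_or_gt_of_ne hc with h3 | h3
      · have : (P.κ * (c : ℕ) : ℤ) + P.κ ≤ P.κ * (c' : ℕ) := by
          have : (c : ℕ) + 1 ≤ c' := h3
          have := Nat.mul_le_mul_left P.κ this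
          zify at this; linarith
        generalize (P.κ * (c : ℕ) : ℤ) = u at *
        generalize (P.κ * (c' : ℕ) : ℤ) = u' at *
        split_ifs at b1 b2 <;> omega
      · have : (P.κ * (c' : ℕ) : ℤ) + P.κ ≤ P.κ * (c : ℕ) := by
          have : (c' : ℕ) + 1 ≤ c := h3
          have := Nat.mul_le_mul_left P.κ this
          zify at this; linarith
        generalize (P.κ * (c : ℕ) : ℤ) = u at *
        generalize (P.κ * (c' : ℕ) : ℤ) = u' at *
        split_ifs at b1 b2 <;> omega
  · intro z
    unfold Uset
    rw [Finset.mem_filter, Finset.mem_Icc, mem_Bx]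
    refine and_congr ⟨fun h l => ⟨h.1 l, h.2 l⟩, fun h => ⟨fun l => (h l).1, fun l => (h l).2⟩⟩ Iff.rfl

/-- freely exchangeable sites -/
def Free (P : Par d) : Set (Site d) := {z | (∀ l, |z l| ≤ P.M) ∧ z ∉ P.St ∧ z ∉ P.AllC}

lemma machine_conn (P : Par d) {ω : Config d} (hω : ω ∈ P.Good) (hω' : ω ∈ P.HasSt)
    (l : List (Site d × Site d)) (hl : ∀ p ∈ l, p.1 ∈ P.Free ∧ p.2 ∈ P.Free) :
    Conn P.Uset (20 * d * P.M + l.length) ω (app ω l) := by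
  have h10 := P.N10
  have hS : P.S = 20 * P.N := rfl
  have hMM : P.M = 2 * P.S := rfl
  have hcat : ∀ z ∈ CatS 3 P.M (P.catOf ω), (z ∈ P.St ∧ P.patS z = false) ∨
      (z ∈ P.AllC ∧ ω z = false) := by
    rintro z ⟨g, n, c, h1, h2, rfl⟩
    by_cases hn : n ≤ P.N
    · left
      simp only [catOf, hn, if_true]
      exact ⟨P.ecat_St g hn c, P.ecat_pat g h1 c⟩
    · right
      have := P.catOf_spec hω (g := g) (c := c) (by omega : P.N < n) h2
      exact ⟨⟨g, n, c, by omega, h2, this.1⟩, this.2⟩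
  refine machine (R := 3) (N := P.N) (P.catOK hω) (by norm_num) (by omega) (by omega) ?_ ?_ ?_ P.hi ?_ l ?_
  · intro g n c h1 h2 l hl
    simp only [catOf, h2, if_true]
    exact P.ecat_bd g n c hl
  · intro g n c h1 h2 l hl
    have h3 := P.cand_bd (P.catOf_spec hω (g := g) (c := c) h1 (by omega)).1 hl
    rw [if_pos h2] at h3
    rw [abs_lt]; omega
  · intro g n c h1 h2 l hl
    have h3 := P.cand_bd (P.catOf_spec hω (g := g) (c := c) (by omega) h2).1 hl
    rw [if_neg (by omega)] at h3
    rw [abs_lt]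
    split_ifs at h3 <;> omega
  · rintro z (hz | hz)
    · rw [hω' z (P.bdry_St hz.1), P.bdry_pat hz]
    · rcases hcat z hz with h | h
      · rw [hω' z h.1, h.2]
      · exact h.2
  · have key : ∀ z ∈ P.Free, z ∈ Bx (fun _ : Fin d × Bool => P.M) ∧ z ∉ (Core 3 : Set (Site d)) ∧
        z ∉ CatS 3 P.M (P.catOf ω) := by
      rintro z ⟨h1, h2, h3⟩
      refine ⟨mem_Bx.2 fun l => abs_le.1 (h1 l), fun h => h2 (P.bdry_St h), fun h => ?_⟩
      rcases hcat z h with h | h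
      · exact h2 h.1
      · exact h3 h.1
    exact fun p hp => ⟨key _ (hl p hp).1, key _ (hl p hp).2⟩

end Par
end

section
/-! ### translation of lists -/

lemma app_shift (v : Site d) (ω : Config d) (l : List (Site d × Site d)) :
    app (shift (-v) ω) (l.map fun p => (p.1 - v, p.2 - v)) = shift (-v) (app ω l) := by
  induction l generalizing ω with
  | nil => rfl
  | cons p l ih =>
    rw [List.map_cons, app_cons, app_cons, ← ih, swap_shift]

lemma lab_shift (f : Config d → ℝ) (v X : Site d) (ω : Config d) :
    lab f (shift (-v) ω) (X - v) = lab f ω X + dotZ (e1R d) v := by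
  unfold lab
  rw [shift_shift, dotZ_sub]
  have : -(X - v) + -v = -X := by abel
  rw [this]; ring

/-- lists of disjoint transpositions -/
lemma app_map_not {ι : Type*} (l : List ι) (φ ψ : ι → Site d) (ω : Config d) (z : Site d)
    (h : ∀ i ∈ l, z ≠ φ i ∧ z ≠ ψ i) : app ω (l.map fun i => (φ i, ψ i)) z = ω z := by
  apply app_of_notMem
  intro p hp
  obtain ⟨i, hi, rfl⟩ := List.mem_map.1 hp
  exact ⟨(h i hi).1.symm, (h i hi).2.symm⟩

lemma app_map_aux {ι : Type*} (l : List ι) (hl : l.Nodup) (φ ψ : ι → Site d) (ω : Config d)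
    (hφ : ∀ i ∈ l, ∀ j ∈ l, φ i = φ j → i = j) (hψ : ∀ i ∈ l, ∀ j ∈ l, ψ i = ψ j → i = j)
    (hd : ∀ i ∈ l, ∀ j ∈ l, φ i ≠ ψ j) (i : ι) (hi : i ∈ l) :
    app ω (l.map fun i => (φ i, ψ i)) (φ i) = ω (ψ i) ∧
      app ω (l.map fun i => (φ i, ψ i)) (ψ i) = ω (φ i) := by
  induction l generalizing ω with
  | nil => simp at hi
  | cons j l ih =>
    rw [List.nodup_cons] at hl
    rw [List.map_cons, app_cons]
    have hjl : j ∈ j :: l := by simp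
    by_cases hij : i = j
    · subst hij
      rw [app_map_not, app_map_not]
      · exact ⟨swap_left _ _ _, swap_right _ _ _⟩
      · intro k hk
        have hk' : k ∈ i :: l := List.mem_cons_of_mem _ hk
        refine ⟨(hd k hk' i hi).symm, fun h => hl.1 ?_⟩
        rw [hψ _ hi _ hk' h]; exact hk
      · intro k hk
        have hk' : k ∈ i :: l := List.mem_cons_of_mem _ hk
        refine ⟨fun h => hl.1 ?_, hd i hi k hk'⟩
        rw [hφ _ hi _ hk' h]; exact hk
    · have hi' : i ∈ l := by
        rcases List.mem_cons.1 hi with h | h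
        · exact absurd h hij
        · exact h
      have hs : ∀ k ∈ l, k ∈ j :: l := fun k hk => List.mem_cons_of_mem _ hk
      have := ih hl.2 (swap ω (φ j) (ψ j)) (fun a ha b hb => hφ a (hs a ha) b (hs b hb))
        (fun a ha b hb => hψ a (hs a ha) b (hs b hb)) (fun a ha b hb => hd a (hs a ha) b (hs b hb)) hi'
      rw [this.1, this.2]
      exact ⟨swap_of_ne _ (hd j hjl i hi).symm (fun h => hij (hψ _ hi _ hjl h)),
        swap_of_ne _ (fun h => hij (hφ _ hi _ hjl h)) (hd i hi j hjl)⟩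

def mapL {ι : Type*} (I : Finset ι) (φ ψ : ι → Site d) : List (Site d × Site d) :=
  I.toList.map fun i => (φ i, ψ i)

lemma length_mapL {ι : Type*} (I : Finset ι) (φ ψ : ι → Site d) : (mapL I φ ψ).length = I.card := by
  simp [mapL]

lemma mem_mapL {ι : Type*} {I : Finset ι} {φ ψ : ι → Site d} {p : Site d × Site d} :
    p ∈ mapL I φ ψ ↔ ∃ i ∈ I, (φ i, ψ i) = p := by simp [mapL]

lemma app_mapL_not {ι : Type*} {I : Finset ι} {φ ψ : ι → Site d} (ω : Config d) {z : Site d}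
    (h : ∀ i ∈ I, z ≠ φ i ∧ z ≠ ψ i) : app ω (mapL I φ ψ) z = ω z :=
  app_map_not _ _ _ _ _ (fun i hi => h i (by simpa using hi))

lemma app_mapL {ι : Type*} {I : Finset ι} {φ ψ : ι → Site d} (ω : Config d)
    (hφ : Set.InjOn φ I) (hψ : Set.InjOn ψ I) (hd : ∀ i ∈ I, ∀ j ∈ I, φ i ≠ ψ j) {i : ι} (hi : i ∈ I) :
    app ω (mapL I φ ψ) (φ i) = ω (ψ i) ∧ app ω (mapL I φ ψ) (ψ i) = ω (φ i) :=
  app_map_aux _ I.nodup_toList φ ψ ω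
    (fun a ha b hb h => hφ (by simpa using ha) (by simpa using hb) h)
    (fun a ha b hb h => hψ (by simpa using ha) (by simpa using hb) h)
    (fun a ha b hb => hd a (by simpa using ha) b (by simpa using hb)) i (by simpa using hi)

namespace Par

lemma pat0 (P : Par d) : P.patS origin = true := by
  unfold patS; rw [decide_eq_true_iff]
  exact Or.inl ⟨0, by norm_num, (P.pt_zero).symm⟩

lemma origin_St (P : Par d) : origin ∈ P.St := by
  rw [mem_St]
  exact ⟨P.i0, by simp [origin], fun l _ => by simp [origin]⟩

lemma center_bound {q : ℝ} {μ : Measure (Config d)} (hμ : IsBernoulliProduct q μ)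
    {f : Config d → ℝ} (hf : IsLocal f) (P : Par d) (o : Site d) (l : List (Site d × Site d))
    (hl : ∀ p ∈ l, p.1 - o ∈ P.Free ∧ p.2 - o ∈ P.Free) :
    ∫⁻ ω, (if shift (-o) ω ∈ P.Good ∩ P.HasSt then
      ENNReal.ofReal ((lab f (app ω l) o - lab f ω o) ^ 2) else 0) ∂μ ≤
      cost P.Uset.card (20 * d * P.M + l.length) * energy 2 (e1R d) (condOcc μ) f := by
  set l' := l.map fun p => (p.1 - o, p.2 - o) with hl'
  have h1 := conn_bound hμ hf (U := P.Uset) (r := 20 * d * P.M + l'.length) (X := origin)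
    (by simp [Uset, Core, origin]) (P.Good ∩ P.HasSt) (fun ω => app ω l') (by
      rintro ω ⟨h1, h2⟩
      refine ⟨by rw [h2 _ P.origin_St, P.pat0], P.machine_conn h1 h2 l' ?_⟩
      intro p hp
      obtain ⟨p', hp', rfl⟩ := List.mem_map.1 hp
      exact hl p' hp')
  rw [← lintegral_shift hμ (-o)] at h1
  have hlen : l'.length = l.length := by simp [hl']
  rw [hlen] at h1
  refine le_trans (le_of_eq ?_) h1
  congr 1; funext ω
  have h0 : (origin : Site d) = o - o := by funext i; simp [origin]
  rw [h0, app_shift, lab_shift, lab_shift]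
  congr 3; ring

end Par
end

section
lemma measurable_tagG {f : Config d → ℝ} (hf : IsLocal f) (X y : Site d) :
    Measurable (tagG f X y) := by
  unfold tagG
  refine Measurable.ite ((measurableSet_occ X true).inter (measurableSet_constraint X (X + y))) ?_ measurable_const
  exact measurable_abs.comp
    (((measurable_lab hf (X - y)).comp (measurable_swap X (X + y))).sub (measurable_lab hf X))

lemma tag_static {f : Config d → ℝ} {X e w : Site d} (he : adj origin e) (hw : adj origin w)
    (h1 : w ≠ e) (h2 : w ≠ -e) {σ : Config d} (hX : σ X = true) (hX' : σ (X - e) = true)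
    (hh : σ (X + w) = false) (hh' : σ (X - e + w) = false) :
    |lab f σ (X + e) - lab f σ X| = tagG f X (-e) σ := by
  have hadd : ∀ (Y v : Site d), adj origin v → adj Y (Y + v) := by
    intro Y v hv
    have := (adj_add (v := Y)).2 hv
    have h0 : (origin : Site d) + Y = Y := by funext i; simp [origin]
    rwa [h0, add_comm v Y] at this
  have hc : constraint 2 σ X (X + -e) := by
    rw [constraint_two]
    refine ⟨⟨X + w, hadd _ _ hw, ?_, hh⟩, ⟨X - e + w, ?_, ?_, hh'⟩⟩
    · intro h; exact h2 (add_left_cancel h)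
    · rw [← sub_eq_add_neg]; exact hadd _ _ hw
    · intro h
      apply h1
      have : X - e + w = X - e + e := by rw [h]; abel
      exact add_left_cancel this
  unfold tagG
  rw [if_pos ⟨hX, hc⟩, swap_of_eq, sub_neg_eq_add]
  rw [hX, ← sub_eq_add_neg, hX']

lemma adj_neg' {e : Site d} (he : adj origin e) : adj origin (-e) := by
  unfold adj at *
  rw [← he]
  apply Finset.sum_congr rfl
  intro i _
  simp [origin]

/-- straight static walk -/
lemma segment {q : ℝ} {μ : Measure (Config d)} (hμ : IsBernoulliProduct q μ)
    {f : Config d → ℝ} (hf : IsLocal f) {X e w : Site d} (he : adj origin e) (hw : adj origin w)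
    (h1 : w ≠ e) (h2 : w ≠ -e) (m : ℕ) (Ev : Set (Config d))
    (hE : ∀ σ ∈ Ev, ∀ j : ℤ, -1 ≤ j → j < m → σ (X + j • e) = true ∧ σ (X + j • e + w) = false) :
    ∫⁻ σ, (if σ ∈ Ev then ENNReal.ofReal ((lab f σ (X + (m : ℤ) • e) - lab f σ X) ^ 2) else 0) ∂μ ≤
      (m ^ 2 : ℕ) * energy 2 (e1R d) (condOcc μ) f := by
  have hpt : ∀ σ : Config d, (if σ ∈ Ev then
      ENNReal.ofReal ((lab f σ (X + (m : ℤ) • e) - lab f σ X) ^ 2) else 0) ≤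
      m * ∑ j ∈ Finset.range m, ENNReal.ofReal (tagG f (X + (j : ℤ) • e) (-e) σ ^ 2) := by
    intro σ
    split_ifs with hσ
    · have hstep : ∀ j < m, |lab f σ (X + ((j + 1 : ℕ) : ℤ) • e) - lab f σ (X + (j : ℤ) • e)| =
          tagG f (X + (j : ℤ) • e) (-e) σ := by
        intro j hj
        have a := hE σ hσ j (by omega) (by exact_mod_cast hj)
        have b := hE σ hσ (j - 1) (by omega) (by omega)
        have e1 : X + ((j : ℤ) - 1) • e = X + (j : ℤ) • e - e := by rw [sub_smul, one_smul]; abel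
        rw [e1] at b
        have e2 : X + ((j + 1 : ℕ) : ℤ) • e = X + (j : ℤ) • e + e := by
          push_cast; rw [add_smul, one_smul]; abel
        rw [e2]
        exact tag_static he hw h1 h2 a.1 b.1 a.2 b.2
      have htel : lab f σ (X + (m : ℤ) • e) - lab f σ X = ∑ j ∈ Finset.range m,
          (lab f σ (X + ((j + 1 : ℕ) : ℤ) • e) - lab f σ (X + (j : ℤ) • e)) := by
        rw [Finset.sum_range_sub (fun j : ℕ => lab f σ (X + (j : ℤ) • e))]
        simp
      have hsq : (lab f σ (X + (m : ℤ) • e) - lab f σ X) ^ 2 ≤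
          m * ∑ j ∈ Finset.range m, tagG f (X + (j : ℤ) • e) (-e) σ ^ 2 := by
        rw [htel]
        refine (sq_sum_le_card_mul_sum_sq).trans ?_
        rw [Finset.card_range]
        refine mul_le_mul_of_nonneg_left (Finset.sum_le_sum fun j hj => ?_) (by positivity)
        rw [← hstep j (Finset.mem_range.1 hj), sq_abs]
      refine (ENNReal.ofReal_le_ofReal hsq).trans ?_
      rw [ENNReal.ofReal_mul (by positivity), ENNReal.ofReal_sum_of_nonneg (fun _ _ => by positivity)]
      simp
    · exact zero_le
  refine (lintegral_mono hpt).trans ?_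
  rw [lintegral_const_mul]
  · rw [lintegral_finset_sum]
    · calc (m : ℝ≥0∞) * ∑ j ∈ Finset.range m, ∫⁻ σ, ENNReal.ofReal (tagG f (X + (j : ℤ) • e) (-e) σ ^ 2) ∂μ
          ≤ m * ∑ j ∈ Finset.range m, energy 2 (e1R d) (condOcc μ) f := by
            gcongr with j hj
            exact tag_edge hμ f (adj_neg' he)
        _ = _ := by simp [sq, mul_assoc]
    · intro j _
      exact ENNReal.measurable_ofReal.comp ((measurable_tagG hf _ _).pow_const 2)
  · apply Finset.measurable_sum
    intro j _
    exact ENNReal.measurable_ofReal.comp ((measurable_tagG hf _ _).pow_const 2)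
end

section
def Legal : Config d → List (Site d × Site d) → Prop
  | _, [] => True
  | ω, p :: l => adj p.1 p.2 ∧ constraint 2 ω p.1 p.2 ∧ Legal (swap ω p.1 p.2) l

lemma Legal.append {l l' : List (Site d × Site d)} {ω : Config d} (h : Legal ω l)
    (h' : Legal (app ω l) l') : Legal ω (l ++ l') := by
  induction l generalizing ω with
  | nil => exact h'
  | cons p l ih =>
    obtain ⟨a, b, c⟩ := h
    exact ⟨a, b, ih c h'⟩

lemma Legal.conn {U : Finset (Site d)} {l : List (Site d × Site d)} {ω : Config d} (h : Legal ω l)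
    (hU : ∀ p ∈ l, p.1 ∈ U ∧ p.2 ∈ U) : Conn U l.length ω (app ω l) := by
  suffices H : ∀ (l l₀ : List (Site d × Site d)) (r : ℕ), Legal (app ω l₀) l → l₀.length + l.length ≤ r →
      (∀ p ∈ l₀, p.1 ∈ U ∧ p.2 ∈ U) → (∀ p ∈ l, p.1 ∈ U ∧ p.2 ∈ U) →
      Relation.ReflTransGen (fun a b => Step U a b ∧ Near U r ω a ∧ Near U r ω b)
        (app ω l₀) (app (app ω l₀) l) from H l [] l.length h (by simp) (by simp) hU
  intro l
  induction l with
  | nil => intro l₀ r _ _ _ _; exact Relation.ReflTransGen.refl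
  | cons p l ih =>
    intro l₀ r h hr h0 h1
    obtain ⟨a, b, c⟩ := h
    have e : swap (app ω l₀) p.1 p.2 = app ω (l₀ ++ [p]) := by
      rw [app_append]; rfl
    simp only [List.length_cons] at hr
    have hp := h1 p (by simp)
    have h0' : ∀ p' ∈ l₀ ++ [p], p'.1 ∈ U ∧ p'.2 ∈ U := by
      intro p' hp'
      rcases List.mem_append.1 hp' with h | h
      · exact h0 p' h
      · rw [List.mem_singleton.1 h]; exact hp
    rw [app_cons, e]
    rw [e] at c
    refine Relation.ReflTransGen.head ⟨⟨p.1, hp.1, p.2, hp.2, a, b, e.symm⟩,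
      ⟨l₀, by omega, h0, rfl⟩, ⟨l₀ ++ [p], by simp; omega, h0', rfl⟩⟩ ?_
    exact ih (l₀ ++ [p]) r c (by simp; omega) h0' (fun p' hp' => h1 p' (by simp [hp']))

namespace Par

/-- the two manual moves near a slot centre -/
def bhL (P : Par d) (A B ε : ℤ) : List (Site d × Site d) :=
  [(P.pt (A + 2 * ε) B, P.pt (A + 3 * ε) B), (P.pt (A + 2 * ε) (B - 1), P.pt (A + 2 * ε) B)]

lemma bhL_legal (P : Par d) {A B ε : ℤ} (hε : ε = 1 ∨ ε = -1) {σ : Config d}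
    (h1 : σ (P.pt (A + 2 * ε) (B + 1)) = false) (h2 : σ (P.pt (A + 3 * ε) (B + 1)) = false)
    (h3 : σ (P.pt (A + ε) (B - 1)) = false) : Legal σ (P.bhL A B ε) := by
  have hne : ε ≠ 0 := by omega
  refine ⟨?_, ?_, ?_, ?_, trivial⟩
  · apply adj_pt0; rcases hε with rfl | rfl <;> simp <;> ring_nf <;> norm_num
  · rw [constraint_two]
    refine ⟨⟨_, ?_, ?_, h1⟩, ⟨_, ?_, ?_, h2⟩⟩
    · apply adj_pt1; simp
    · rw [Ne, pt_inj]; omega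
    · apply adj_pt1; simp
    · rw [Ne, pt_inj]; omega
  · apply adj_pt1; simp
  · rw [constraint_two]
    refine ⟨⟨P.pt (A + ε) (B - 1), ?_, ?_, ?_⟩, ⟨P.pt (A + 2 * ε) (B + 1), ?_, ?_, ?_⟩⟩
    · apply adj_pt0; rcases hε with rfl | rfl <;> simp <;> ring_nf <;> norm_num
    · rw [Ne, pt_inj]; omega
    · dsimp only
      rw [swap_of_ne, h3]
      · rw [Ne, pt_inj]; omega
      · rw [Ne, pt_inj]; omega
    · apply adj_pt1; simp
    · rw [Ne, pt_inj]; omega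
    · dsimp only
      rw [swap_of_ne, h1]
      · rw [Ne, pt_inj]; omega
      · rw [Ne, pt_inj]; omega

lemma bhL_val (P : Par d) {A B ε : ℤ} (hε : ε = 1 ∨ ε = -1) {σ : Config d}
    (h1 : σ (P.pt (A + 2 * ε) B) = true) (h2 : σ (P.pt (A + 3 * ε) B) = false)
    (h3 : σ (P.pt (A + 2 * ε) (B - 1)) = true) (a b : ℤ) :
    app σ (P.bhL A B ε) (P.pt a b) =
      if a = A + 3 * ε ∧ b = B then true else if a = A + 2 * ε ∧ b = B - 1 then false else σ (P.pt a b) := by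
  have hne : ε ≠ 0 := by omega
  unfold bhL
  rw [app_cons, app_cons]
  change swap (swap σ _ _) _ _ _ = _
  simp only [swap, pt_inj]
  have e1 : ¬ (B - 1 = B) := by omega
  have e2 : ¬ (A + 2 * ε = A + 3 * ε) := by omega
  have e3 : ¬ (B = B - 1) := by omega
  by_cases ha : a = A + 3 * ε
  · by_cases hb : b = B
    · subst ha hb; simp [e1, e2, e3, h1, Ne.symm e2]
    · subst ha; simp [hb, Ne.symm e2]
  · by_cases ha' : a = A + 2 * ε
    · subst ha'
      by_cases hb : b = B
      · subst hb; simp [h1, h3, e1, e2, e3]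
      · by_cases hb' : b = B - 1
        · subst hb'; simp [h2, e2, e1]
        · simp [hb, hb', e2]
    · simp [ha, ha']

lemma pt_St (P : Par d) {a b : ℤ} (ha : |a| ≤ P.N) (hb : |b| ≤ 3) : P.pt a b ∈ P.St := by
  rw [mem_St]
  refine ⟨P.i0, by simpa using ha, fun l hl => ?_⟩
  by_cases h1 : l = P.i1
  · subst h1; simpa using hb
  · rw [P.pt_of_ne _ _ hl h1]; simp

lemma patS_pt (P : Par d) (a b : ℤ) :
    P.patS (P.pt a b) = decide ((b = 0 ∧ |a| ≠ 3) ∨ (b = -1 ∧ |a| = 2)) := by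
  unfold patS
  rw [decide_eq_decide]
  simp only [pt_inj]
  constructor
  · rintro (⟨t, h, rfl, rfl⟩ | ⟨rfl, rfl⟩ | ⟨rfl, rfl⟩)
    · exact Or.inl ⟨rfl, h⟩
    · right; simp
    · right; simp
  · rintro (⟨rfl, h⟩ | ⟨rfl, h⟩)
    · exact Or.inl ⟨a, h, rfl, rfl⟩
    · rcases abs_eq (by norm_num : (0:ℤ) ≤ 2) |>.1 h with rfl | rfl
      · right; left; simp
      · right; right; simp

/-- destination of a hop -/
def oo (P : Par d) (s : ℤ) : Site d := P.pt P.S (s * P.S)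

/-- configurations ready for the walk -/
def Ready (P : Par d) (s : ℤ) : Set (Config d) :=
  {σ | (∀ x ∈ P.St, σ x = P.patS x) ∧ (∀ x ∈ P.St, σ (P.oo s + x) = P.patS x) ∧
    ∀ x ∈ P.Cor s, σ x = P.patC s x}

def bh (P : Par d) (s : ℤ) : List (Site d × Site d) :=
  P.bhL 0 0 1 ++ P.bhL P.S (s * P.S) (-1)

lemma ready_St (P : Par d) {s : ℤ} {σ : Config d} (h : σ ∈ P.Ready s) {a b : ℤ} (ha : |a| ≤ P.N)
    (hb : |b| ≤ 3) : σ (P.pt a b) = decide ((b = 0 ∧ |a| ≠ 3) ∨ (b = -1 ∧ |a| = 2)) := by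
  rw [h.1 _ (P.pt_St ha hb), patS_pt]

lemma ready_St' (P : Par d) {s : ℤ} {σ : Config d} (h : σ ∈ P.Ready s) {a b : ℤ} (ha : |a - P.S| ≤ P.N)
    (hb : |b - s * P.S| ≤ 3) : σ (P.pt a b) =
      decide ((b = s * P.S ∧ |a - P.S| ≠ 3) ∨ (b = s * P.S - 1 ∧ |a - P.S| = 2)) := by
  have := h.2.1 _ (P.pt_St ha hb)
  rw [oo, pt_add, patS_pt] at this
  rw [show P.pt a b = P.pt (P.S + (a - P.S)) (s * P.S + (b - s * P.S)) by congr 1 <;> ring, this,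
    decide_eq_decide]
  constructor <;> rintro (h | h) <;> omega

lemma bh_legal (P : Par d) {s : ℤ} {σ : Config d} (h : σ ∈ P.Ready s) : Legal σ (P.bh s) := by
  have hN := P.N10
  have hS : P.S = 20 * P.N := rfl
  have h1 : ∀ a b : ℤ, (a = 2 ∧ b = 1) ∨ (a = 3 ∧ b = 1) ∨ (a = 1 ∧ b = -1) → σ (P.pt a b) = false := by
    intro a b hab
    rw [P.ready_St h (by rw [abs_le]; omega) (by rw [abs_le]; omega), decide_eq_false_iff_not]
    rcases hab with ⟨rfl, rfl⟩ | ⟨rfl, rfl⟩ | ⟨rfl, rfl⟩ <;> norm_num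
  have h2 : ∀ a b : ℤ, (a = P.S - 2 ∧ b = s * P.S + 1) ∨ (a = P.S - 3 ∧ b = s * P.S + 1) ∨
      (a = P.S - 1 ∧ b = s * P.S - 1) → app σ (P.bhL 0 0 1) (P.pt a b) = false := by
    intro a b hab
    rw [app_of_notMem, P.ready_St' h (by rw [abs_le]; omega) (by rw [abs_le]; omega), decide_eq_false_iff_not]
    · rcases hab with ⟨rfl, rfl⟩ | ⟨rfl, rfl⟩ | ⟨rfl, rfl⟩ <;> simp <;> omega
    · intro p hp
      simp only [bhL, List.mem_cons, List.not_mem_nil, or_false] at hp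
      rcases hp with rfl | rfl <;> simp only [Ne, pt_inj] <;> omega
  refine Legal.append (P.bhL_legal (Or.inl rfl) (h1 _ _ (by omega)) (h1 _ _ (by omega)) (h1 _ _ (by omega)))
    (P.bhL_legal (Or.inr rfl) (h2 _ _ (by omega)) (h2 _ _ (by omega)) (h2 _ _ (by omega)))

lemma bh_val (P : Par d) {s : ℤ} {σ : Config d} (h : σ ∈ P.Ready s) (a b : ℤ) :
    app σ (P.bh s) (P.pt a b) =
      if (a = 3 ∧ b = 0) ∨ (a = P.S - 3 ∧ b = s * P.S) then true else
      if (a = 2 ∧ b = -1) ∨ (a = P.S - 2 ∧ b = s * P.S - 1) then false else σ (P.pt a b) := by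
  have hN := P.N10
  have hS : P.S = 20 * P.N := rfl
  have v1 := P.bhL_val (A := 0) (B := 0) (ε := 1) (Or.inl rfl) (σ := σ)
    (by rw [P.ready_St h (by rw [abs_le]; omega) (by norm_num)]; norm_num)
    (by rw [P.ready_St h (by rw [abs_le]; omega) (by norm_num)]; norm_num)
    (by rw [P.ready_St h (by rw [abs_le]; omega) (by norm_num)]; norm_num)
  have v2 := P.bhL_val (A := P.S) (B := s * P.S) (ε := -1) (Or.inr rfl) (σ := app σ (P.bhL 0 0 1))
    (by rw [v1, if_neg (by omega), if_neg (by omega),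
          P.ready_St' h (by rw [abs_le]; omega) (by rw [abs_le]; omega), decide_eq_true_iff]; simp)
    (by rw [v1, if_neg (by omega), if_neg (by omega),
          P.ready_St' h (by rw [abs_le]; omega) (by rw [abs_le]; omega), decide_eq_false_iff_not]; simp)
    (by rw [v1, if_neg (by omega), if_neg (by omega),
          P.ready_St' h (by rw [abs_le]; omega) (by rw [abs_le]; omega), decide_eq_true_iff]; simp)
  rw [bh, app_append, v2, v1]
  split_ifs <;> first | rfl | omega

end Par
end

section
namespace Par

lemma ready_Cor (P : Par d) {s : ℤ} (hs : IsS s) {σ : Config d} (h : σ ∈ P.Ready s) {a b : ℤ}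
    (hr : P.regC s a b) : σ (P.pt a b) = decide (P.occC s a b) := by
  rw [h.2.2 _ ((P.mem_Cor hs).2 ⟨a, b, hr, rfl⟩)]
  simp [patC]

def Walk (P : Par d) (s : ℤ) : Set (Config d) :=
  {σ | (∀ j : ℤ, -1 ≤ j → j < P.T s → σ (P.pt j 0) = true ∧ σ (P.pt j (-(sg s))) = false) ∧
    (s ≠ 0 → ∀ j : ℤ, -1 ≤ j → j < P.S → σ (P.pt (P.T s) (s * j)) = true ∧
      σ (P.pt (P.T s + 1) (s * j)) = false) ∧
    (∀ j : ℤ, P.T s - 1 ≤ j → j < P.S → σ (P.pt j (s * P.S)) = true ∧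
      σ (P.pt j (s * P.S + sg s)) = false)}

lemma ready_walk (P : Par d) {s : ℤ} (hs : IsS s) {σ : Config d} (h : σ ∈ P.Ready s) :
    app σ (P.bh s) ∈ P.Walk s := by
  have hN := P.N10
  have hS : P.S = 20 * P.N := rfl
  have hsg : sg s = 1 ∨ sg s = -1 := by unfold sg; split_ifs <;> simp
  have hT : P.T s = 3 * P.N ∧ s = -1 ∨ P.T s = 17 * P.N ∧ (s = 0 ∨ s = 1) := by
    unfold T
    rcases hs with rfl | rfl | rfl <;> simp <;> omega
  refine ⟨?_, ?_, ?_⟩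
  · intro j h1 h2
    have hsS : s * P.S = 0 ∧ s = 0 ∨ s * P.S = P.S ∨ s * P.S = -P.S := by
      rcases hs with rfl | rfl | rfl <;> simp
    rw [P.bh_val h, P.bh_val h]
    by_cases hj : j ≤ P.N
    · rw [P.ready_St h (by rw [abs_le]; omega) (by norm_num),
        P.ready_St h (by rw [abs_le]; omega) (by rw [abs_le]; omega)]
      constructor
      · by_cases h3 : j = 3
        · rw [if_pos (by omega)]
        · rw [if_neg (by omega), if_neg (by omega), decide_eq_true_iff]
          left; refine ⟨rfl, fun h => ?_⟩
          rcases (abs_eq (by norm_num)).1 h with h | h <;> omega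
      · rw [if_neg (by omega)]
        split_ifs with h5
        · rfl
        · rw [decide_eq_false_iff_not]
          rintro (h | ⟨h, h'⟩)
          · omega
          · rcases (abs_eq (by norm_num)).1 h' with h' | h' <;> omega
    · have r1 : P.regC s j 0 := Or.inl ⟨by norm_num, by omega, by omega⟩
      have r2 : P.regC s j (-(sg s)) := Or.inl ⟨by rw [abs_le]; omega, by omega, by omega⟩
      rw [P.ready_Cor hs h r1, P.ready_Cor hs h r2, if_neg (by omega), if_neg (by omega), if_neg (by omega),
        if_neg (by omega)]
      constructor
      · rw [decide_eq_true_iff]; exact Or.inl ⟨rfl, by omega⟩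
      · rw [decide_eq_false_iff_not]
        rintro (h | h | h) <;> omega
  · intro hs0 j h1 h2
    have hss : s = 1 ∨ s = -1 := by rcases hs with h | h | h <;> omega
    have hsj : s * (s * j) = j := by rcases hss with rfl | rfl <;> ring
    rw [P.bh_val h, P.bh_val h]
    have r1 : P.regC s (P.T s) (s * j) := Or.inr (Or.inl ⟨hs0, by omega, by omega, by omega, by omega⟩)
    have r2 : P.regC s (P.T s + 1) (s * j) := Or.inr (Or.inl ⟨hs0, by omega, by omega, by omega, by omega⟩)
    rw [P.ready_Cor hs h r1, P.ready_Cor hs h r2, if_neg (by omega), if_neg (by omega), if_neg (by omega),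
        if_neg (by omega)]
    constructor
    · rw [decide_eq_true_iff]; exact Or.inr (Or.inl ⟨rfl, hs0, by omega, by omega⟩)
    · rw [decide_eq_false_iff_not]
      rintro (h | h | h)
      · omega
      · omega
      · rcases hss with rfl | rfl <;> omega
  · intro j h1 h2
    have hsS : s * P.S = 0 ∧ s = 0 ∨ s * P.S = P.S ∨ s * P.S = -P.S := by
      rcases hs with rfl | rfl | rfl <;> simp
    have hsS2 : s = 0 ∨ s * (s * P.S + sg s) = P.S + 1 := by
      rcases hs with rfl | rfl | rfl <;> simp [sg]; omega
    have hm : s = -1 ∧ sg s = -1 ∨ sg s = 1 := by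
      rcases hs with rfl | rfl | rfl <;> simp [sg]
    rw [P.bh_val h, P.bh_val h]
    by_cases hj : P.S - P.N ≤ j
    · rw [P.ready_St' h (by rw [abs_le]; omega) (by norm_num),
        P.ready_St' h (by rw [abs_le]; omega) (by rw [abs_le]; omega)]
      constructor
      · by_cases h3 : j = P.S - 3
        · rw [if_pos (by omega)]
        · rw [if_neg (by omega), if_neg (by omega), decide_eq_true_iff]
          left; refine ⟨rfl, fun h => ?_⟩
          rcases (abs_eq (by norm_num)).1 h with h | h <;> omega
      · rw [if_neg (by omega)]
        split_ifs with h5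
        · rfl
        · rw [decide_eq_false_iff_not]
          rintro (h | ⟨h, h'⟩)
          · omega
          · rcases (abs_eq (by norm_num)).1 h' with h' | h' <;> omega
    · have r1 : P.regC s j (s * P.S) := Or.inr (Or.inr ⟨by simp, by omega, by omega⟩)
      have r2 : P.regC s j (s * P.S + sg s) := Or.inr (Or.inr ⟨by rw [abs_le]; omega, by omega, by omega⟩)
      rw [P.ready_Cor hs h r1, P.ready_Cor hs h r2, if_neg (by omega), if_neg (by omega), if_neg (by omega),
        if_neg (by omega)]
      constructor
      · rw [decide_eq_true_iff]; exact Or.inr (Or.inr ⟨rfl, by omega⟩)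
      · rw [decide_eq_false_iff_not]
        rintro (h | h | h)
        · omega
        · rcases hsS2 with h' | h' <;> omega
        · omega

lemma adj_o_pt0 (P : Par d) {ε : ℤ} (h : |ε| = 1) : adj origin (P.pt ε 0) := by
  rw [← P.pt_zero]; apply adj_pt0; simpa using h

lemma adj_o_pt1 (P : Par d) {ε : ℤ} (h : |ε| = 1) : adj origin (P.pt 0 ε) := by
  rw [← P.pt_zero]; apply adj_pt1; simpa using h

lemma pt_smul (P : Par d) (j a b : ℤ) : j • P.pt a b = P.pt (j * a) (j * b) := by
  funext l; simp only [pt, Pi.smul_apply, smul_eq_mul]; split_ifs <;> simp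

lemma ofReal_sq3 (x y z w : ℝ) : ENNReal.ofReal ((x - w) ^ 2) ≤
    3 * (ENNReal.ofReal ((x - y) ^ 2) + ENNReal.ofReal ((y - z) ^ 2) + ENNReal.ofReal ((z - w) ^ 2)) := by
  rw [← ENNReal.ofReal_add (by positivity) (by positivity), ← ENNReal.ofReal_add (by positivity) (by positivity),
    show (3 : ℝ≥0∞) = ENNReal.ofReal 3 by simp, ← ENNReal.ofReal_mul (by norm_num)]
  apply ENNReal.ofReal_le_ofReal
  nlinarith [sq_nonneg (x - y - (y - z)), sq_nonneg (x - y - (z - w)), sq_nonneg (y - z - (z - w))]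

lemma lint3 {μ : Measure (Config d)} {a b c : Config d → ℝ≥0∞} (ha : Measurable a) (hb : Measurable b)
    (hc : Measurable c) : ∫⁻ σ, 3 * ((a σ + b σ) + c σ) ∂μ =
      3 * ((∫⁻ σ, a σ ∂μ + ∫⁻ σ, b σ ∂μ) + ∫⁻ σ, c σ ∂μ) := by
  rw [lintegral_const_mul _ (by fun_prop), lintegral_add_left (by fun_prop), lintegral_add_left ha]

lemma walk_bound {q : ℝ} {μ : Measure (Config d)} (hμ : IsBernoulliProduct q μ)
    {f : Config d → ℝ} (hf : IsLocal f) (P : Par d) {s : ℤ} (hs : IsS s) :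
    ∫⁻ σ, (if σ ∈ P.Walk s then
      ENNReal.ofReal ((lab f σ (P.oo s) - lab f σ origin) ^ 2) else 0) ∂μ ≤
      (9 * P.S ^ 2 : ℕ) * energy 2 (e1R d) (condOcc μ) f := by
  have hN := P.N10
  have hS : P.S = 20 * P.N := rfl
  have hsg : sg s = 1 ∨ sg s = -1 := by unfold sg; split_ifs <;> simp
  have hsg' : |sg s| = 1 := by rcases hsg with h | h <;> simp [h]
  obtain ⟨t, ht⟩ : ∃ t : ℕ, P.T s = t := by
    refine ⟨(P.T s).toNat, ?_⟩
    rw [Int.toNat_of_nonneg]; unfold T; split_ifs <;> omega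
  have htS : t ≤ P.S := by zify; rw [← ht]; unfold T; split_ifs <;> omega
  have hb : ∀ m : ℕ, m ≤ P.S → ((m ^ 2 : ℕ) : ℝ≥0∞) * energy 2 (e1R d) (condOcc μ) f ≤
      (P.S ^ 2 : ℕ) * energy 2 (e1R d) (condOcc μ) f := by
    intro m hm
    have : m ^ 2 ≤ P.S ^ 2 := Nat.pow_le_pow_left hm 2
    gcongr
  have m1 : ∀ X Y : Site d, Measurable fun σ : Config d =>
      ENNReal.ofReal ((lab f σ X - lab f σ Y) ^ 2) := fun X Y =>
    ENNReal.measurable_ofReal.comp (((measurable_lab hf _).sub (measurable_lab hf _)).pow_const 2)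
  have mW : MeasurableSet (P.Walk s) := by
    unfold Walk
    simp only [Set.setOf_and, Set.setOf_forall]
    refine MeasurableSet.inter ?_ (MeasurableSet.inter ?_ ?_)
    · exact MeasurableSet.iInter fun j => MeasurableSet.iInter fun _ => MeasurableSet.iInter fun _ =>
        (measurableSet_occ _ _).inter (measurableSet_occ _ _)
    · exact MeasurableSet.iInter fun _ => MeasurableSet.iInter fun j => MeasurableSet.iInter fun _ => MeasurableSet.iInter fun _ =>
        (measurableSet_occ _ _).inter (measurableSet_occ _ _)
    · exact MeasurableSet.iInter fun j => MeasurableSet.iInter fun _ => MeasurableSet.iInter fun _ =>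
        (measurableSet_occ _ _).inter (measurableSet_occ _ _)
  have s1 := segment hμ hf (X := origin) (e := P.pt 1 0) (w := P.pt 0 (-(sg s))) (P.adj_o_pt0 (by simp))
    (P.adj_o_pt1 (by rw [abs_neg, hsg'])) (by rw [Ne, pt_inj]; omega) (by rw [pt_neg, Ne, pt_inj]; omega)
    t (P.Walk s) (by
      intro σ hσ j h1 h2
      have := hσ.1 j h1 (by omega)
      rw [← P.pt_zero, pt_smul, pt_add, pt_add]
      simpa using this)
  have s2 : ∫⁻ σ, (if σ ∈ P.Walk s then
      ENNReal.ofReal ((lab f σ (P.pt t (s * P.S)) - lab f σ (P.pt t 0)) ^ 2) else 0) ∂μ ≤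
      (P.S ^ 2 : ℕ) * energy 2 (e1R d) (condOcc μ) f := by
    by_cases hs0 : s = 0
    · subst hs0; simp
    have hss : s = 1 ∨ s = -1 := by rcases hs with h | h | h <;> omega
    have hs' : |s| = 1 := by rcases hss with h | h <;> simp [h]
    have := segment hμ hf (X := P.pt t 0) (e := P.pt 0 s) (w := P.pt 1 0) (P.adj_o_pt1 hs')
      (P.adj_o_pt0 (by simp)) (by rw [Ne, pt_inj]; omega) (by rw [pt_neg, Ne, pt_inj]; omega)
      P.S (P.Walk s) (by
        intro σ hσ j h1 h2
        have := hσ.2.1 hs0 j h1 h2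
        rw [pt_smul, pt_add, pt_add]
        simpa [← ht, mul_comm] using this)
    rw [pt_smul, pt_add] at this
    simpa [mul_comm s] using this
  have s3 := segment hμ hf (X := P.pt t (s * P.S)) (e := P.pt 1 0) (w := P.pt 0 (sg s)) (P.adj_o_pt0 (by simp))
    (P.adj_o_pt1 hsg') (by rw [Ne, pt_inj]; omega) (by rw [pt_neg, Ne, pt_inj]; omega)
    (P.S - t) (P.Walk s) (by
      intro σ hσ j h1 h2
      have := hσ.2.2 (t + j) (by omega) (by omega)
      rw [pt_smul, pt_add, pt_add]
      simpa using this)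
  have e1 : origin + (t : ℤ) • P.pt 1 0 = P.pt t 0 := by
    rw [← P.pt_zero, pt_smul, pt_add]; simp
  have e3 : P.pt t (s * P.S) + ((P.S - t : ℕ) : ℤ) • P.pt 1 0 = P.oo s := by
    rw [pt_smul, pt_add, oo]; push_cast [htS]; simp
  rw [e1] at s1
  rw [e3] at s3
  calc _ ≤ ∫⁻ σ, 3 * (((if σ ∈ P.Walk s then ENNReal.ofReal ((lab f σ (P.oo s) - lab f σ (P.pt t (s * P.S))) ^ 2) else 0) +
        (if σ ∈ P.Walk s then ENNReal.ofReal ((lab f σ (P.pt t (s * P.S)) - lab f σ (P.pt t 0)) ^ 2) else 0)) +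
        (if σ ∈ P.Walk s then ENNReal.ofReal ((lab f σ (P.pt t 0) - lab f σ origin) ^ 2) else 0)) ∂μ := by
        apply lintegral_mono
        intro σ
        dsimp only
        split_ifs
        · exact ofReal_sq3 _ _ _ _
        · exact zero_le
    _ = 3 * ((∫⁻ σ, (if σ ∈ P.Walk s then ENNReal.ofReal ((lab f σ (P.oo s) - lab f σ (P.pt t (s * P.S))) ^ 2) else 0) ∂μ +
        ∫⁻ σ, (if σ ∈ P.Walk s then ENNReal.ofReal ((lab f σ (P.pt t (s * P.S)) - lab f σ (P.pt t 0)) ^ 2) else 0) ∂μ) +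
        ∫⁻ σ, (if σ ∈ P.Walk s then ENNReal.ofReal ((lab f σ (P.pt t 0) - lab f σ origin) ^ 2) else 0) ∂μ) := by
        have mi : ∀ X Y : Site d, Measurable fun σ : Config d =>
            (if σ ∈ P.Walk s then ENNReal.ofReal ((lab f σ X - lab f σ Y) ^ 2) else 0) :=
          fun X Y => Measurable.ite mW (m1 X Y) measurable_const
        exact lint3 (mi _ _) (mi _ _) (mi _ _)
    _ ≤ 3 * (((P.S ^ 2 : ℕ) * energy 2 (e1R d) (condOcc μ) f + (P.S ^ 2 : ℕ) * energy 2 (e1R d) (condOcc μ) f) +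
          (P.S ^ 2 : ℕ) * energy 2 (e1R d) (condOcc μ) f) := by
        gcongr
        · exact s3.trans (hb _ (by omega))
        · exact s1.trans (hb _ htS)
    _ = _ := by push_cast; ring

end Par
end

section
namespace Par

abbrev Key (d : ℕ) := Option ℤ × Site d

def KN (P : Par d) : Finset (Key d) := P.St.image fun x => (none, x)
def KC (P : Par d) (s : ℤ) : Finset (Key d) := (P.Cor s).image fun x => (some s, x)
def Keys (P : Par d) : Finset (Key d) := P.KN ∪ (P.KC (-1) ∪ (P.KC 0 ∪ P.KC 1))
def kp (P : Par d) (k : Key d) : Bool :=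
  match k.1 with
  | none => P.patS k.2
  | some s => P.patC s k.2

/-- injective allocation of resources -/
structure Res (P : Par d) where
  φ : Key d → Site d
  inj : Set.InjOn φ P.Keys
  mem : ∀ k ∈ P.Keys, φ k ∈ P.resZ

lemma KN_sub (P : Par d) : P.KN ⊆ P.Keys := Finset.subset_union_left
lemma KC_sub (P : Par d) {s : ℤ} (hs : IsS s) : P.KC s ⊆ P.Keys := by
  intro k hk
  simp only [Keys, Finset.mem_union]
  rcases hs with rfl | rfl | rfl <;> simp [hk]

lemma mem_KN {P : Par d} {k : Key d} : k ∈ P.KN ↔ k.1 = none ∧ k.2 ∈ P.St := by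
  unfold KN
  rw [Finset.mem_image]
  constructor
  · rintro ⟨x, hx, rfl⟩; exact ⟨rfl, hx⟩
  · rintro ⟨h1, h2⟩; exact ⟨k.2, h2, by rw [← h1]⟩

lemma mem_KC {P : Par d} {s : ℤ} {k : Key d} : k ∈ P.KC s ↔ k.1 = some s ∧ k.2 ∈ P.Cor s := by
  unfold KC
  rw [Finset.mem_image]
  constructor
  · rintro ⟨x, hx, rfl⟩; exact ⟨rfl, hx⟩
  · rintro ⟨h1, h2⟩; exact ⟨k.2, h2, by rw [← h1]⟩

def Dr (P : Par d) (R : P.Res) : Set (Config d) :=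
  {ω | ω ∈ P.HasSt ∧ ∀ k ∈ P.Keys, ω (R.φ k) = P.kp k}

def tgt (P : Par d) (s : ℤ) (k : Key d) : Site d := if k.1 = none then P.oo s + k.2 else k.2

variable (P : Par d) (R : P.Res)

def L1 (s : ℤ) : List (Site d × Site d) := mapL (P.KN ∪ P.KC s) R.φ (P.tgt s)
def L2a (s : ℤ) : List (Site d × Site d) := mapL (P.KC s) R.φ (P.tgt s)
def L2b (s : ℤ) : List (Site d × Site d) := mapL (P.Keys \ P.KN) R.φ (fun k => P.oo s + R.φ k)
def L2c (s : ℤ) : List (Site d × Site d) := mapL P.KN Prod.snd (fun k => P.oo s + R.φ k)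
def L2 (s : ℤ) : List (Site d × Site d) := P.L2a R s ++ (P.L2b R s ++ P.L2c R s)
def hopL (s : ℤ) : List (Site d × Site d) := P.L1 R s ++ P.L2 R s

/-- slot sites -/
def Slot : Finset (Site d) := P.St ∪ P.Keys.image R.φ

lemma St_a {x : Site d} (h : x ∈ P.St) : -(P.N : ℤ) ≤ x P.i0 ∧ x P.i0 ≤ P.N := abs_le.1 (P.St_le h _)

lemma res_a {x : Site d} (h : x ∈ P.resZ) : (4 * P.N : ℤ) ≤ x P.i0 ∧ x P.i0 < P.S - 4 * P.N := by
  obtain ⟨a, b, h1, h2, h3, h4, rfl⟩ := P.mem_resZ.1 h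
  simp; omega

lemma cor_a {s : ℤ} (hs : IsS s) {x : Site d} (h : x ∈ P.Cor s) :
    (P.N : ℤ) < x P.i0 ∧ x P.i0 < P.S - P.N := by
  obtain ⟨a, b, h1, rfl⟩ := (P.mem_Cor hs).1 h
  have := P.regC_bd hs h1
  simp; omega

lemma cor_res {s : ℤ} (hs : IsS s) {x : Site d} (h : x ∈ P.Cor s) : x ∉ P.resZ := by
  obtain ⟨a, b, h1, rfl⟩ := (P.mem_Cor hs).1 h
  intro h2
  obtain ⟨a', b', h2, h3, h4, h5, h6⟩ := P.mem_resZ.1 h2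
  obtain ⟨rfl, rfl⟩ := P.pt_inj.1 h6
  have := P.N10
  have hS : P.S = 20 * P.N := rfl
  rcases hs with rfl | rfl | rfl <;> simp [regC, T, abs_le] at h1 <;> omega

lemma oo_a (s : ℤ) (x : Site d) : (P.oo s + x) P.i0 = P.S + x P.i0 := by simp [oo]

lemma phi_St {k : Key d} (hk : k ∈ P.Keys) : R.φ k ∉ P.St := by
  intro h
  have h1 := P.St_a h
  have h2 := P.res_a (R.mem k hk)
  have := P.N10
  omega

lemma phi_ne_tgt {s : ℤ} (hs : IsS s) {k k' : Key d} (hk : k ∈ P.Keys) (hk' : k' ∈ P.KN ∪ P.KC s) :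
    R.φ k ≠ P.tgt s k' := by
  intro h
  have h2 := P.res_a (R.mem k hk)
  have h10 := P.N10
  have hS : P.S = 20 * P.N := rfl
  rcases Finset.mem_union.1 hk' with h3 | h3
  · rw [mem_KN] at h3
    rw [tgt, if_pos h3.1] at h
    have := P.St_a h3.2
    have e := congrFun h P.i0
    rw [oo_a] at e
    omega
  · rw [mem_KC] at h3
    rw [tgt, if_neg (by rw [h3.1]; simp)] at h
    exact P.cor_res hs h3.2 (h ▸ R.mem k hk)

lemma tgt_inj {s : ℤ} (hs : IsS s) : Set.InjOn (P.tgt s) (P.KN ∪ P.KC s : Finset (Key d)) := by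
  intro k hk k' hk' h
  have h10 := P.N10
  have hS : P.S = 20 * P.N := rfl
  rw [Finset.mem_coe, Finset.mem_union, mem_KN, mem_KC] at hk hk'
  rcases hk with hk | hk <;> rcases hk' with hk' | hk'
  · rw [tgt, tgt, if_pos hk.1, if_pos hk'.1] at h
    exact Prod.ext (hk.1.trans hk'.1.symm) (add_left_cancel h)
  · rw [tgt, tgt, if_pos hk.1, if_neg (by rw [hk'.1]; simp)] at h
    have a := P.St_a hk.2
    have b := P.cor_a hs hk'.2
    have e := congrFun h P.i0
    rw [oo_a] at e; omega
  · rw [tgt, tgt, if_pos hk'.1, if_neg (by rw [hk.1]; simp)] at h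
    have a := P.St_a hk'.2
    have b := P.cor_a hs hk.2
    have e := congrFun h P.i0
    rw [oo_a] at e; omega
  · rw [tgt, tgt, if_neg (by rw [hk.1]; simp), if_neg (by rw [hk'.1]; simp)] at h
    exact Prod.ext (hk.1.trans hk'.1.symm) h

lemma keys_s {s : ℤ} (hs : IsS s) : P.KN ∪ P.KC s ⊆ P.Keys :=
  Finset.union_subset P.KN_sub (P.KC_sub hs)

lemma L1_val {s : ℤ} (hs : IsS s) (ω : Config d) {k : Key d} (hk : k ∈ P.KN ∪ P.KC s) :
    app ω (P.L1 R s) (R.φ k) = ω (P.tgt s k) ∧ app ω (P.L1 R s) (P.tgt s k) = ω (R.φ k) :=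
  app_mapL ω (R.inj.mono (by exact_mod_cast P.keys_s hs)) (P.tgt_inj hs)
    (fun i hi j hj => P.phi_ne_tgt R hs (P.keys_s hs hi) hj) hk

lemma L2a_val {s : ℤ} (hs : IsS s) (ω : Config d) {k : Key d} (hk : k ∈ P.KC s) :
    app ω (P.L2a R s) (R.φ k) = ω (P.tgt s k) ∧ app ω (P.L2a R s) (P.tgt s k) = ω (R.φ k) :=
  app_mapL ω (R.inj.mono (by exact_mod_cast P.KC_sub hs))
    ((P.tgt_inj hs).mono (by exact_mod_cast Finset.subset_union_right))
    (fun i hi j hj => P.phi_ne_tgt R hs (P.KC_sub hs hi) (Finset.mem_union_right _ hj)) hk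

lemma L2b_val {s : ℤ} (ω : Config d) {k : Key d} (hk : k ∈ P.Keys \ P.KN) :
    app ω (P.L2b R s) (R.φ k) = ω (P.oo s + R.φ k) ∧ app ω (P.L2b R s) (P.oo s + R.φ k) = ω (R.φ k) := by
  have hsub : ((P.Keys \ P.KN : Finset (Key d)) : Set (Key d)) ⊆ P.Keys := by
    exact_mod_cast Finset.sdiff_subset
  refine app_mapL ω (R.inj.mono hsub) ?_ ?_ hk
  · intro i hi j hj h
    exact R.inj (hsub hi) (hsub hj) (add_left_cancel h)
  · intro i hi j hj h
    have a := P.res_a (R.mem i (hsub hi))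
    have b := P.res_a (R.mem j (hsub hj))
    have e := congrFun h P.i0
    rw [oo_a] at e
    have := P.N10
    omega

lemma L2c_val {s : ℤ} (ω : Config d) {k : Key d} (hk : k ∈ P.KN) :
    app ω (P.L2c R s) k.2 = ω (P.oo s + R.φ k) ∧ app ω (P.L2c R s) (P.oo s + R.φ k) = ω k.2 := by
  refine app_mapL (φ := Prod.snd) ω ?_ ?_ ?_ hk
  · intro i hi j hj h
    rw [Finset.mem_coe, mem_KN] at hi hj
    exact Prod.ext (hi.1.trans hj.1.symm) h
  · intro i hi j hj h
    exact R.inj (P.KN_sub hi) (P.KN_sub hj) (add_left_cancel h)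
  · intro i hi j hj h
    have a := P.St_a (mem_KN.1 hi).2
    have b := P.res_a (R.mem j (P.KN_sub hj))
    have e := congrFun h P.i0
    rw [oo_a] at e
    have := P.N10
    omega

lemma L1_ready {s : ℤ} (hs : IsS s) {ω : Config d} (h : ω ∈ P.Dr R) : app ω (P.L1 R s) ∈ P.Ready s := by
  have h10 := P.N10
  have hS : P.S = 20 * P.N := rfl
  refine ⟨?_, ?_, ?_⟩
  · intro x hx
    rw [← h.1 x hx]
    apply app_mapL_not
    intro k hk
    refine ⟨fun e => P.phi_St R (P.keys_s hs hk) (e ▸ hx), fun e => ?_⟩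
    have hx' := P.St_a hx
    have e' := congrFun e P.i0
    rcases Finset.mem_union.1 hk with h3 | h3
    · rw [mem_KN] at h3
      rw [tgt, if_pos h3.1, oo_a] at e'
      have := P.St_a h3.2
      omega
    · rw [mem_KC] at h3
      rw [tgt, if_neg (by rw [h3.1]; simp)] at e'
      have := P.cor_a hs h3.2
      omega
  · intro x hx
    have hk : ((none, x) : Key d) ∈ P.KN := mem_KN.2 ⟨rfl, hx⟩
    have := (P.L1_val R hs ω (Finset.mem_union_left _ hk)).2
    rw [h.2 _ (P.KN_sub hk)] at this
    simpa [tgt, kp] using this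
  · intro x hx
    have hk : ((some s, x) : Key d) ∈ P.KC s := mem_KC.2 ⟨rfl, hx⟩
    have := (P.L1_val R hs ω (Finset.mem_union_right _ hk)).2
    rw [h.2 _ (P.KC_sub hs hk)] at this
    simpa [tgt, kp] using this

/-- after the corridor has been restored -/
lemma L2a_rest {s : ℤ} (hs : IsS s) (ω : Config d) {z : Site d}
    (hz : ∀ k ∈ P.KN, z ≠ R.φ k ∧ z ≠ P.oo s + k.2) :
    app (app ω (P.L1 R s)) (P.L2a R s) z = ω z := by
  by_cases h1 : ∃ k ∈ P.KC s, z = R.φ k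
  · obtain ⟨k, hk, rfl⟩ := h1
    rw [(P.L2a_val R hs _ hk).1, (P.L1_val R hs _ (Finset.mem_union_right _ hk)).2]
  by_cases h2 : ∃ k ∈ P.KC s, z = P.tgt s k
  · obtain ⟨k, hk, rfl⟩ := h2
    rw [(P.L2a_val R hs _ hk).2, (P.L1_val R hs _ (Finset.mem_union_right _ hk)).1]
  push Not at h1 h2
  rw [L2a, app_mapL_not _ (fun k hk => ⟨h1 k hk, h2 k hk⟩), L1, app_mapL_not]
  intro k hk
  rcases Finset.mem_union.1 hk with h3 | h3
  · have := hz k h3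
    rw [tgt, if_pos (mem_KN.1 h3).1]; exact this
  · exact ⟨h1 k h3, h2 k h3⟩

lemma L2a_oo {s : ℤ} (hs : IsS s) {ω : Config d} (h : ω ∈ P.Dr R) {x : Site d} (hx : x ∈ P.St) :
    app (app ω (P.L1 R s)) (P.L2a R s) (P.oo s + x) = P.patS x := by
  rw [← (P.L1_ready R hs h).2.1 x hx]
  have h10 := P.N10
  have hS : P.S = 20 * P.N := rfl
  apply app_mapL_not
  intro k hk
  have a := P.St_a hx
  have b := P.res_a (R.mem k (P.KC_sub hs hk))
  have hk' := mem_KC.1 hk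
  have c := P.cor_a hs hk'.2
  constructor <;> intro e <;> have e' := congrFun e P.i0 <;> rw [oo_a] at e'
  · omega
  · rw [tgt, if_neg (by rw [hk'.1]; simp)] at e'; omega

/-- net effect of a hop off the slots -/
lemma hop_off {s : ℤ} (hs : IsS s) (ω : Config d) {z : Site d} (h1 : z ∉ P.Slot R)
    (h2 : z - P.oo s ∉ P.Slot R) : app ω (P.hopL R s) z = ω z := by
  simp only [Slot, Finset.mem_union, Finset.mem_image, not_or, not_exists, not_and] at h1 h2
  have e : ∀ y, z = P.oo s + y → z - P.oo s = y := fun y h => by rw [h]; simp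
  rw [hopL, L2, app_append, app_append, app_append, L2c, app_mapL_not, L2b, app_mapL_not, L2a_rest _ _ hs]
  · intro k hk
    exact ⟨fun h => h1.2 k (P.KN_sub hk) h.symm, fun h => h2.1 (by rw [e _ h]; exact (mem_KN.1 hk).2)⟩
  · intro k hk
    have hk' := (Finset.mem_sdiff.1 hk).1
    exact ⟨fun h => h1.2 k hk' h.symm, fun h => h2.2 k hk' (e _ h).symm⟩
  · intro k hk
    exact ⟨fun h => h1.1 (by rw [h]; exact (mem_KN.1 hk).2), fun h => h2.2 k (P.KN_sub hk) (e _ h).symm⟩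

lemma shift_neg_apply (v x : Site d) (ω : Config d) : shift (-v) ω x = ω (v + x) := by
  simp [shift, add_comm]

lemma hop_Dr {s : ℤ} (hs : IsS s) {ω : Config d} (h : ω ∈ P.Dr R) :
    shift (-(P.oo s)) (app ω (P.hopL R s)) ∈ P.Dr R := by
  have h10 := P.N10
  have hS : P.S = 20 * P.N := rfl
  have e0 : app ω (P.hopL R s) = app (app (app (app ω (P.L1 R s)) (P.L2a R s)) (P.L2b R s)) (P.L2c R s) := by
    rw [hopL, L2, app_append, app_append, app_append]
  refine ⟨?_, ?_⟩
  · intro x hx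
    rw [shift_neg_apply, e0, ← P.L2a_oo R hs h hx, L2c, app_mapL_not, L2b, app_mapL_not]
    · intro k hk
      have a := P.St_a hx
      have b := P.res_a (R.mem k (Finset.mem_sdiff.1 hk).1)
      constructor <;> intro e <;> have e' := congrFun e P.i0 <;> rw [oo_a] at e'
      · omega
      · rw [oo_a] at e'; omega
    · intro k hk
      have a := P.St_a hx
      have b := P.res_a (R.mem k (P.KN_sub hk))
      have c := P.St_a (mem_KN.1 hk).2
      constructor <;> intro e <;> have e' := congrFun e P.i0 <;> rw [oo_a] at e'
      · omega
      · rw [oo_a] at e'; omega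
  · intro k hk
    rw [shift_neg_apply, e0]
    have b := P.res_a (R.mem k hk)
    by_cases hkn : k ∈ P.KN
    · rw [(P.L2c_val R _ hkn).2, L2b, app_mapL_not, L2a_rest _ _ hs]
      · rw [h.1 _ (mem_KN.1 hkn).2, kp, (mem_KN.1 hkn).1]
      · intro k' hk'
        have a := P.St_a (mem_KN.1 hkn).2
        have a' := P.St_a (mem_KN.1 hk').2
        have b' := P.res_a (R.mem k' (P.KN_sub hk'))
        constructor <;> intro e <;> have e' := congrFun e P.i0
        · omega
        · rw [oo_a] at e'; omega
      · intro k' hk'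
        have a := P.St_a (mem_KN.1 hkn).2
        have b' := P.res_a (R.mem k' (Finset.mem_sdiff.1 hk').1)
        constructor <;> intro e <;> have e' := congrFun e P.i0
        · omega
        · rw [oo_a] at e'; omega
    · rw [L2c, app_mapL_not, (P.L2b_val R _ (Finset.mem_sdiff.2 ⟨hk, hkn⟩)).2, L2a_rest _ _ hs, h.2 k hk]
      · intro k' hk'
        constructor
        · intro e
          exact hkn (R.inj hk (P.KN_sub hk') e ▸ hk')
        · intro e
          have e' := congrFun e P.i0
          have a' := P.St_a (mem_KN.1 hk').2
          rw [oo_a] at e'; omega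
      · intro k' hk'
        constructor
        · intro e
          have e' := congrFun e P.i0
          have a' := P.St_a (mem_KN.1 hk').2
          rw [oo_a] at e'; omega
        · intro e
          exact hkn (R.inj hk (P.KN_sub hk') (add_left_cancel e) ▸ hk')

end Par
end

section
lemma origin_zero : (origin : Site d) = 0 := rfl

namespace Par
variable (P : Par d) (R : P.Res)

lemma pt_abs (a b : ℤ) (B : ℤ) (ha : |a| ≤ B) (hb : |b| ≤ B) (l : Fin d) : |P.pt a b l| ≤ B := by
  have := (abs_nonneg a).trans ha
  unfold pt; split_ifs
  · exact ha
  · exact hb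
  · simpa using this

lemma abs3 {w : ℤ} (h : IsS w) (S : ℕ) : |(S : ℤ) * w| ≤ S := by
  rcases h with rfl | rfl | rfl <;> simp

lemma free_res {x : Site d} (hx : x ∈ P.resZ) {w0 w1 : ℤ} (h0 : IsS w0) (h1 : IsS w1) :
    x + P.pt (P.S * w0) (P.S * w1) ∈ P.Free := by
  have h10 := P.N10
  have hS : P.S = 20 * P.N := rfl
  have hMM : P.M = 2 * P.S := rfl
  refine ⟨?_, ?_, ?_⟩
  · obtain ⟨a, b, h2, h3, h4, h5, rfl⟩ := P.mem_resZ.1 hx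
    intro l
    rw [P.pt_add]
    apply P.pt_abs
    · have := abs_le.1 (abs3 h0 P.S)
      rw [abs_le]; omega
    · have := abs_le.1 (abs3 h1 P.S)
      rw [abs_le]; omega
  · intro h
    have a := P.St_a h
    have b := P.res_a hx
    simp only [Pi.add_apply, pt_i0] at a
    rcases h0 with rfl | rfl | rfl <;> simp at a <;> omega
  · intro h
    apply P.AllC_res h w0 w1
    simpa using hx

lemma free_St {x : Site d} (hx : x ∈ P.St) {w0 w1 : ℤ} (h0 : IsS w0) (h1 : IsS w1) (hw : w0 ≠ 0) :
    x + P.pt (P.S * w0) (P.S * w1) ∈ P.Free := by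
  have h10 := P.N10
  have hS : P.S = 20 * P.N := rfl
  have hMM : P.M = 2 * P.S := rfl
  refine ⟨?_, ?_, ?_⟩
  · intro l
    have h2 := abs_le.1 (P.St_le hx l)
    have h3 := abs_le.1 (P.pt_abs _ _ _ (abs3 h0 P.S) (abs3 h1 P.S) l)
    rw [Pi.add_apply, abs_le]
    omega
  · intro h
    have a := P.St_a h
    have b := P.St_a hx
    simp only [Pi.add_apply, pt_i0] at a
    rcases h0 with rfl | rfl | rfl <;> simp at a <;> omega
  · intro h
    apply P.AllC_St h w0 w1
    simpa using hx

lemma free_Cor {x : Site d} {s : ℤ} (hs : IsS s) (hx : x ∈ P.Cor s) : x ∈ P.Free ∧ x - P.oo s ∈ P.Free := by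
  have h10 := P.N10
  have hS : P.S = 20 * P.N := rfl
  have hMM : P.M = 2 * P.S := rfl
  have ha := P.cor_a hs hx
  have hsS := abs_le.1 (abs3 hs P.S)
  have hx' := hx
  obtain ⟨a, b, h1, h2⟩ := (P.mem_Cor hs).1 hx'
  have h3 := P.regC_bd hs h1
  refine ⟨⟨?_, ?_, ?_⟩, ⟨?_, ?_, ?_⟩⟩
  · intro l; rw [h2]; apply P.pt_abs <;> rw [abs_le] <;> omega
  · intro h
    have := P.St_a h; omega
  · intro h; exact P.AllC_Cor h hs hx
  · intro l; rw [h2, oo, pt_sub]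
    have : s * P.S = P.S * s := by ring
    have hb : -(P.S + 1 : ℤ) ≤ b - s * P.S ∧ b - s * P.S ≤ P.S + 1 := by
      rcases hs with rfl | rfl | rfl <;> simp [regC, T, abs_le] at h1 ⊢ <;> omega
    apply P.pt_abs <;> rw [abs_le] <;> omega
  · intro h
    have := P.St_a h
    simp [oo] at this; omega
  · intro h
    apply P.AllC_Cor' h hs
    simpa [oo] using hx

lemma oo_pt (s : ℤ) : P.oo s = P.pt (P.S * 1) (P.S * s) := by
  rw [oo, mul_one, mul_comm]
lemma oo_neg (s : ℤ) : - P.oo s = P.pt (P.S * (-1)) (P.S * (-s)) := by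
  rw [oo_pt, pt_neg]; congr 1 <;> ring
lemma IsS.neg {s : ℤ} (h : IsS s) : IsS (-s) := by unfold IsS at *; omega

lemma L1_free {s : ℤ} (hs : IsS s) : ∀ p ∈ P.L1 R s, p.1 ∈ P.Free ∧ p.2 ∈ P.Free := by
  intro p hp
  obtain ⟨k, hk, rfl⟩ := mem_mapL.1 hp
  have hk' := P.keys_s hs hk
  constructor
  · have := P.free_res (R.mem k hk') (w0 := 0) (w1 := 0) (by simp [IsS]) (by simp [IsS])
    simpa [pt_zero, origin_zero] using this
  · rcases Finset.mem_union.1 hk with h3 | h3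
    · rw [mem_KN] at h3
      rw [tgt, if_pos h3.1, oo_pt, add_comm]
      exact P.free_St h3.2 (by simp [IsS]) hs (by simp)
    · rw [mem_KC] at h3
      rw [tgt, if_neg (by rw [h3.1]; simp)]
      exact (P.free_Cor hs h3.2).1

lemma L2_free {s : ℤ} (hs : IsS s) : ∀ p ∈ P.L2 R s, p.1 - P.oo s ∈ P.Free ∧ p.2 - P.oo s ∈ P.Free := by
  have fr : ∀ k ∈ P.Keys, R.φ k - P.oo s ∈ P.Free ∧ P.oo s + R.φ k - P.oo s ∈ P.Free := by
    intro k hk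
    constructor
    · rw [sub_eq_add_neg, oo_neg]
      exact P.free_res (R.mem k hk) (by simp [IsS]) hs.neg
    · have := P.free_res (R.mem k hk) (w0 := 0) (w1 := 0) (by simp [IsS]) (by simp [IsS])
      simpa [pt_zero, origin_zero] using this
  intro p hp
  simp only [L2, List.mem_append] at hp
  rcases hp with hp | hp | hp <;> obtain ⟨k, hk, rfl⟩ := mem_mapL.1 hp
  · refine ⟨(fr k (P.KC_sub hs hk)).1, ?_⟩
    rw [mem_KC] at hk
    dsimp only
    rw [tgt, if_neg (by rw [hk.1]; simp)]
    exact (P.free_Cor hs hk.2).2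
  · exact fr k (Finset.mem_sdiff.1 hk).1
  · refine ⟨?_, (fr k (P.KN_sub hk)).2⟩
    dsimp only
    rw [sub_eq_add_neg, oo_neg]
    exact P.free_St (mem_KN.1 hk).2 (by simp [IsS]) hs.neg (by simp)

lemma measurableSet_Good : MeasurableSet P.Good := by
  apply measurableSet_finite (Finset.univ.biUnion fun g => (Finset.range (P.M + 1)).biUnion fun n =>
    Finset.univ.biUnion fun c => P.cand g n c)
  have key : ∀ η η' : Config d, (∀ x ∈ (Finset.univ.biUnion fun g => (Finset.range (P.M + 1)).biUnion fun n =>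
    Finset.univ.biUnion fun c => P.cand g n c), η x = η' x) → η ∈ P.Good → η' ∈ P.Good := by
    intro η η' h hη g n c h1 h2
    obtain ⟨z, hz, hz'⟩ := hη g n c h1 h2
    refine ⟨z, hz, ?_⟩
    rw [← h z, hz']
    simp only [Finset.mem_biUnion, Finset.mem_univ, true_and, Finset.mem_range]
    exact ⟨g, n, by omega, c, hz⟩
  exact fun η η' h => ⟨key η η' h, key η' η fun x hx => (h x hx).symm⟩

lemma measurableSet_pat {ι : Type*} (I : Finset ι) (φ : ι → Site d) (v : ι → Bool) :
    MeasurableSet {ω : Config d | ∀ i ∈ I, ω (φ i) = v i} := by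
  have : {ω : Config d | ∀ i ∈ I, ω (φ i) = v i} = ⋂ i ∈ I, {ω | ω (φ i) = v i} := by
    ext; simp
  rw [this]
  exact Finset.measurableSet_biInter _ fun i _ => measurableSet_occ _ _

lemma measurableSet_HasSt : MeasurableSet P.HasSt := measurableSet_pat P.St id P.patS
lemma measurableSet_Dr : MeasurableSet (P.Dr R) :=
  P.measurableSet_HasSt.inter (measurableSet_pat P.Keys R.φ P.kp)
lemma measurableSet_Ready (s : ℤ) : MeasurableSet (P.Ready s) :=
  (measurableSet_pat P.St id P.patS).inter ((measurableSet_pat P.St (fun x => P.oo s + x) P.patS).inter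
    (measurableSet_pat (P.Cor s) id (P.patC s)))

def HopEv (s : ℤ) : Set (Config d) := {ω | ω ∈ P.Good ∧ shift (-(P.oo s)) ω ∈ P.Good ∧ ω ∈ P.Dr R}

/-- Good only depends on candidates -/
lemma Good_congr {ω ω' : Config d} (h : ∀ z ∈ P.AllC, ω z = ω' z) : ω ∈ P.Good ↔ ω' ∈ P.Good := by
  have key : ∀ {ω ω' : Config d}, (∀ z ∈ P.AllC, ω z = ω' z) → ω ∈ P.Good → ω' ∈ P.Good := by
    intro ω ω' h hω g n c h1 h2
    obtain ⟨z, hz, hz'⟩ := hω g n c h1 h2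
    exact ⟨z, hz, by rw [← h z ⟨g, n, c, h1, h2, hz⟩, hz']⟩
  exact ⟨key h, key fun z hz => (h z hz).symm⟩

lemma L1_good {s : ℤ} (hs : IsS s) {ω : Config d} (h : shift (-(P.oo s)) ω ∈ P.Good) :
    shift (-(P.oo s)) (app ω (P.L1 R s)) ∈ P.Good := by
  refine (P.Good_congr ?_).1 h
  intro z hz
  rw [shift_neg_apply, shift_neg_apply, L1, app_mapL_not]
  intro k hk
  constructor
  · intro e
    apply P.AllC_res hz (-1) (-s)
    rw [← oo_neg, sub_neg_eq_add, add_comm, e]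
    exact R.mem k (P.keys_s hs hk)
  · intro e
    rcases Finset.mem_union.1 hk with h3 | h3
    · rw [mem_KN] at h3
      rw [tgt, if_pos h3.1] at e
      apply P.AllC_St hz 0 0
      have := add_left_cancel e
      simpa [pt_zero, origin_zero, this] using h3.2
    · rw [mem_KC] at h3
      rw [tgt, if_neg (by rw [h3.1]; simp)] at e
      apply P.AllC_Cor' hz hs
      rw [← oo, add_comm, e]; exact h3.2

end Par

lemma ofReal_sq5 (x1 x2 x3 x4 x5 x6 : ℝ) : ENNReal.ofReal ((x6 - x1) ^ 2) ≤
    5 * (ENNReal.ofReal ((x2 - x1) ^ 2) + (ENNReal.ofReal ((x3 - x2) ^ 2) + (ENNReal.ofReal ((x4 - x3) ^ 2) +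
      (ENNReal.ofReal ((x4 - x5) ^ 2) + ENNReal.ofReal ((x6 - x5) ^ 2))))) := by
  rw [← ENNReal.ofReal_add (by positivity) (by positivity), ← ENNReal.ofReal_add (by positivity) (by positivity),
    ← ENNReal.ofReal_add (by positivity) (by positivity), ← ENNReal.ofReal_add (by positivity) (by positivity),
    show (5 : ℝ≥0∞) = ENNReal.ofReal 5 by simp, ← ENNReal.ofReal_mul (by norm_num)]
  apply ENNReal.ofReal_le_ofReal
  set a := x2 - x1
  set b := x3 - x2
  set c := x4 - x3
  set e := x4 - x5
  set g := x6 - x5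
  have : x6 - x1 = a + b + c - e + g := by ring
  rw [this]
  nlinarith [sq_nonneg (a - b), sq_nonneg (a - c), sq_nonneg (a + e), sq_nonneg (a - g), sq_nonneg (b - c),
    sq_nonneg (b + e), sq_nonneg (b - g), sq_nonneg (c + e), sq_nonneg (c - g), sq_nonneg (e + g)]

lemma lint5 {μ : Measure (Config d)} {a b c e g : Config d → ℝ≥0∞} (ha : Measurable a) (hb : Measurable b)
    (hc : Measurable c) (he : Measurable e) (hg : Measurable g) :
    ∫⁻ σ, 5 * (a σ + (b σ + (c σ + (e σ + g σ)))) ∂μ =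
      5 * (∫⁻ σ, a σ ∂μ + (∫⁻ σ, b σ ∂μ + (∫⁻ σ, c σ ∂μ + (∫⁻ σ, e σ ∂μ + ∫⁻ σ, g σ ∂μ)))) := by
  rw [lintegral_const_mul _ (by fun_prop), lintegral_add_left ha, lintegral_add_left hb,
    lintegral_add_left hc, lintegral_add_left he]

namespace Par
variable (P : Par d) (R : P.Res)

def bhU (s : ℤ) : Finset (Site d) := ((P.bh s).map Prod.fst ++ (P.bh s).map Prod.snd).toFinset
lemma bhU_card (s : ℤ) : (P.bhU s).card ≤ 8 := by
  refine (List.toFinset_card_le _).trans ?_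
  simp [bh, bhL]

lemma cost_mono {u u' r r' : ℕ} (h : u ≤ u') (h' : r ≤ r') : cost u r ≤ cost u' r' := by
  unfold cost
  gcongr
  exact Nat.le_add_left 1 _

def KK : ℝ≥0∞ := 5 * (2 * cost P.Uset.card (20 * d * P.M + 4 * P.Keys.card) + 2 * cost 8 4 + 9 * P.S ^ 2 : ℕ)

lemma KNC_card {s : ℤ} (hs : IsS s) : (P.L1 R s).length ≤ 4 * P.Keys.card ∧ (P.L2 R s).length ≤ 4 * P.Keys.card := by
  have h1 := Finset.card_le_card (P.keys_s hs)
  have h2 := Finset.card_le_card P.KN_sub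
  have h3 := Finset.card_le_card (P.KC_sub hs)
  have h4 := Finset.card_le_card (Finset.sdiff_subset (s := P.Keys) (t := P.KN))
  simp only [L1, L2, L2a, L2b, L2c, List.length_append, length_mapL]
  omega

lemma bh_bound {q : ℝ} {μ : Measure (Config d)} (hμ : IsBernoulliProduct q μ)
    {f : Config d → ℝ} (hf : IsLocal f) {s : ℤ} (hs : IsS s) {X : Site d} (hX : X = origin ∨ X = P.oo s) :
    ∫⁻ σ, (if σ ∈ P.Ready s then
      ENNReal.ofReal ((lab f (app σ (P.bh s)) X - lab f σ X) ^ 2) else 0) ∂μ ≤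
      cost 8 4 * energy 2 (e1R d) (condOcc μ) f := by
  have h10 := P.N10
  have hS : P.S = 20 * P.N := rfl
  have hXU : X ∉ P.bhU s := by
    rcases hX with rfl | rfl
    · rw [← P.pt_zero]
      simp [bhU, bh, bhL, pt_inj]; omega
    · simp [bhU, bh, bhL, pt_inj, oo]; omega
  refine (conn_bound (r := 4) hμ hf hXU (P.Ready s) (fun σ => app σ (P.bh s)) ?_).trans ?_
  · intro σ hσ
    constructor
    · rcases hX with rfl | rfl
      · rw [← P.pt_zero, P.ready_St hσ (by simp) (by simp)]; simp
      · rw [oo, P.ready_St' hσ (by simp) (by simp)]; simp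
    · refine (P.bh_legal hσ).conn (U := P.bhU s) (fun p hp => ?_)
      simp only [bhU, List.mem_toFinset, List.mem_append, List.mem_map]
      exact ⟨Or.inl ⟨p, hp, rfl⟩, Or.inr ⟨p, hp, rfl⟩⟩
  · gcongr
    exact_mod_cast cost_mono (P.bhU_card s) le_rfl

theorem hop_bound {q : ℝ} {μ : Measure (Config d)} (hμ : IsBernoulliProduct q μ)
    {f : Config d → ℝ} (hf : IsLocal f) {s : ℤ} (hs : IsS s) :
    ∫⁻ ω, (if ω ∈ P.HopEv R s then
      ENNReal.ofReal ((lab f (app ω (P.hopL R s)) (P.oo s) - lab f ω origin) ^ 2) else 0) ∂μ ≤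
      P.KK * energy 2 (e1R d) (condOcc μ) f := by
  set E := energy 2 (e1R d) (condOcc μ) f
  have mR := P.measurableSet_Ready s
  have mL := measurable_app (P.L1 R s)
  have hz : ∀ ω : Config d, shift (-(origin : Site d)) ω = ω := by
    intro ω; funext z; simp [shift, origin_zero]
  -- the five terms
  let F1 : Config d → ℝ≥0∞ := fun ω => if shift (-(origin : Site d)) ω ∈ P.Good ∩ P.HasSt then
    ENNReal.ofReal ((lab f (app ω (P.L1 R s)) origin - lab f ω origin) ^ 2) else 0
  let G2 : Site d → Config d → ℝ≥0∞ := fun X σ => if σ ∈ P.Ready s then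
    ENNReal.ofReal ((lab f (app σ (P.bh s)) X - lab f σ X) ^ 2) else 0
  let G3 : Config d → ℝ≥0∞ := fun σ => if σ ∈ P.Walk s then
    ENNReal.ofReal ((lab f σ (P.oo s) - lab f σ origin) ^ 2) else 0
  let G3' : Config d → ℝ≥0∞ := fun σ => if σ ∈ P.Ready s then
    ENNReal.ofReal ((lab f (app σ (P.bh s)) (P.oo s) - lab f (app σ (P.bh s)) origin) ^ 2) else 0
  let G5 : Config d → ℝ≥0∞ := fun σ => if shift (-(P.oo s)) σ ∈ P.Good ∩ P.HasSt then
    ENNReal.ofReal ((lab f (app σ (P.L2 R s)) (P.oo s) - lab f σ (P.oo s)) ^ 2) else 0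
  have mlab : ∀ (l : List (Site d × Site d)) X, Measurable fun ω : Config d => lab f (app ω l) X :=
    fun l X => (measurable_lab hf X).comp (measurable_app l)
  have mlab0 := fun X => measurable_lab hf X
  have msq : ∀ {g h : Config d → ℝ}, Measurable g → Measurable h →
      Measurable fun ω => ENNReal.ofReal ((g ω - h ω) ^ 2) := fun hg hh => ((hg.sub hh).pow_const 2).ennreal_ofReal
  have mGS := P.measurableSet_Good.inter P.measurableSet_HasSt
  have m1 : Measurable F1 := Measurable.ite (measurable_shift _ mGS) (msq (mlab _ _) (mlab0 _)) measurable_const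
  have m2 : ∀ X, Measurable (G2 X) := fun X => Measurable.ite mR (msq (mlab _ _) (mlab0 _)) measurable_const
  have m3 : Measurable G3' := Measurable.ite mR (msq (mlab _ _) (mlab _ _)) measurable_const
  have m5 : Measurable G5 := Measurable.ite (measurable_shift _ mGS) (msq (mlab _ _) (mlab0 _)) measurable_const
  have b1 : ∫⁻ ω, F1 ω ∂μ ≤ cost P.Uset.card (20 * d * P.M + 4 * P.Keys.card) * E := by
    refine (center_bound hμ hf P origin (P.L1 R s) ?_).trans ?_
    · intro p hp
      have := P.L1_free R hs p hp
      have e : ∀ z : Site d, z - origin = z := fun z => by funext l; simp [origin]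
      rw [e, e]; exact this
    · gcongr
      exact_mod_cast cost_mono le_rfl (by have := P.KNC_card R hs; omega)
  have b5 : ∫⁻ ω, G5 (app ω (P.L1 R s)) ∂μ ≤ cost P.Uset.card (20 * d * P.M + 4 * P.Keys.card) * E := by
    rw [lintegral_app hμ]
    refine (center_bound hμ hf P (P.oo s) (P.L2 R s) (P.L2_free R hs)).trans ?_
    gcongr
    exact_mod_cast cost_mono le_rfl (by have := P.KNC_card R hs; omega)
  have b2 : ∀ X, X = origin ∨ X = P.oo s → ∫⁻ ω, G2 X (app ω (P.L1 R s)) ∂μ ≤ cost 8 4 * E := by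
    intro X hX
    rw [lintegral_app hμ]
    exact P.bh_bound hμ hf hs hX
  have b3 : ∫⁻ ω, G3' (app ω (P.L1 R s)) ∂μ ≤ (9 * P.S ^ 2 : ℕ) * E := by
    rw [lintegral_app hμ]
    calc ∫⁻ σ, G3' σ ∂μ ≤ ∫⁻ σ, G3 (app σ (P.bh s)) ∂μ := by
          apply lintegral_mono
          intro σ
          simp only [G3', G3]
          split_ifs with h1 h2
          · exact le_rfl
          · exact absurd (P.ready_walk hs h1) h2
          · exact zero_le
          · exact zero_le
      _ = ∫⁻ σ, G3 σ ∂μ := lintegral_app hμ _ _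
      _ ≤ _ := walk_bound hμ hf P hs
  calc _ ≤ ∫⁻ ω, 5 * (F1 ω + (G2 origin (app ω (P.L1 R s)) + (G3' (app ω (P.L1 R s)) +
          (G2 (P.oo s) (app ω (P.L1 R s)) + G5 (app ω (P.L1 R s)))))) ∂μ := by
        apply lintegral_mono
        intro ω
        dsimp only
        split_ifs with h
        · obtain ⟨h1, h2, h3⟩ := h
          have r := P.L1_ready R hs h3
          have r5 : shift (-(P.oo s)) (app ω (P.L1 R s)) ∈ P.Good ∩ P.HasSt :=
            ⟨P.L1_good R hs h2, fun x hx => by rw [shift_neg_apply]; exact r.2.1 x hx⟩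
          have r1 : shift (-(origin : Site d)) ω ∈ P.Good ∩ P.HasSt := by
            rw [hz]; exact ⟨h1, h3.1⟩
          simp only [F1, G2, G3', G5, if_pos r, if_pos r5, if_pos r1]
          rw [hopL, app_append]
          exact ofReal_sq5 _ _ _ _ _ _
        · exact zero_le
    _ = 5 * (∫⁻ ω, F1 ω ∂μ + (∫⁻ ω, G2 origin (app ω (P.L1 R s)) ∂μ + (∫⁻ ω, G3' (app ω (P.L1 R s)) ∂μ +
          (∫⁻ ω, G2 (P.oo s) (app ω (P.L1 R s)) ∂μ + ∫⁻ ω, G5 (app ω (P.L1 R s)) ∂μ)))) :=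
        lint5 m1 ((m2 _).comp mL) (m3.comp mL) ((m2 _).comp mL) (m5.comp mL)
    _ ≤ 5 * (cost P.Uset.card (20 * d * P.M + 4 * P.Keys.card) * E + (cost 8 4 * E + ((9 * P.S ^ 2 : ℕ) * E +
          (cost 8 4 * E + cost P.Uset.card (20 * d * P.M + 4 * P.Keys.card) * E)))) := by
        gcongr
        · exact b2 _ (Or.inl rfl)
        · exact b2 _ (Or.inr rfl)
    _ = _ := by unfold KK; push_cast; ring

end Par
end

section
/-- A depends only on coordinates in T -/
def DepOn (T : Set (Site d)) (A : Set (Config d)) : Prop :=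
  ∀ ω ω' : Config d, (∀ x ∈ T, ω x = ω' x) → (ω ∈ A ↔ ω' ∈ A)

lemma DepOn.mono {T T' : Set (Site d)} {A : Set (Config d)} (h : DepOn T A) (hT : T ⊆ T') : DepOn T' A :=
  fun ω ω' hh => h ω ω' fun x hx => hh x (hT hx)

lemma DepOn.inter {T T' : Set (Site d)} {A A' : Set (Config d)} (h : DepOn T A) (h' : DepOn T' A') :
    DepOn (T ∪ T') (A ∩ A') := fun ω ω' hh =>
  and_congr (h ω ω' fun x hx => hh x (Or.inl hx)) (h' ω ω' fun x hx => hh x (Or.inr hx))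

lemma iIndep_coord {q : ℝ} {μ : Measure (Config d)} (hμ : IsBernoulliProduct q μ) :
    ProbabilityTheory.iIndepFun (fun (x : Site d) (ω : Config d) => ω x) μ := by
  haveI := hμ.1
  have m0 : Measurable (fun ω : Config d => ω origin) := measurable_pi_apply origin
  set ν : Measure Bool := μ.map (fun ω : Config d => ω origin) with hν
  haveI : IsProbabilityMeasure ν := Measure.isProbabilityMeasure_map m0.aemeasurable
  have h1 : ∀ b, ν {b} = ENNReal.ofReal (if b then 1 - q else q) := by
    intro b
    rw [hν, Measure.map_apply m0 (measurableSet_singleton b)]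
    have := hμ.2 {origin} (fun _ => b)
    have e : (fun ω : Config d => ω origin) ⁻¹' {b} = {η | ∀ x ∈ ({origin} : Finset (Site d)), η x = b} := by
      ext; simp
    rw [e, this]; simp
  have h2 : μ = Measure.infinitePi (fun _ : Site d => ν) := by
    apply bern_unique hμ
    refine ⟨inferInstance, fun S ζ => ?_⟩
    have : {η : Config d | ∀ x ∈ S, η x = ζ x} = Set.pi S (fun x => {ζ x}) := by
      ext η; simp [Set.mem_pi]
    rw [this, Measure.infinitePi_pi _ (fun _ _ => measurableSet_singleton _)]
    exact Finset.prod_congr rfl fun x _ => h1 _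
  rw [h2]
  exact ProbabilityTheory.iIndepFun_infinitePi (X := fun (x : Site d) (b : Bool) => b) (fun _ => measurable_id)

lemma indep_dep {q : ℝ} {μ : Measure (Config d)} (hμ : IsBernoulliProduct q μ) {T T' : Set (Site d)}
    (hT : Disjoint T T') {A A' : Set (Config d)} (mA : MeasurableSet A) (mA' : MeasurableSet A')
    (hA : DepOn T A) (hA' : DepOn T' A') : μ (A ∩ A') = μ A * μ A' := by
  have hi := iIndep_coord hμ
  have h1 := ProbabilityTheory.indep_iSup_of_disjoint
    (m := fun x : Site d => MeasurableSpace.comap (fun ω : Config d => ω x) inferInstance)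
    (fun x => (measurable_pi_apply x).comap_le) hi hT
  rw [ProbabilityTheory.Indep_iff] at h1
  have key : ∀ (T : Set (Site d)) (A : Set (Config d)), MeasurableSet A → DepOn T A →
      MeasurableSet[⨆ x ∈ T, MeasurableSpace.comap (fun ω : Config d => ω x) inferInstance] A := by
    intro T A mA hA
    let π : Config d → Config d := fun ω x => if x ∈ T then ω x else true
    have hπ : Measurable[⨆ x ∈ T, MeasurableSpace.comap (fun ω : Config d => ω x) inferInstance] π := by
      refine @measurable_pi_lambda _ _ _ (⨆ x ∈ T, MeasurableSpace.comap (fun ω : Config d => ω x) inferInstance) _ π ?_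
      intro x
      by_cases hx : x ∈ T
      · simp only [π, hx, if_true]
        apply Measurable.mono (comap_measurable (fun ω : Config d => ω x)) _ le_rfl
        exact le_iSup₂_of_le x hx le_rfl
      · simp only [π, hx, if_false]
        exact measurable_const
    have : A = π ⁻¹' A := by
      ext ω
      exact hA ω (π ω) fun x hx => by simp [π, hx]
    rw [this]
    exact hπ mA
  exact h1 A A' (key T A mA hA) (key T' A' mA' hA')

lemma indep_fin {q : ℝ} {μ : Measure (Config d)} (hμ : IsBernoulliProduct q μ) {ι : Type*} (V : Finset ι)
    (T : ι → Set (Site d)) (A : ι → Set (Config d)) (mA : ∀ i, MeasurableSet (A i))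
    (hA : ∀ i, DepOn (T i) (A i)) (hT : ∀ i ∈ V, ∀ j ∈ V, i ≠ j → Disjoint (T i) (T j)) (ε : ℝ≥0∞)
    (hε : ∀ i ∈ V, μ (A i) ≤ ε) : μ (⋂ i ∈ V, A i) ≤ ε ^ V.card := by
  haveI := hμ.1
  induction V using Finset.induction_on with
  | empty => simp
  | insert a V ha ih =>
    have hD : DepOn (⋃ i ∈ V, T i) (⋂ i ∈ V, A i) := by
      intro ω ω' h
      simp only [Set.mem_iInter]
      refine forall₂_congr fun i hi => hA i ω ω' fun x hx => h x ?_
      simp only [Set.mem_iUnion]; exact ⟨i, hi, hx⟩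
    rw [Finset.set_biInter_insert, Finset.card_insert_of_notMem ha, pow_succ', indep_dep hμ _ (mA a)
      (Finset.measurableSet_biInter _ fun i _ => mA i) (hA a) hD]
    · refine mul_le_mul' (hε a (by simp)) (ih ?_ ?_)
      · intro i hi j hj; exact hT i (by simp [hi]) j (by simp [hj])
      · intro i hi; exact hε i (by simp [hi])
    · simp only [Set.disjoint_iUnion_right]
      intro i hi
      exact hT a (by simp) i (by simp [hi]) (fun h => ha (h ▸ hi))

/-! ### Lipschitz percolation, deterministic part -/

def RR (B : ℤ → ℕ → Prop) : ℕ → ℤ → ℕ → Prop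
  | 0, _, y => y = 0
  | n + 1, x, y => RR B n x y ∨ (∃ y', y = y' + 1 ∧ B x y ∧ RR B n x y') ∨
      RR B n (x - 1) (y + 1) ∨ RR B n (x + 1) (y + 1)

def Rch (B : ℤ → ℕ → Prop) (x : ℤ) (y : ℕ) : Prop := ∃ n, RR B n x y
def Top (B : ℤ → ℕ → Prop) (x : ℤ) (y : ℕ) : Prop := Rch B x y ∧ ∀ y', y < y' → ¬ Rch B x y'

section
variable {B : ℤ → ℕ → Prop} {x : ℤ} {y : ℕ}

lemma Rch.zero : Rch B x 0 := ⟨0, rfl⟩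
lemma Rch.up (h : Rch B x y) (hb : B x (y + 1)) : Rch B x (y + 1) := by
  obtain ⟨n, h⟩ := h
  exact ⟨n + 1, Or.inr (Or.inl ⟨y, rfl, hb, h⟩)⟩
lemma Rch.down (h : Rch B (x + 1) (y + 1)) : Rch B x y := by
  obtain ⟨n, h⟩ := h
  exact ⟨n + 1, Or.inr (Or.inr (Or.inr h))⟩
lemma Rch.down' (h : Rch B x (y + 1)) : Rch B (x + 1) y := by
  obtain ⟨n, h⟩ := h
  exact ⟨n + 1, Or.inr (Or.inr (Or.inl (by simpa using h)))⟩
lemma Top.good (h : Top B x y) : ¬ B x (y + 1) := fun hb => h.2 _ (Nat.lt_succ_self _) (h.1.up hb)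
lemma Top.unique {y' : ℕ} (h : Top B x y) (h' : Top B x y') : y = y' := by
  by_contra hne
  rcases lt_or_gt_of_ne hne with hh | hh
  · exact h.2 _ hh h'.1
  · exact h'.2 _ hh h.1
lemma Top.lip {y' : ℕ} (h : Top B x y) (h' : Top B (x + 1) y') : y ≤ y' + 1 ∧ y' ≤ y + 1 := by
  constructor
  · by_contra hh
    obtain ⟨z, rfl⟩ : ∃ z, y = z + 1 := ⟨y - 1, by omega⟩
    exact h'.2 z (by omega) h.1.down'
  · by_contra hh
    obtain ⟨z, rfl⟩ : ∃ z, y' = z + 1 := ⟨y' - 1, by omega⟩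
    exact h.2 z (by omega) h'.1.down
lemma ex_Top_of_bd (N : ℕ) (h : ∀ y', N < y' → ¬ Rch B x y') : ∃ y, y ≤ N ∧ Top B x y := by
  induction N with
  | zero => exact ⟨0, le_rfl, Rch.zero, h⟩
  | succ N ih =>
    by_cases hN : Rch B x (N + 1)
    · exact ⟨N + 1, le_rfl, hN, h⟩
    · obtain ⟨y, hy, h'⟩ := ih (fun y' hy' hr => by
        rcases Nat.lt_or_ge (N + 1) y' with hh | hh
        · exact h y' hh hr
        · exact hN ((show y' = N + 1 by omega) ▸ hr))
      exact ⟨y, by omega, h'⟩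
lemma Top.ex_right (h : Top B x y) : ∃ y', Top B (x + 1) y' := by
  obtain ⟨y', _, h'⟩ := ex_Top_of_bd (B := B) (x := x + 1) (y + 1) (fun y' hy' hr => by
    obtain ⟨z, rfl⟩ : ∃ z, y' = z + 1 := ⟨y' - 1, by omega⟩
    exact h.2 z (by omega) hr.down)
  exact ⟨y', h'⟩
lemma Top.ex_left (h : Top B (x + 1) y) : ∃ y', Top B x y' := by
  obtain ⟨y', _, h'⟩ := ex_Top_of_bd (B := B) (x := x) (y + 1) (fun y' hy' hr => by
    obtain ⟨z, rfl⟩ : ∃ z, y' = z + 1 := ⟨y' - 1, by omega⟩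
    exact h.2 z (by omega) hr.down')
  exact ⟨y', h'⟩

lemma RR_shift (B : ℤ → ℕ → Prop) (n : ℕ) (x : ℤ) (y : ℕ) :
    RR (fun a b => B (a + 1) b) n x y ↔ RR B n (x + 1) y := by
  induction n generalizing x y with
  | zero => rfl
  | succ n ih =>
    simp only [RR, ih, sub_add_cancel, add_sub_cancel_right]
lemma Top_shift (B : ℤ → ℕ → Prop) (x : ℤ) (y : ℕ) :
    Top (fun a b => B (a + 1) b) x y ↔ Top B (x + 1) y := by
  simp only [Top, Rch, RR_shift]

def ups : ℤ → ℕ → List (Fin 3) → List (ℤ × ℕ)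
  | _, _, [] => []
  | x, y, a :: w => if a = 0 then (x, y) :: ups x (y - 1) w else
      if a = 1 then ups (x - 1) (y + 1) w else ups (x + 1) (y + 1) w

lemma RR.witness (n : ℕ) (x : ℤ) (y : ℕ) (h : RR B n x y) (h' : ∀ m < n, ¬ RR B m x y) :
    ∃ w : List (Fin 3), w.length = n ∧ (ups x y w).Nodup ∧ n + y ≤ 2 * (ups x y w).length ∧
      ∀ v ∈ ups x y w, B v.1 v.2 ∧ RR B n v.1 v.2 := by
  induction n generalizing x y with
  | zero =>
    have : y = 0 := h
    exact ⟨[], rfl, by simp [ups], by simp [this], by simp [ups]⟩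
  | succ n ih =>
    rcases h with h | ⟨y', rfl, hb, h⟩ | h | h
    · exact absurd h (h' n (Nat.lt_succ_self n))
    · obtain ⟨w, h1, h2, h3, h4⟩ := ih x y' h (fun m hm hr =>
        h' (m + 1) (by omega) (Or.inr (Or.inl ⟨y', rfl, hb, hr⟩)))
      refine ⟨0 :: w, by simp [h1], ?_, ?_, ?_⟩
      · simp only [ups, if_true, Nat.add_sub_cancel, List.nodup_cons]
        exact ⟨fun hm => h' n (Nat.lt_succ_self n) (h4 _ hm).2, h2⟩
      · simp only [ups, if_true, Nat.add_sub_cancel, List.length_cons]; omega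
      · simp only [ups, if_true, Nat.add_sub_cancel, List.mem_cons]
        rintro v (rfl | hv)
        · exact ⟨hb, Or.inr (Or.inl ⟨y', rfl, hb, h⟩)⟩
        · exact ⟨(h4 v hv).1, Or.inl (h4 v hv).2⟩
    · obtain ⟨w, h1, h2, h3, h4⟩ := ih (x - 1) (y + 1) h (fun m hm hr =>
        h' (m + 1) (by omega) (Or.inr (Or.inr (Or.inl hr))))
      have e : ups x y (1 :: w) = ups (x - 1) (y + 1) w := by simp [ups]
      exact ⟨1 :: w, by simp [h1], by rwa [e], by rw [e]; omega, by
        rw [e]; exact fun v hv => ⟨(h4 v hv).1, Or.inl (h4 v hv).2⟩⟩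
    · obtain ⟨w, h1, h2, h3, h4⟩ := ih (x + 1) (y + 1) h (fun m hm hr =>
        h' (m + 1) (by omega) (Or.inr (Or.inr (Or.inr hr))))
      have e : ups x y (2 :: w) = ups (x + 1) (y + 1) w := by simp [ups]
      exact ⟨2 :: w, by simp [h1], by rwa [e], by rw [e]; omega, by
        rw [e]; exact fun v hv => ⟨(h4 v hv).1, Or.inl (h4 v hv).2⟩⟩

lemma Rch.witness (h : Rch B x y) : ∃ (n : ℕ) (w : Fin n → Fin 3), (ups x y (List.ofFn w)).Nodup ∧
    n + y ≤ 2 * (ups x y (List.ofFn w)).length ∧ ∀ v ∈ ups x y (List.ofFn w), B v.1 v.2 := by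
  have h0 := h
  obtain ⟨w, h1, h2, h3, h4⟩ := RR.witness (Nat.find h0) x y (Nat.find_spec h0) (fun m hm => Nat.find_min h0 hm)
  have e : List.ofFn w.get = w := List.ofFn_get w
  exact ⟨w.length, w.get, by rwa [e], by rw [e, h1]; exact h3, by rw [e]; exact fun v hv => (h4 v hv).1⟩
end
end

section
namespace Par
variable (P : Par d)

lemma bad_prob {q : ℝ} (hq0 : 0 ≤ q) (hq1 : q ≤ 1) {μ : Measure (Config d)} (hμ : IsBernoulliProduct q μ) :
    μ P.Goodᶜ ≤ (6 * d * (P.M + 1) : ℕ) * ENNReal.ofReal ((1 - q) ^ (P.κ ^ (d - 1))) := by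
  have h : P.Goodᶜ ⊆ ⋃ t ∈ ((Finset.univ : Finset (Fin d × Bool)) ×ˢ (Finset.range (P.M + 1) ×ˢ (Finset.univ : Finset (Fin 3)))),
      {ω : Config d | ∀ z ∈ P.cand t.1 t.2.1 t.2.2, ω z = true} := by
    intro ω hω
    simp only [Good, Set.mem_compl_iff, Set.mem_setOf_eq, not_forall, not_exists, not_and] at hω
    obtain ⟨g, n, c, h1, h2, h3⟩ := hω
    simp only [Set.mem_iUnion]
    exact ⟨(g, n, c), by simp; omega, fun z hz => by simpa using h3 z hz⟩
  refine (measure_mono h).trans ((measure_biUnion_finset_le _ _).trans ?_)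
  have h2 : ∀ t ∈ ((Finset.univ : Finset (Fin d × Bool)) ×ˢ (Finset.range (P.M + 1) ×ˢ (Finset.univ : Finset (Fin 3)))),
      μ {ω : Config d | ∀ z ∈ P.cand t.1 t.2.1 t.2.2, ω z = true} ≤ ENNReal.ofReal ((1 - q) ^ (P.κ ^ (d - 1))) := by
    intro t _
    rw [hμ.2 _ (fun _ => true)]
    simp only [if_true, Finset.prod_const, cand_card]
    rw [ENNReal.ofReal_pow (by linarith)]
  refine (Finset.sum_le_sum h2).trans ?_
  rw [Finset.sum_const, nsmul_eq_mul]
  apply le_of_eq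
  congr 2
  simp only [Finset.card_product, Finset.card_univ, Fintype.card_prod, Fintype.card_fin, Fintype.card_bool, Finset.card_range]
  ring

/-- bad field -/
def bad (ω : Config d) (x : ℤ) (y : ℕ) : Prop := shift (-(P.pt (P.S * x) (P.S * y))) ω ∉ P.Good

def BadE (v : ℤ × ℕ) : Set (Config d) := {ω | P.bad ω v.1 v.2}
def TB (v : ℤ × ℕ) : Set (Site d) := {z | z - P.pt (P.S * v.1) (P.S * v.2) ∈ P.AllC}

lemma BadE_meas (v : ℤ × ℕ) : MeasurableSet (P.BadE v) :=
  (measurable_shift (-(P.pt (P.S * v.1) (P.S * v.2)))) P.measurableSet_Good.compl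

lemma BadE_dep (v : ℤ × ℕ) : DepOn (P.TB v) (P.BadE v) := by
  intro ω ω' h
  simp only [BadE, bad, Set.mem_setOf_eq]
  rw [P.Good_congr]
  intro z hz
  rw [shift_neg_apply, shift_neg_apply]
  exact h _ (by simpa [TB] using hz)

lemma measure_shift {q : ℝ} {μ : Measure (Config d)} (hμ : IsBernoulliProduct q μ) (v : Site d)
    {A : Set (Config d)} (hA : MeasurableSet A) : μ {ω | shift v ω ∈ A} = μ A := by
  have := lintegral_shift hμ v (A.indicator 1)
  rw [lintegral_indicator_one hA] at this
  rw [← this]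
  exact (lintegral_indicator_one (μ := μ) (measurable_shift v hA)).symm

lemma BadE_prob {q : ℝ} {μ : Measure (Config d)} (hμ : IsBernoulliProduct q μ) (v : ℤ × ℕ) :
    μ (P.BadE v) = μ P.Goodᶜ := measure_shift hμ _ P.measurableSet_Good.compl

lemma AllC_le {z : Site d} (h : z ∈ P.AllC) (l : Fin d) : |z l| ≤ P.M := by
  obtain ⟨g, n, c, h1, h2, hz⟩ := h
  have h10 := P.N10
  have hS : P.S = 20 * P.N := rfl
  have hMM : P.M = 2 * P.S := rfl
  rw [abs_le]
  by_cases hl : l = g.1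
  · rw [hl]; rcases P.cand_coord hz with h | h <;> omega
  · have := P.cand_bd hz hl
    split_ifs at this <;> omega

lemma mul5 {S a b m : ℤ} (hS : 0 < S) (h : |S * a - S * b| ≤ 4 * S) (hm : a - b = 5 * m) : a = b := by
  have e : S * a - S * b = S * (5 * m) := by rw [← hm]; ring
  rw [e, abs_mul, abs_of_pos hS, mul_comm] at h
  have : |5 * m| ≤ 4 := le_of_mul_le_mul_right h hS
  rw [abs_le] at this
  omega

lemma TB_disj {v v' : ℤ × ℕ} (hne : v ≠ v') (h1 : v.1 % 5 = v'.1 % 5) (h2 : v.2 % 5 = v'.2 % 5) :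
    Disjoint (P.TB v) (P.TB v') := by
  rw [Set.disjoint_left]
  intro z hz hz'
  apply hne
  have h10 := P.N10
  have hS : P.S = 20 * P.N := rfl
  have hMM : P.M = 2 * P.S := rfl
  have hS0 : (0 : ℤ) < P.S := by omega
  have a0 := P.AllC_le hz P.i0
  have b0 := P.AllC_le hz' P.i0
  have a1 := P.AllC_le hz P.i1
  have b1 := P.AllC_le hz' P.i1
  simp only [Pi.sub_apply, pt_i0, pt_i1, abs_le] at a0 b0 a1 b1
  have e1 : v.1 = v'.1 := mul5 (m := (v.1 - v'.1) / 5) hS0 (by rw [abs_le]; omega) (by omega)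
  have e2 : (v.2 : ℤ) = v'.2 := mul5 (m := ((v.2 : ℤ) - v'.2) / 5) hS0 (by rw [abs_le]; omega) (by omega)
  exact Prod.ext e1 (by exact_mod_cast e2)

lemma all_bad {q : ℝ} {μ : Measure (Config d)} (hμ : IsBernoulliProduct q μ)
    (hε : μ P.Goodᶜ ≤ (12⁻¹ : ℝ≥0∞) ^ 50) (V : Finset (ℤ × ℕ)) :
    μ (⋂ v ∈ V, P.BadE v) ≤ (12⁻¹ : ℝ≥0∞) ^ (2 * V.card) := by
  obtain ⟨c, -, hc⟩ := Finset.exists_le_card_fiber_of_nsmul_le_card_of_maps_to (M := ℚ) (s := V)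
    (t := Finset.Ico (0 : ℤ) 5 ×ˢ Finset.range 5) (f := fun v => (v.1 % 5, v.2 % 5)) (b := (V.card : ℚ) / 25)
    (by
      intro v _
      simp only [Finset.mem_product, Finset.mem_Ico, Finset.mem_range]
      omega) ⟨(0, 0), by simp⟩ (by simp; linarith)
  set V' := V.filter (fun v => (v.1 % 5, v.2 % 5) = c) with hV'
  have hcard : V.card ≤ 25 * V'.card := by
    have : (V.card : ℚ) ≤ 25 * V'.card := by linarith
    exact_mod_cast this
  have h1 : μ (⋂ v ∈ V', P.BadE v) ≤ ((12⁻¹ : ℝ≥0∞) ^ 50) ^ V'.card := by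
    refine indep_fin hμ V' P.TB P.BadE P.BadE_meas P.BadE_dep ?_ _ (fun v _ => by rw [P.BadE_prob hμ]; exact hε)
    intro i hi j hj hne
    have e := ((Finset.mem_filter.1 hi).2).trans ((Finset.mem_filter.1 hj).2).symm
    simp only [Prod.mk.injEq] at e
    exact P.TB_disj hne e.1 e.2
  refine (measure_mono ?_).trans (h1.trans ?_)
  · exact Set.biInter_subset_biInter_left (fun v hv => (Finset.mem_filter.1 hv).1)
  · rw [← pow_mul]
    exact pow_le_pow_right_of_le_one' (by rw [ENNReal.inv_le_one]; norm_num) (by omega)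

def RE (x : ℤ) (y : ℕ) : Set (Config d) := {ω | Rch (P.bad ω) x y}
def AE (x : ℤ) (y : ℕ) : Set (Config d) := {ω | Top (P.bad ω) x y}

lemma RR_meas (n : ℕ) (x : ℤ) (y : ℕ) : MeasurableSet {ω : Config d | RR (P.bad ω) n x y} := by
  induction n generalizing x y with
  | zero => exact MeasurableSet.const (y = 0)
  | succ n ih =>
    cases y with
    | zero =>
      have : {ω : Config d | RR (P.bad ω) (n + 1) x 0} = {ω | RR (P.bad ω) n x 0} ∪
        ({ω | RR (P.bad ω) n (x - 1) (0 + 1)} ∪ {ω | RR (P.bad ω) n (x + 1) (0 + 1)}) := by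
        ext ω; simp [RR]
      rw [this]
      exact (ih _ _).union ((ih _ _).union (ih _ _))
    | succ y =>
      have : {ω : Config d | RR (P.bad ω) (n + 1) x (y + 1)} = {ω | RR (P.bad ω) n x (y + 1)} ∪
        ((P.BadE (x, y + 1) ∩ {ω | RR (P.bad ω) n x y}) ∪
        ({ω | RR (P.bad ω) n (x - 1) (y + 1 + 1)} ∪ {ω | RR (P.bad ω) n (x + 1) (y + 1 + 1)})) := by
        ext ω; simp [RR, BadE]
      rw [this]
      exact (ih _ _).union (((P.BadE_meas _).inter (ih _ _)).union ((ih _ _).union (ih _ _)))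

lemma RE_meas (x : ℤ) (y : ℕ) : MeasurableSet (P.RE x y) := by
  have : P.RE x y = ⋃ n, {ω | RR (P.bad ω) n x y} := by ext; simp [RE, Rch]
  rw [this]; exact MeasurableSet.iUnion fun n => P.RR_meas n x y

lemma AE_eq (x : ℤ) (y : ℕ) : P.AE x y = P.RE x y ∩ ⋂ (y' : ℕ) (_ : y < y'), (P.RE x y')ᶜ := by
  ext; simp [AE, RE, Top]

lemma AE_meas (x : ℤ) (y : ℕ) : MeasurableSet (P.AE x y) := by
  rw [AE_eq]
  exact (P.RE_meas x y).inter (MeasurableSet.iInter fun y' => MeasurableSet.iInter fun _ => (P.RE_meas x y').compl)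

lemma RE_prob {q : ℝ} {μ : Measure (Config d)} (hμ : IsBernoulliProduct q μ)
    (hε : μ P.Goodᶜ ≤ (12⁻¹ : ℝ≥0∞) ^ 50) (x : ℤ) (y : ℕ) : μ (P.RE x y) ≤ 4 / 3 * (12⁻¹ : ℝ≥0∞) ^ y := by
  let W : (n : ℕ) → (Fin n → Fin 3) → Set (Config d) := fun n w =>
    if (ups x y (List.ofFn w)).Nodup ∧ n + y ≤ 2 * (ups x y (List.ofFn w)).length then
      ⋂ v ∈ (ups x y (List.ofFn w)).toFinset, P.BadE v else ∅
  have h12 : (12⁻¹ : ℝ≥0∞) ≤ 1 := by rw [ENNReal.inv_le_one]; norm_num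
  have hW : ∀ n w, μ (W n w) ≤ (12⁻¹ : ℝ≥0∞) ^ (n + y) := by
    intro n w
    simp only [W]
    split_ifs with h
    · refine (P.all_bad hμ hε _).trans ?_
      rw [List.toFinset_card_of_nodup h.1]
      exact pow_le_pow_right_of_le_one' h12 h.2
    · simp
  have hsub : P.RE x y ⊆ ⋃ n, ⋃ w, W n w := by
    intro ω hω
    obtain ⟨n, w, h1, h2, h3⟩ := Rch.witness hω
    simp only [Set.mem_iUnion]
    refine ⟨n, w, ?_⟩
    simp only [W, if_pos (And.intro h1 h2), Set.mem_iInter, List.mem_toFinset]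
    exact fun v hv => h3 v hv
  refine (measure_mono hsub).trans ((measure_iUnion_le _).trans ?_)
  have h1 : ∀ n, μ (⋃ w, W n w) ≤ (12⁻¹ : ℝ≥0∞) ^ y * (4⁻¹ : ℝ≥0∞) ^ n := by
    intro n
    refine (measure_iUnion_le _).trans ?_
    rw [tsum_fintype]
    refine (Finset.sum_le_sum fun w _ => hW n w).trans ?_
    rw [Finset.sum_const, nsmul_eq_mul]
    simp only [Finset.card_univ, Fintype.card_pi, Fintype.card_fin, Finset.prod_const]
    rw [pow_add, mul_comm, mul_assoc, mul_comm, mul_assoc]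
    gcongr
    push_cast
    rw [mul_comm, ← mul_pow]
    apply le_of_eq
    congr 1
    rw [← ENNReal.toReal_eq_toReal_iff' (by finiteness) (by finiteness)]
    simp; norm_num
  refine (ENNReal.tsum_le_tsum h1).trans ?_
  rw [ENNReal.tsum_mul_left, ENNReal.tsum_geometric, mul_comm]
  gcongr
  apply le_of_eq
  have : (1 - 4⁻¹ : ℝ≥0∞) = 3 / 4 := by
    rw [← ENNReal.toReal_eq_toReal_iff' (by finiteness) (by finiteness), ENNReal.toReal_sub_of_le (by simp) (by simp)]
    simp; norm_num
  rw [this, ENNReal.inv_div (by simp) (by simp)]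

lemma geom_toReal {r : ℝ≥0∞} (hr : r < 1) : ∑' n : ℕ, r ^ n = ENNReal.ofReal ((1 - r.toReal)⁻¹) := by
  rw [ENNReal.tsum_geometric]
  rw [ENNReal.ofReal_inv_of_pos (by
    have := (ENNReal.toReal_lt_toReal hr.ne_top (by simp)).2 hr
    simp at this; linarith)]
  congr 1
  rw [ENNReal.ofReal_sub _ ENNReal.toReal_nonneg, ENNReal.ofReal_toReal hr.ne_top]; simp

lemma AE_sum {q : ℝ} {μ : Measure (Config d)} (hμ : IsBernoulliProduct q μ)
    (hε : μ P.Goodᶜ ≤ (12⁻¹ : ℝ≥0∞) ^ 50) (x : ℤ) : ∑' y : ℕ, 2 ^ (y + 1) * μ (P.AE x y) ≤ 4 := by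
  have h : ∀ y : ℕ, 2 ^ (y + 1) * μ (P.AE x y) ≤ 8 / 3 * (6⁻¹ : ℝ≥0∞) ^ y := by
    intro y
    have : μ (P.AE x y) ≤ 4 / 3 * (12⁻¹ : ℝ≥0∞) ^ y :=
      (measure_mono (fun ω h => h.1)).trans (P.RE_prob hμ hε x y)
    refine (mul_le_mul_right this _).trans ?_
    apply le_of_eq
    rw [← ENNReal.toReal_eq_toReal_iff' (by finiteness) (by finiteness)]
    simp
    rw [show (12 : ℝ) = 2 * 6 by norm_num, mul_pow, pow_succ]
    field_simp; norm_num
  refine (ENNReal.tsum_le_tsum h).trans ?_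
  rw [ENNReal.tsum_mul_left, geom_toReal (by rw [ENNReal.inv_lt_one]; norm_num)]
  rw [← ENNReal.toReal_le_toReal (by finiteness) (by finiteness)]
  simp
  norm_num

lemma AE_half {q : ℝ} {μ : Measure (Config d)} (hμ : IsBernoulliProduct q μ)
    (hε : μ P.Goodᶜ ≤ (12⁻¹ : ℝ≥0∞) ^ 50) (x : ℤ) : 2⁻¹ ≤ μ (P.AE x 0) := by
  haveI := hμ.1
  have h1 : (P.AE x 0)ᶜ ⊆ ⋃ y : ℕ, P.RE x (y + 1) := by
    intro ω hω
    by_contra hh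
    simp only [Set.mem_iUnion, not_exists] at hh
    apply hω
    refine ⟨Rch.zero, fun y' hy' hr => ?_⟩
    obtain ⟨z, rfl⟩ : ∃ z, y' = z + 1 := ⟨y' - 1, by omega⟩
    exact hh z hr
  have h2 : μ (P.AE x 0)ᶜ ≤ 2⁻¹ := by
    refine (measure_mono h1).trans ((measure_iUnion_le _).trans ((ENNReal.tsum_le_tsum fun y => P.RE_prob hμ hε x (y + 1)).trans ?_))
    simp only [pow_succ]
    rw [ENNReal.tsum_mul_left, ENNReal.tsum_mul_right, geom_toReal (by rw [ENNReal.inv_lt_one]; norm_num)]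
    rw [← ENNReal.toReal_le_toReal (by finiteness) (by finiteness)]
    simp
    norm_num
  have h3 := prob_add_prob_compl (μ := μ) (P.AE_meas x 0)
  have h4 : (1 : ℝ≥0∞) = 2⁻¹ + 2⁻¹ := (ENNReal.inv_two_add_inv_two).symm
  by_contra hh
  push Not at hh
  have : μ (P.AE x 0) + μ (P.AE x 0)ᶜ < 2⁻¹ + 2⁻¹ := ENNReal.add_lt_add_of_lt_of_le (by finiteness) hh h2
  rw [h3, ← h4] at this
  exact lt_irrefl _ this
end Par
end

section
namespace Par
variable (P : Par d) (R : P.Res)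

def CandS : Set (Site d) := {z | ∃ w0 w1 : ℤ, z - P.pt (P.S * w0) (P.S * w1) ∈ P.AllC}

lemma CandS_Slot {z : Site d} (h : z ∈ P.CandS) (a b : ℤ) : z - P.pt (P.S * a) (P.S * b) ∉ P.Slot R := by
  obtain ⟨w0, w1, hz⟩ := h
  have e : z - P.pt (P.S * a) (P.S * b) = z - P.pt (P.S * w0) (P.S * w1) - P.pt (P.S * (a - w0)) (P.S * (b - w1)) := by
    rw [sub_sub, P.pt_add]; congr 2 <;> ring
  rw [e]
  simp only [Slot, Finset.mem_union, Finset.mem_image, not_or, not_exists, not_and]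
  refine ⟨P.AllC_St hz _ _, fun k hk he => P.AllC_res hz (a - w0) (b - w1) (he ▸ R.mem k hk)⟩

lemma bad_congr {ω ω' : Config d} (h : ∀ z ∈ P.CandS, ω z = ω' z) : P.bad ω = P.bad ω' := by
  funext x y
  apply propext
  exact P.BadE_dep (x, y) ω ω' fun z hz => h z ⟨x, y, hz⟩

lemma AE_dep (x : ℤ) (y : ℕ) : DepOn P.CandS (P.AE x y) := by
  intro ω ω' h
  simp only [AE, Set.mem_setOf_eq, P.bad_congr h]

/-- base point of the slot at height y -/
def uu (y : ℕ) : Site d := P.pt (P.S * 0) (P.S * (y + 1))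
def DrU (y : ℕ) : Set (Config d) := {ω | shift (-(P.uu y)) ω ∈ P.Dr R}
lemma DrU_meas (y : ℕ) : MeasurableSet (P.DrU R y) := measurable_shift _ (P.measurableSet_Dr R)

lemma Dr_congr {ω ω' : Config d} (h : ∀ z ∈ P.Slot R, ω z = ω' z) : ω ∈ P.Dr R ↔ ω' ∈ P.Dr R := by
  have key : ∀ {ω ω' : Config d}, (∀ z ∈ P.Slot R, ω z = ω' z) → ω ∈ P.Dr R → ω' ∈ P.Dr R := by
    intro ω ω' h ⟨h1, h2⟩
    refine ⟨fun x hx => ?_, fun k hk => ?_⟩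
    · rw [← h x (Finset.mem_union_left _ hx)]; exact h1 x hx
    · rw [← h _ (Finset.mem_union_right _ (Finset.mem_image_of_mem _ hk))]; exact h2 k hk
  exact ⟨key h, key fun z hz => (h z hz).symm⟩

lemma DrU_dep (y : ℕ) : DepOn {z | z - P.uu y ∈ P.Slot R} (P.DrU R y) := by
  intro ω ω' h
  apply P.Dr_congr R
  intro z hz
  rw [shift_neg_apply, shift_neg_apply]
  exact h _ (by simpa using hz)

lemma AE_DrU {q : ℝ} {μ : Measure (Config d)} (hμ : IsBernoulliProduct q μ) (y : ℕ) :
    μ (P.AE 0 y ∩ P.DrU R y) = μ (P.AE 0 y) * μ (P.Dr R) := by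
  rw [indep_dep hμ _ (P.AE_meas 0 y) (P.DrU_meas R y) (P.AE_dep 0 y) (P.DrU_dep R y)]
  · congr 1
    exact measure_shift hμ _ (P.measurableSet_Dr R)
  · rw [Set.disjoint_left]
    intro z hz hz'
    exact P.CandS_Slot R hz _ _ hz'

/-- the hop from height one height to another -/
def hopS (y y' : ℕ) : List (Site d × Site d) :=
  (P.hopL R ((y' : ℤ) - y)).map fun p => (p.1 + P.uu y, p.2 + P.uu y)

lemma shift_hopS (y y' : ℕ) (ω : Config d) :
    shift (-(P.uu y)) (app ω (P.hopS R y y')) = app (shift (-(P.uu y)) ω) (P.hopL R ((y' : ℤ) - y)) := by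
  rw [← app_shift, hopS, List.map_map]
  congr 1
  have : ((fun p : Site d × Site d => (p.1 - P.uu y, p.2 - P.uu y)) ∘ fun p => (p.1 + P.uu y, p.2 + P.uu y)) = id := by
    funext p; simp
  rw [this, List.map_id]

lemma bad_hopS {y y' : ℕ} (hs : IsS ((y' : ℤ) - y)) (ω : Config d) :
    P.bad (app ω (P.hopS R y y')) = P.bad ω := by
  apply P.bad_congr
  intro z hz
  have h := congrFun (P.shift_hopS R y y' ω) (z - P.uu y)
  rw [shift_neg_apply, P.hop_off R hs, shift_neg_apply] at h
  · simpa using h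
  · exact P.CandS_Slot R hz _ _
  · rw [oo_pt, sub_sub, uu, P.pt_add, ← mul_add, ← mul_add]
    exact P.CandS_Slot R hz _ _

def uu' (y : ℕ) : Site d := P.pt (P.S * 1) (P.S * (y + 1))
lemma uu'_eq (y y' : ℕ) : P.uu' y' = P.uu y + P.oo ((y' : ℤ) - y) := by
  rw [uu', uu, oo_pt, P.pt_add]; congr 1 <;> ring

lemma shift_uu' (y y' : ℕ) (ω : Config d) :
    shift (-(P.oo ((y' : ℤ) - y))) (app (shift (-(P.uu y)) ω) (P.hopL R ((y' : ℤ) - y))) =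
      shift (-(P.uu' y')) (app ω (P.hopS R y y')) := by
  rw [← P.shift_hopS, shift_shift, P.uu'_eq y y']; congr 1; abel

lemma AE_one (y : ℕ) (ω : Config d) : ω ∈ P.AE 1 y ↔ shift (-(P.pt (P.S * 1) (P.S * 0))) ω ∈ P.AE 0 y := by
  have e : P.bad (shift (-(P.pt (P.S * 1) (P.S * 0))) ω) = fun a b => P.bad ω (a + 1) b := by
    funext a b
    simp only [bad]
    rw [shift_shift, ← neg_add, P.pt_add, ← mul_add, ← mul_add]
    simp [add_comm]
  simp only [AE, Set.mem_setOf_eq]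
  rw [e, Top_shift]; simp

lemma uu_shift (y : ℕ) (ω : Config d) : shift (-(P.uu y)) (shift (-(P.pt (P.S * 1) (P.S * 0))) ω) = shift (-(P.uu' y)) ω := by
  rw [shift_shift, uu, uu', ← neg_add, P.pt_add]; congr 3 <;> ring

def JE (y y' : ℕ) : Set (Config d) := P.AE 0 y ∩ P.AE 1 y'
lemma JE_meas (y y' : ℕ) : MeasurableSet (P.JE y y') := (P.AE_meas _ _).inter (P.AE_meas _ _)
lemma JE_S {y y' : ℕ} {ω : Config d} (h : ω ∈ P.JE y y') : IsS ((y' : ℤ) - y) := by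
  have := Top.lip (x := 0) h.1 h.2
  unfold IsS; omega

lemma dot_oo (hP : (P.i0 : ℕ) = 0) (s : ℤ) : dotZ (e1R d) (P.oo s) = P.S := by
  unfold dotZ
  rw [Finset.sum_eq_single P.i0]
  · simp [e1R, hP, oo]
  · intro b _ hb
    have : (b : ℕ) ≠ 0 := fun h => hb (Fin.ext (h.trans hP.symm))
    simp [e1R, this]
  · simp
end Par
end

section
namespace Par
variable (P : Par d) (R : P.Res)

def DrU' (y : ℕ) : Set (Config d) := {ω | shift (-(P.uu' y)) ω ∈ P.Dr R}
lemma DrU'_meas (y : ℕ) : MeasurableSet (P.DrU' R y) := measurable_shift _ (P.measurableSet_Dr R)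

/-- increment along the hop -/
def Dl (f : Config d → ℝ) (y y' : ℕ) (ω : Config d) : ℝ :=
  lab f (app (shift (-(P.uu y)) ω) (P.hopL R ((y' : ℤ) - y))) (P.oo ((y' : ℤ) - y)) - lab f (shift (-(P.uu y)) ω) origin

lemma Dl_meas {f : Config d → ℝ} (hf : IsLocal f) (y y' : ℕ) : Measurable (P.Dl R f y y') :=
  ((measurable_lab hf _).comp ((measurable_app _).comp (measurable_shift _))).sub
    ((measurable_lab hf _).comp (measurable_shift _))

lemma Dl_ge (hP : (P.i0 : ℕ) = 0) (f : Config d → ℝ) (B : ℝ) (hB : ∀ η, |f η| ≤ B) (y y' : ℕ) (ω : Config d) :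
    ENNReal.ofReal (f (shift (-(P.uu y)) ω) + B) + 1 ≤
      ENNReal.ofReal (f (shift (-(P.uu' y')) (app ω (P.hopS R y y'))) + B) + ENNReal.ofReal |P.Dl R f y y' ω| := by
  have h0 : ∀ η, 0 ≤ f η + B := fun η => by have := abs_le.1 (hB η); linarith
  rw [← ENNReal.ofReal_one, ← ENNReal.ofReal_add (h0 _) zero_le_one, ← ENNReal.ofReal_add (h0 _) (abs_nonneg _)]
  apply ENNReal.ofReal_le_ofReal
  have e : P.Dl R f y y' ω = f (shift (-(P.uu' y')) (app ω (P.hopS R y y'))) - P.S - f (shift (-(P.uu y)) ω) := by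
    unfold Dl lab
    rw [P.shift_uu' R, P.dot_oo hP]
    have : shift (-(origin : Site d)) (shift (-(P.uu y)) ω) = shift (-(P.uu y)) ω := by
      rw [shift_shift, origin_zero]; simp
    rw [this]
    simp [dotZ, origin]
  have hS : (1 : ℝ) ≤ P.S := by
    have := P.N10
    have hS : P.S = 20 * P.N := rfl
    exact_mod_cast (by omega : 1 ≤ P.S)
  have := neg_abs_le (P.Dl R f y y' ω)
  linarith

lemma sum_right {μ : Measure (Config d)} (y : ℕ) (h : Config d → ℝ≥0∞) :
    ∑' y', ∫⁻ ω in P.JE y y' ∩ P.DrU R y, h ω ∂μ = ∫⁻ ω in P.AE 0 y ∩ P.DrU R y, h ω ∂μ := by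
  rw [← lintegral_iUnion (fun y' => (P.JE_meas y y').inter (P.DrU_meas R y))]
  · congr 2
    ext ω
    simp only [JE, Set.mem_iUnion, Set.mem_inter_iff]
    constructor
    · rintro ⟨y', ⟨h1, h2⟩, h3⟩; exact ⟨h1, h3⟩
    · rintro ⟨h1, h3⟩
      obtain ⟨y', h2⟩ := Top.ex_right (x := 0) h1
      exact ⟨y', ⟨h1, h2⟩, h3⟩
  · intro i j hij
    rw [Function.onFun, Set.disjoint_left]
    intro ω h1 h2
    exact hij (Top.unique h1.1.2 h2.1.2)

lemma sum_left {μ : Measure (Config d)} (y' : ℕ) (h : Config d → ℝ≥0∞) :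
    ∑' y, ∫⁻ ω in P.JE y y' ∩ P.DrU' R y', h ω ∂μ ≤ ∫⁻ ω in P.AE 1 y' ∩ P.DrU' R y', h ω ∂μ := by
  rw [← lintegral_iUnion (fun y => (P.JE_meas y y').inter (P.DrU'_meas R y'))]
  · apply lintegral_mono_set
    intro ω
    simp only [JE, Set.mem_iUnion, Set.mem_inter_iff]
    rintro ⟨y', ⟨h1, h2⟩, h3⟩; exact ⟨h2, h3⟩
  · intro i j hij
    rw [Function.onFun, Set.disjoint_left]
    intro ω h1 h2
    exact hij (Top.unique h1.1.1 h2.1.1)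

lemma trans_one {q : ℝ} {μ : Measure (Config d)} (hμ : IsBernoulliProduct q μ) (y' : ℕ) (g : Config d → ℝ≥0∞) :
    ∫⁻ ω in P.AE 1 y' ∩ P.DrU' R y', g (shift (-(P.uu' y')) ω) ∂μ =
      ∫⁻ ω in P.AE 0 y' ∩ P.DrU R y', g (shift (-(P.uu y')) ω) ∂μ := by
  rw [← lintegral_indicator ((P.AE_meas _ _).inter (P.DrU'_meas R _)),
    ← lintegral_indicator ((P.AE_meas _ _).inter (P.DrU_meas R _)),
    ← lintegral_shift hμ (-(P.pt (P.S * 1) (P.S * 0))) ((P.AE 0 y' ∩ P.DrU R y').indicator _)]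
  congr 1
  funext ω
  simp only [Set.indicator, Set.mem_inter_iff, DrU, DrU', Set.mem_setOf_eq, P.AE_one, P.uu_shift]

lemma hop_le {q : ℝ} {μ : Measure (Config d)} (hμ : IsBernoulliProduct q μ) (y y' : ℕ) (g : Config d → ℝ≥0∞) :
    ∫⁻ ω in P.JE y y' ∩ P.DrU R y, g (shift (-(P.uu' y')) (app ω (P.hopS R y y'))) ∂μ ≤
      ∫⁻ ω in P.JE y y' ∩ P.DrU' R y', g (shift (-(P.uu' y')) ω) ∂μ := by
  rw [← lintegral_indicator ((P.JE_meas _ _).inter (P.DrU_meas R _)),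
    ← lintegral_indicator ((P.JE_meas _ _).inter (P.DrU'_meas R _)),
    ← lintegral_app hμ (P.hopS R y y') ((P.JE y y' ∩ P.DrU' R y').indicator _)]
  apply lintegral_mono
  intro ω
  simp only
  by_cases h : ω ∈ P.JE y y' ∩ P.DrU R y
  · have hs := P.JE_S h.1
    have h' : app ω (P.hopS R y y') ∈ P.JE y y' ∩ P.DrU' R y' := by
      refine ⟨⟨?_, ?_⟩, ?_⟩
      · simp only [AE, Set.mem_setOf_eq, P.bad_hopS R hs]; exact h.1.1
      · simp only [AE, Set.mem_setOf_eq, P.bad_hopS R hs]; exact h.1.2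
      · simp only [DrU', Set.mem_setOf_eq]
        rw [← P.shift_uu' R]
        exact P.hop_Dr R hs h.2
    rw [Set.indicator_of_mem h, Set.indicator_of_mem h']
  · rw [Set.indicator_of_notMem h]; exact zero_le

lemma main1 (hP : (P.i0 : ℕ) = 0) {q : ℝ} {μ : Measure (Config d)} (hμ : IsBernoulliProduct q μ)
    (hε : μ P.Goodᶜ ≤ (12⁻¹ : ℝ≥0∞) ^ 50) {f : Config d → ℝ} (hf : IsLocal f) :
    2⁻¹ * μ (P.Dr R) ≤ ∑' y, ∑' y', ∫⁻ ω in P.JE y y' ∩ P.DrU R y, ENNReal.ofReal |P.Dl R f y y' ω| ∂μ := by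
  haveI := hμ.1
  obtain ⟨B, hB0, hB⟩ := hf.bounded
  set g : Config d → ℝ≥0∞ := fun η => ENNReal.ofReal (f η + B) with hg
  have mg : Measurable g := (hf.measurable.add_const _).ennreal_ofReal
  set G1 := ∑' y, ∫⁻ ω in P.AE 0 y ∩ P.DrU R y, g (shift (-(P.uu y)) ω) ∂μ with hG1
  have hfin : G1 ≠ ⊤ := by
    have : G1 ≤ ENNReal.ofReal (2 * B) * 4 := by
      refine le_trans ?_ (mul_le_mul_right (P.AE_sum hμ hε 0) _)
      rw [← ENNReal.tsum_mul_left]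
      refine ENNReal.tsum_le_tsum fun y => ?_
      calc ∫⁻ ω in P.AE 0 y ∩ P.DrU R y, g (shift (-(P.uu y)) ω) ∂μ
          ≤ ∫⁻ ω in P.AE 0 y ∩ P.DrU R y, ENNReal.ofReal (2 * B) ∂μ := by
            apply lintegral_mono
            intro ω
            apply ENNReal.ofReal_le_ofReal
            have := abs_le.1 (hB (shift (-(P.uu y)) ω)); linarith
        _ = ENNReal.ofReal (2 * B) * μ (P.AE 0 y ∩ P.DrU R y) := setLIntegral_const _ _
        _ ≤ _ := by
            gcongr
            refine (measure_mono Set.inter_subset_left).trans ?_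
            exact le_mul_of_one_le_left (zero_le) (one_le_pow₀ (by norm_num))
    exact ne_top_of_le_ne_top (by finiteness) this
  have hL : G1 + 2⁻¹ * μ (P.Dr R) ≤ ∑' y, ∑' y', ∫⁻ ω in P.JE y y' ∩ P.DrU R y, (g (shift (-(P.uu y)) ω) + 1) ∂μ := by
    simp_rw [P.sum_right R]
    have : ∀ y, ∫⁻ ω in P.AE 0 y ∩ P.DrU R y, (g (shift (-(P.uu y)) ω) + 1) ∂μ =
      ∫⁻ ω in P.AE 0 y ∩ P.DrU R y, g (shift (-(P.uu y)) ω) ∂μ + μ (P.AE 0 y ∩ P.DrU R y) := by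
      intro y
      rw [lintegral_add_right _ measurable_const, setLIntegral_const, one_mul]
    simp_rw [this]
    rw [ENNReal.tsum_add]
    gcongr
    refine le_trans ?_ (ENNReal.le_tsum 0)
    rw [P.AE_DrU R hμ]
    gcongr
    exact P.AE_half hμ hε 0
  have hRR : ∑' y, ∑' y', ∫⁻ ω in P.JE y y' ∩ P.DrU R y, (g (shift (-(P.uu y)) ω) + 1) ∂μ ≤
      G1 + ∑' y, ∑' y', ∫⁻ ω in P.JE y y' ∩ P.DrU R y, ENNReal.ofReal |P.Dl R f y y' ω| ∂μ := by
    have h1 : ∀ y y', ∫⁻ ω in P.JE y y' ∩ P.DrU R y, (g (shift (-(P.uu y)) ω) + 1) ∂μ ≤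
        ∫⁻ ω in P.JE y y' ∩ P.DrU' R y', g (shift (-(P.uu' y')) ω) ∂μ +
        ∫⁻ ω in P.JE y y' ∩ P.DrU R y, ENNReal.ofReal |P.Dl R f y y' ω| ∂μ := by
      intro y y'
      refine (lintegral_mono fun ω => P.Dl_ge R hP f B hB y y' ω).trans ?_
      have m : Measurable (fun ω => ENNReal.ofReal |P.Dl R f y y' ω|) := ((P.Dl_meas R hf y y').abs).ennreal_ofReal
      rw [lintegral_add_right _ m]
      exact add_le_add_left (P.hop_le R hμ y y' g) _
    refine (ENNReal.tsum_le_tsum fun y => ENNReal.tsum_le_tsum fun y' => h1 y y').trans ?_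
    simp_rw [ENNReal.tsum_add]
    refine add_le_add_left ?_ _
    rw [ENNReal.tsum_comm]
    refine ENNReal.tsum_le_tsum fun y' => (P.sum_left R y' _).trans ?_
    rw [P.trans_one R hμ]
  exact (ENNReal.add_le_add_iff_left hfin).1 (hL.trans hRR)

lemma amgm {a : ℝ} (ha : 0 < a) (n : ℕ) (t : ℝ) : ENNReal.ofReal |t| ≤
    ENNReal.ofReal a * 2 ^ n + ENNReal.ofReal (1 / (4 * a)) * (2⁻¹ ^ n * ENNReal.ofReal (t ^ 2)) := by
  have e2 : (2 : ℝ≥0∞) = ENNReal.ofReal 2 := by simp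
  rw [e2, ← ENNReal.ofReal_inv_of_pos (by norm_num), ← ENNReal.ofReal_pow (by norm_num), ← ENNReal.ofReal_pow (by norm_num),
    ← ENNReal.ofReal_mul (by positivity), ← ENNReal.ofReal_mul (by positivity), ← ENNReal.ofReal_mul (by positivity),
    ← ENNReal.ofReal_add (by positivity) (by positivity)]
  apply ENNReal.ofReal_le_ofReal
  set b : ℝ := a * 2 ^ n with hb
  have hb0 : 0 < b := by positivity
  have : 1 / (4 * a) * (2⁻¹ ^ n * t ^ 2) = t ^ 2 / (4 * b) := by
    rw [hb, inv_pow]; field_simp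
  rw [this, ← sq_abs t]
  have h := sq_nonneg (|t| - 2 * b)
  have : |t| = (4 * b * |t|) / (4 * b) := by field_simp
  have h3 : b + |t| ^ 2 / (4 * b) - |t| = (|t| - 2 * b) ^ 2 / (4 * b) := by field_simp; ring
  have : 0 ≤ (|t| - 2 * b) ^ 2 / (4 * b) := by positivity
  linarith

lemma hopE {q : ℝ} {μ : Measure (Config d)} (hμ : IsBernoulliProduct q μ) {f : Config d → ℝ} (hf : IsLocal f)
    (y y' : ℕ) : ∫⁻ ω in P.JE y y' ∩ P.DrU R y, ENNReal.ofReal (P.Dl R f y y' ω ^ 2) ∂μ ≤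
      if IsS ((y' : ℤ) - y) then P.KK * energy 2 (e1R d) (condOcc μ) f else 0 := by
  split_ifs with hs
  · refine le_trans ?_ (P.hop_bound R hμ hf hs)
    rw [← lintegral_shift hμ (-(P.uu y)), ← lintegral_indicator ((P.JE_meas _ _).inter (P.DrU_meas R _))]
    apply lintegral_mono
    intro ω
    simp only
    by_cases h : ω ∈ P.JE y y' ∩ P.DrU R y
    · rw [Set.indicator_of_mem h, if_pos]
      · rfl
      · refine ⟨?_, ?_, h.2⟩
        · have := Top.good h.1.1
          simp only [bad, not_not] at this
          simpa [uu] using this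
        · have := Top.good h.1.2
          simp only [bad, not_not] at this
          rw [shift_shift, ← neg_add, add_comm, ← P.uu'_eq]
          simpa [uu'] using this
    · rw [Set.indicator_of_notMem h]; exact zero_le
  · have : P.JE y y' ∩ P.DrU R y = ∅ := by
      ext ω
      simp only [Set.mem_empty_iff_false, iff_false]
      exact fun h => hs (P.JE_S h.1)
    rw [this]; simp

lemma main2 (hP : (P.i0 : ℕ) = 0) {q : ℝ} {μ : Measure (Config d)} (hμ : IsBernoulliProduct q μ)
    (hε : μ P.Goodᶜ ≤ (12⁻¹ : ℝ≥0∞) ^ 50) {f : Config d → ℝ} (hf : IsLocal f) {a : ℝ} (ha : 0 < a) :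
    2⁻¹ * μ (P.Dr R) ≤ ENNReal.ofReal a * 4 + ENNReal.ofReal (1 / (4 * a)) * (3 * (P.KK * energy 2 (e1R d) (condOcc μ) f)) := by
  haveI := hμ.1
  set E := P.KK * energy 2 (e1R d) (condOcc μ) f with hE
  refine (P.main1 R hP hμ hε hf).trans ?_
  have h1 : ∀ y y', ∫⁻ ω in P.JE y y' ∩ P.DrU R y, ENNReal.ofReal |P.Dl R f y y' ω| ∂μ ≤
      ENNReal.ofReal a * (2 ^ (y + 1) * ∫⁻ ω in P.JE y y' ∩ P.DrU R y, 1 ∂μ) +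
      ENNReal.ofReal (1 / (4 * a)) * (2⁻¹ ^ (y + 1) * if IsS ((y' : ℤ) - y) then E else 0) := by
    intro y y'
    refine (lintegral_mono fun ω => amgm ha (y + 1) _).trans ?_
    have m : Measurable (fun ω => ENNReal.ofReal (P.Dl R f y y' ω ^ 2)) := ((P.Dl_meas R hf y y').pow_const 2).ennreal_ofReal
    rw [lintegral_add_left measurable_const, lintegral_const_mul _ (m.const_mul _), lintegral_const_mul _ m]
    gcongr
    · rw [setLIntegral_const, setLIntegral_const, one_mul, mul_assoc]
    · exact P.hopE R hμ hf y y'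
  refine (ENNReal.tsum_le_tsum fun y => ENNReal.tsum_le_tsum fun y' => h1 y y').trans ?_
  simp_rw [ENNReal.tsum_add, ENNReal.tsum_mul_left, P.sum_right R]
  gcongr
  · refine le_trans ?_ (P.AE_sum hμ hε 0)
    refine ENNReal.tsum_le_tsum fun y => ?_
    rw [setLIntegral_const, one_mul]
    gcongr
    exact Set.inter_subset_left
  · have h3 : ∀ y : ℕ, ∑' y' : ℕ, (if IsS ((y' : ℤ) - y) then E else 0) ≤ 3 * E := by
      intro y
      rw [tsum_eq_sum (s := Finset.Icc (y - 1) (y + 1))]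
      · refine (Finset.sum_le_sum (g := fun _ => E) fun i _ => by split_ifs <;> simp).trans ?_
        rw [Finset.sum_const, nsmul_eq_mul]
        gcongr
        have : (Finset.Icc (y - 1) (y + 1)).card ≤ 3 := by rw [Nat.card_Icc]; omega
        exact_mod_cast this
      · intro y' hy'
        rw [if_neg]
        intro hs
        apply hy'
        unfold IsS at hs
        rw [Finset.mem_Icc]; omega
    refine (ENNReal.tsum_le_tsum fun y => mul_le_mul_right (h3 y) _).trans ?_
    rw [ENNReal.tsum_mul_right]
    refine mul_le_of_le_one_left (zero_le) ?_
    simp_rw [pow_succ]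
    rw [ENNReal.tsum_mul_right, ENNReal.tsum_geometric, ENNReal.one_sub_inv_two, inv_inv,
      ENNReal.mul_inv_cancel (by simp) (by simp)]

theorem main3 (hP : (P.i0 : ℕ) = 0) {q : ℝ} {μ : Measure (Config d)} (hμ : IsBernoulliProduct q μ)
    (hε : μ P.Goodᶜ ≤ (12⁻¹ : ℝ≥0∞) ^ 50) {f : Config d → ℝ} (hf : IsLocal f) :
    μ (P.Dr R) ^ 2 ≤ 48 * (P.KK * energy 2 (e1R d) (condOcc μ) f) := by
  haveI := hμ.1
  set E := P.KK * energy 2 (e1R d) (condOcc μ) f with hE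
  by_cases hT : E = ⊤
  · rw [hT]; simp
  by_cases h0 : μ (P.Dr R) = 0
  · rw [h0]; simp
  set m := (μ (P.Dr R)).toReal with hm
  have hfin : μ (P.Dr R) ≠ ⊤ := by finiteness
  have hm0 : 0 < m := ENNReal.toReal_pos h0 hfin
  have h := P.main2 R hP hμ hε hf (a := m / 16) (by positivity)
  rw [← hE] at h
  have h' := ENNReal.toReal_mono (by finiteness) h
  rw [ENNReal.toReal_add (by finiteness) (by finiteness)] at h'
  simp only [ENNReal.toReal_mul, ENNReal.toReal_inv, ENNReal.toReal_ofNat] at h'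
  rw [ENNReal.toReal_ofReal (by positivity), ENNReal.toReal_ofReal (by positivity), ← hm] at h'
  rw [← ENNReal.toReal_le_toReal (by finiteness) (by finiteness)]
  simp only [ENNReal.toReal_mul, ENNReal.toReal_pow, ENNReal.toReal_ofNat, ← hm]
  have e : 1 / (4 * (m / 16)) * (3 * E.toReal) = 12 * E.toReal / m := by field_simp; ring
  rw [e] at h'
  have h4 : m / 4 ≤ 12 * E.toReal / m := by linarith
  rw [le_div_iff₀ hm0] at h4
  nlinarith
end Par
end

section
def CK (d : ℕ) : ℕ := 3 * d * 7 ^ d + 1620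

namespace Par
variable (P : Par d) (R : P.Res)

lemma St_card : P.St.card ≤ 3 * d * 7 ^ d * P.N := by
  have h : P.St ⊆ (Finset.univ : Finset (Fin d)).biUnion fun i =>
      Finset.Icc (fun l => if l = i then -(P.N : ℤ) else -3) (fun l => if l = i then (P.N : ℤ) else 3) := by
    intro x hx
    obtain ⟨i, h1, h2⟩ := P.mem_St.1 hx
    simp only [Finset.mem_biUnion, Finset.mem_univ, true_and, Finset.mem_Icc]
    refine ⟨i, fun l => ?_, fun l => ?_⟩
    · by_cases hl : l = i
      · subst hl; simpa using (abs_le.1 h1).1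
      · simpa [hl] using (abs_le.1 (h2 l hl)).1
    · by_cases hl : l = i
      · subst hl; simpa using (abs_le.1 h1).2
      · simpa [hl] using (abs_le.1 (h2 l hl)).2
  refine (Finset.card_le_card h).trans (Finset.card_biUnion_le.trans ?_)
  have h2 : ∀ i ∈ (Finset.univ : Finset (Fin d)), (Finset.Icc (fun l => if l = i then -(P.N : ℤ) else -3)
      (fun l => if l = i then (P.N : ℤ) else 3)).card ≤ 3 * P.N * 7 ^ d := by
    intro i _
    rw [Pi.card_Icc]
    have h10 := P.N10
    have : ∀ l, (Finset.Icc (if l = i then -(P.N : ℤ) else -3) (if l = i then (P.N : ℤ) else 3)).card ≤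
        (if l = i then 3 * P.N else 1) * 7 := by
      intro l
      rw [Int.card_Icc]
      split_ifs <;> omega
    refine (Finset.prod_le_prod' fun l _ => this l).trans ?_
    rw [Finset.prod_mul_distrib, Finset.prod_ite_eq']
    simp
  refine (Finset.sum_le_sum h2).trans ?_
  simp only [Finset.sum_const, Finset.card_univ, Fintype.card_fin, smul_eq_mul]
  apply le_of_eq; ring

lemma Cor_card {s : ℤ} (hs : IsS s) : (P.Cor s).card ≤ 540 * P.N := by
  have h10 := P.N10
  have hS : P.S = 20 * P.N := rfl
  have h : P.Cor s ⊆ ((Finset.Icc (0 : ℤ) (2 * P.S) ×ˢ Finset.Icc (-1 : ℤ) 1) ∪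
      ((Finset.Icc (P.T s - 1) (P.T s + 1) ×ˢ Finset.Icc (-(P.S + 1) : ℤ) (P.S + 1)) ∪
      (Finset.Icc (0 : ℤ) (2 * P.S) ×ˢ Finset.Icc (s * P.S - 1) (s * P.S + 1)))).image fun p => P.pt p.1 p.2 := by
    intro x hx
    obtain ⟨a, b, h1, rfl⟩ := (P.mem_Cor hs).1 hx
    have hb := P.regC_bd hs h1
    apply Finset.mem_image.2
    refine ⟨(a, b), ?_, rfl⟩
    simp only [Finset.mem_union, Finset.mem_product, Finset.mem_Icc]
    rcases h1 with h | h | h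
    · left; have := abs_le.1 h.1; omega
    · right; left; omega
    · right; right; have := abs_le.1 h.1; omega
  refine (Finset.card_le_card h).trans (Finset.card_image_le.trans ((Finset.card_union_le _ _).trans ?_))
  refine (Nat.add_le_add_left (Finset.card_union_le _ _) _).trans ?_
  simp only [Finset.card_product, Int.card_Icc]
  have e1 : ((1 : ℤ) + 1 - -1).toNat = 3 := by rfl
  have e2 : (P.T s + 1 + 1 - (P.T s - 1)).toNat = 3 := by omega
  have e3 : (s * P.S + 1 + 1 - (s * P.S - 1)).toNat = 3 := by omega
  rw [e1, e2, e3]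
  omega

lemma Keys_card : P.Keys.card ≤ CK d * P.N := by
  have h0 : P.KN.card ≤ 3 * d * 7 ^ d * P.N := Finset.card_image_le.trans P.St_card
  have h1 : ∀ s, IsS s → (P.KC s).card ≤ 540 * P.N := fun s hs => Finset.card_image_le.trans (P.Cor_card hs)
  have a := h1 (-1) (Or.inl rfl)
  have b := h1 0 (Or.inr (Or.inl rfl))
  have c := h1 1 (Or.inr (Or.inr rfl))
  unfold Keys CK
  have := Finset.card_union_le P.KN (P.KC (-1) ∪ (P.KC 0 ∪ P.KC 1))
  have := Finset.card_union_le (P.KC (-1)) (P.KC 0 ∪ P.KC 1)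
  have := Finset.card_union_le (P.KC 0) (P.KC 1)
  rw [add_mul]
  omega

lemma resZ_card : P.resZ.card = 168 * (P.N * P.N) := by
  have hS : P.S = 20 * P.N := rfl
  unfold resZ
  rw [Finset.card_image_of_injective, Finset.card_product, Int.card_Ico, Int.card_Ico]
  · have e1 : ((P.S : ℤ) - 4 * P.N - 4 * P.N).toNat = 12 * P.N := by omega
    have e2 : ((P.S : ℤ) - 3 * P.N - 3 * P.N).toNat = 14 * P.N := by omega
    rw [e1, e2]; ring
  · intro p p' h
    have := P.pt_inj.1 h
    exact Prod.ext this.1 this.2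

lemma ex_Res (hN : CK d ≤ P.N) : Nonempty P.Res := by
  have h : P.Keys.card ≤ P.resZ.card := by
    rw [resZ_card]
    refine P.Keys_card.trans ?_
    nlinarith [Nat.mul_le_mul_right P.N hN]
  have h2 : Fintype.card P.Keys ≤ Fintype.card P.resZ := by simpa using h
  obtain ⟨e⟩ := Function.Embedding.nonempty_of_card_le h2
  refine ⟨⟨fun k => if hk : k ∈ P.Keys then (e ⟨k, hk⟩ : Site d) else origin, ?_, ?_⟩⟩
  · intro k hk k' hk' he
    have hk1 : k ∈ P.Keys := hk
    have hk2 : k' ∈ P.Keys := hk'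
    simp only [dif_pos hk1, dif_pos hk2] at he
    have := e.injective (Subtype.ext he)
    simpa using this
  · intro k hk
    simp only [dif_pos hk]
    exact (e ⟨k, hk⟩).2

lemma Slot_card : (P.Slot R).card ≤ 2 * (CK d * P.N) := by
  have h1 := P.St_card
  have h2 := P.Keys_card
  have h3 : 3 * d * 7 ^ d * P.N ≤ CK d * P.N := Nat.mul_le_mul_right _ (by unfold CK; omega)
  refine (Finset.card_union_le _ _).trans ?_
  have h4 : (P.Keys.image R.φ).card ≤ P.Keys.card := Finset.card_image_le
  omega

lemma Dr_nonempty : ∃ ω : Config d, ω ∈ P.Dr R := by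
  refine ⟨fun x => if x ∈ P.St then P.patS x else if h : ∃ k ∈ P.Keys, R.φ k = x then P.kp h.choose else true, ?_, ?_⟩
  · intro x hx
    simp [hx]
  · intro k hk
    have h1 : R.φ k ∉ P.St := by
      intro h
      have a := P.St_a h
      have b := P.res_a (R.mem k hk)
      have := P.N10
      omega
    have h2 : ∃ k' ∈ P.Keys, R.φ k' = R.φ k := ⟨k, hk, rfl⟩
    simp only [h1, if_false, dif_pos h2]
    congr 1
    exact R.inj h2.choose_spec.1 hk h2.choose_spec.2

lemma Dr_prob {q : ℝ} (hq : 0 < q) (hq2 : q ≤ 1 / 2) {μ : Measure (Config d)} (hμ : IsBernoulliProduct q μ) :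
    ENNReal.ofReal (q ^ (2 * (CK d * P.N))) ≤ μ (P.Dr R) := by
  obtain ⟨ω0, h0⟩ := P.Dr_nonempty R
  have h1 : {η : Config d | ∀ x ∈ P.Slot R, η x = ω0 x} ⊆ P.Dr R := fun η h => (P.Dr_congr R h).2 h0
  refine le_trans ?_ (measure_mono h1)
  rw [hμ.2]
  have h2 : ∀ x ∈ P.Slot R, ENNReal.ofReal q ≤ ENNReal.ofReal (if ω0 x then 1 - q else q) := by
    intro x _
    apply ENNReal.ofReal_le_ofReal
    split_ifs <;> linarith
  refine le_trans ?_ (Finset.prod_le_prod' h2)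
  rw [Finset.prod_const, ENNReal.ofReal_pow hq.le]
  exact pow_le_pow_right_of_le_one' (by simpa using (by linarith : q ≤ 1)) (P.Slot_card R)

def C2 (d : ℕ) : ℕ := 4 * d * (801 * d + 4 * CK d) + 13

lemma Uset_card : P.Uset.card ≤ (81 * P.N) ^ d := by
  have hS : P.S = 20 * P.N := rfl
  have hMM : P.M = 2 * P.S := rfl
  have h10 := P.N10
  refine (Finset.card_filter_le _ _).trans ?_
  rw [Pi.card_Icc]
  simp only [Int.card_Icc, Finset.prod_const, Finset.card_univ, Fintype.card_fin]
  exact Nat.pow_le_pow_left (by omega) _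

lemma KK_le (hd : 1 ≤ d) : P.KK ≤ (((162 * P.N) ^ (C2 d * P.N) : ℕ) : ℝ≥0∞) := by
  have hS : P.S = 20 * P.N := rfl
  have hMM : P.M = 2 * P.S := rfl
  have h10 := P.N10
  set X := 162 * P.N with hX
  have hX1 : 1 ≤ X := by omega
  set r := 20 * d * P.M + 4 * P.Keys.card with hr
  have hr1 : r + 1 ≤ (801 * d + 4 * CK d) * P.N := by
    have := P.Keys_card
    have h1 : 20 * d * P.M = 800 * (d * P.N) := by rw [hMM, hS]; ring
    have h2 : (801 * d + 4 * CK d) * P.N = 801 * (d * P.N) + 4 * (CK d * P.N) := by ring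
    have h3 : 1 ≤ d * P.N := Nat.one_le_iff_ne_zero.2 (Nat.mul_ne_zero (by omega) (by omega))
    omega
  have hu : P.Uset.card ^ 2 + 1 ≤ X ^ (2 * d) := by
    have h1 : P.Uset.card ^ 2 ≤ (81 * P.N) ^ (2 * d) := by
      rw [mul_comm 2 d, pow_mul]
      exact Nat.pow_le_pow_left P.Uset_card 2
    have h2 : X ^ (2 * d) = 2 ^ (2 * d) * (81 * P.N) ^ (2 * d) := by rw [← mul_pow, hX]; congr 1; ring
    have h3 : 2 ≤ 2 ^ (2 * d) := by
      calc 2 = 2 ^ 1 := rfl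
        _ ≤ _ := Nat.pow_le_pow_right (by norm_num) (by omega)
    have h4 : 1 ≤ (81 * P.N) ^ (2 * d) := Nat.one_le_pow _ _ (by omega)
    rw [h2]; nlinarith
  have hc : cost P.Uset.card r ≤ X ^ (4 * d * ((801 * d + 4 * CK d) * P.N)) := by
    unfold cost
    calc ((P.Uset.card ^ 2 + 1) ^ (r + 1)) ^ 2 ≤ ((X ^ (2 * d)) ^ (r + 1)) ^ 2 := by gcongr
      _ = X ^ (4 * d * (r + 1)) := by rw [← pow_mul, ← pow_mul]; congr 1; ring
      _ ≤ _ := Nat.pow_le_pow_right hX1 (Nat.mul_le_mul_left _ hr1)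
  set e := 4 * d * ((801 * d + 4 * CK d) * P.N) with he
  have hc8 : cost 8 4 ≤ X ^ 10 := by
    calc cost 8 4 = 65 ^ 10 := by unfold cost; norm_num
      _ ≤ X ^ 10 := Nat.pow_le_pow_left (by omega) _
  have b1 : 5 * (2 * cost P.Uset.card r) ≤ X ^ (e + 11) := by
    calc 5 * (2 * cost P.Uset.card r) ≤ X * X ^ e := by nlinarith
      _ = X ^ (e + 1) := by ring
      _ ≤ _ := Nat.pow_le_pow_right hX1 (by omega)
  have b2 : 5 * (2 * cost 8 4) ≤ X ^ (e + 11) := by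
    calc 5 * (2 * cost 8 4) ≤ X * X ^ 10 := by nlinarith
      _ = X ^ 11 := by ring
      _ ≤ _ := Nat.pow_le_pow_right hX1 (by omega)
  have b3 : 5 * (9 * P.S ^ 2) ≤ X ^ (e + 11) := by
    calc 5 * (9 * P.S ^ 2) ≤ X * X ^ 2 := by rw [hS, hX]; nlinarith [sq_nonneg P.N, Nat.mul_le_mul_right (P.N ^ 2) h10]
      _ = X ^ 3 := by ring
      _ ≤ _ := Nat.pow_le_pow_right hX1 (by omega)
  unfold KK
  rw [show (5 : ℝ≥0∞) = ((5 : ℕ) : ℝ≥0∞) by norm_num, ← Nat.cast_mul]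
  apply Nat.cast_le.2
  rw [← hr]
  calc 5 * (2 * cost P.Uset.card r + 2 * cost 8 4 + 9 * P.S ^ 2) ≤ 3 * X ^ (e + 11) := by omega
    _ ≤ X * X ^ (e + 11) := Nat.mul_le_mul_right _ (by omega)
    _ = X ^ (e + 12) := by ring
    _ ≤ X ^ (C2 d * P.N) := by
      apply Nat.pow_le_pow_right hX1
      unfold C2
      have : (4 * d * (801 * d + 4 * CK d) + 13) * P.N = e + 13 * P.N := by rw [he]; ring
      omega

end Par
end

section
set_option maxHeartbeats 1000000 in
theorem lower (hd : 2 ≤ d) : ∃ c q₀ : ℝ, 0 < c ∧ 0 < q₀ ∧ q₀ < 1 ∧ ∀ q : ℝ, 0 < q → q < q₀ →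
    ∀ μ : Measure (Config d), IsBernoulliProduct q μ →
      ENNReal.ofReal
        (Real.exp (-(c * (Real.log (1 / q)) ^ d * q ^ (-(1 : ℝ) / ((d : ℝ) - 1))))) ≤ diffCoeff 2 μ := by
  obtain ⟨K1, hK1⟩ : ∃ K1 : ℕ, K1 = CK d := ⟨_, rfl⟩
  obtain ⟨K2, hK2⟩ : ∃ K2 : ℕ, K2 = Par.C2 d := ⟨_, rfl⟩
  obtain ⟨Z, hZ1, hZ⟩ : ∃ Z : ℝ, 1 ≤ Z ∧ (12 : ℝ)⁻¹ ^ 50 = 1 / Z :=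
    ⟨(12 : ℝ) ^ 50, by norm_num, by norm_num⟩
  have hZ0 : 0 < Z := by linarith
  obtain ⟨C3, hC3⟩ : ∃ C3 : ℝ, C3 = K1 + 28 := ⟨_, rfl⟩
  have hCK0 : (0 : ℝ) ≤ K1 := Nat.cast_nonneg _
  have hC31 : (28 : ℝ) ≤ C3 := by linarith
  have hd2 : (2 : ℝ) ≤ d := by exact_mod_cast hd
  have hD : (1 : ℝ) ≤ Z * 246 * d * C3 := by
    have : (1 : ℝ) ≤ Z * 246 := by linarith
    nlinarith [mul_le_mul this (show (1 : ℝ) ≤ d * C3 by nlinarith) (by norm_num) (by positivity)]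
  have hB : (162 * C3 : ℝ) ≤ Z * 246 * d * C3 := by
    have : (162 : ℝ) ≤ Z * 246 := by linarith
    have h2 : C3 ≤ d * C3 := by nlinarith
    calc (162 * C3 : ℝ) ≤ (Z * 246) * (d * C3) := mul_le_mul this h2 (by linarith) (by positivity)
      _ = _ := by ring
  obtain ⟨m, hm⟩ : ∃ m : ℕ, m = 4 * K1 + 3 * K2 + 3 := ⟨_, rfl⟩
  refine ⟨m * C3, 1 / (Z * 246 * d * C3), ?_, by positivity, ?_, ?_⟩
  · have : (0 : ℝ) < m := by rw [hm]; push_cast; positivity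
    positivity
  · rw [div_lt_one (by linarith)]; linarith
  intro q hq hq0 μ hμ
  have hqB : Z * 246 * d * C3 ≤ 1 / q := by
    rw [le_div_iff₀ hq]
    rw [lt_div_iff₀ (by linarith)] at hq0
    linarith
  have hiq : (162 * C3 : ℝ) ≤ 1 / q := hB.trans hqB
  have h28 : (4536 : ℝ) ≤ 1 / q := by linarith
  have hq1 : q ≤ 1 / 4536 := by
    rw [le_div_iff₀ hq] at h28; linarith
  set L := Real.log (1 / q) with hL
  have hLe : Real.exp L = 1 / q := Real.exp_log (by positivity)
  have hLe' : Real.exp (-L) = q := by rw [Real.exp_neg, hLe]; simp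
  have hL1 : 1 ≤ L := by
    rw [hL, Real.le_log_iff_exp_le (by positivity)]
    linarith [Real.exp_one_lt_d9]
  have hLq : L ≤ 1 / q := by
    have := Real.log_le_sub_one_of_pos (show 0 < 1 / q by positivity); linarith
  set h := q ^ (-(1 : ℝ) / ((d : ℝ) - 1)) with hh
  have hd1 : ((d - 1 : ℕ) : ℝ) = (d : ℝ) - 1 := by rw [Nat.cast_sub (by omega)]; simp
  have hhp : h ^ (d - 1) = 1 / q := by
    rw [hh, ← Real.rpow_natCast, ← Real.rpow_mul hq.le, hd1, div_mul_cancel₀ _ (by linarith), Real.rpow_neg_one]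
    simp
  have hh1 : 1 ≤ h := by
    rw [hh]; apply Real.one_le_rpow_of_pos_of_le_one_of_nonpos hq (by linarith)
    apply div_nonpos_of_nonpos_of_nonneg <;> linarith
  have hhq : h ≤ 1 / q := by
    rw [← hhp]; exact le_self_pow₀ hh1 (by omega)
  have hLh : 1 ≤ L * h := by nlinarith
  set κ := ⌈3 * L * h⌉₊ with hκ
  have hκ1 : 3 * L * h ≤ κ := Nat.le_ceil _
  have hκ2 : (κ : ℝ) ≤ 4 * (L * h) := by
    have := (Nat.ceil_lt_add_one (show 0 ≤ 3 * L * h by positivity)).le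
    linarith
  have hκ0 : 1 ≤ κ := by
    have : (1 : ℝ) ≤ κ := by linarith
    exact_mod_cast this
  let P : Par d := ⟨⟨0, by omega⟩, ⟨1, by omega⟩, by simp, 10 + 3 * κ + K1, κ, hκ0, by omega⟩
  have hPN : P.N = 10 + 3 * κ + K1 := rfl
  have hPκ : P.κ = κ := rfl
  have hN : (P.N : ℝ) ≤ C3 * (L * h) := by
    rw [hPN]; push_cast; rw [hC3]; nlinarith
  have hN2 : (P.N : ℝ) ≤ C3 * (1 / q * (1 / q)) := by
    refine hN.trans (mul_le_mul_of_nonneg_left ?_ (by linarith))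
    exact mul_le_mul hLq hhq (by linarith) (by positivity)
  have h13 : (13 : ℝ) ≤ P.N := by exact_mod_cast P.N10
  have hMM : ((P.M : ℕ) : ℝ) = 40 * P.N := by
    have : P.M = 40 * P.N := by simp only [Par.M, Par.S]; ring
    rw [this]; push_cast; ring
  have hpow : (1 - q) ^ (P.κ ^ (d - 1)) ≤ q ^ 3 := by
    have e1 : 1 - q ≤ Real.exp (-q) := by have := Real.add_one_le_exp (-q); linarith
    have e2 : 3 * L / q ≤ (κ : ℝ) ^ (d - 1) := by
      calc 3 * L / q = 3 * L * h ^ (d - 1) := by rw [hhp]; ring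
        _ ≤ (3 * L) ^ (d - 1) * h ^ (d - 1) := by
            apply mul_le_mul_of_nonneg_right _ (by positivity)
            exact le_self_pow₀ (by linarith) (by omega)
        _ = (3 * L * h) ^ (d - 1) := (mul_pow _ _ _).symm
        _ ≤ _ := pow_le_pow_left₀ (by positivity) hκ1 _
    calc (1 - q) ^ (P.κ ^ (d - 1)) ≤ Real.exp (-q) ^ (P.κ ^ (d - 1)) := pow_le_pow_left₀ (by linarith) e1 _
      _ = Real.exp (-(q * (κ : ℝ) ^ (d - 1))) := by rw [← Real.exp_nat_mul, hPκ]; push_cast; congr 1; ring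
      _ ≤ Real.exp (-(3 * L)) := by
          apply Real.exp_le_exp.2
          rw [div_le_iff₀ hq] at e2; linarith
      _ = q ^ 3 := by rw [← hLe', ← Real.exp_nat_mul]; congr 1; push_cast; ring
  have hε : μ P.Goodᶜ ≤ (12⁻¹ : ℝ≥0∞) ^ 50 := by
    refine (P.bad_prob hq.le (by linarith) hμ).trans ?_
    have e : ((12⁻¹ : ℝ≥0∞)) ^ 50 = ENNReal.ofReal ((12 : ℝ)⁻¹ ^ 50) := by
      rw [ENNReal.ofReal_pow (by norm_num), ENNReal.ofReal_inv_of_pos (by norm_num)]; norm_num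
    rw [e, ← ENNReal.ofReal_natCast, ← ENNReal.ofReal_mul (by positivity)]
    apply ENNReal.ofReal_le_ofReal
    push_cast
    calc (6 * d * (P.M + 1) : ℝ) * (1 - q) ^ (P.κ ^ (d - 1)) ≤ (6 * d * (41 * (C3 * (1 / q * (1 / q))))) * q ^ 3 := by
          apply mul_le_mul _ hpow (pow_nonneg (by linarith) _) (by positivity)
          apply mul_le_mul_of_nonneg_left _ (by positivity)
          rw [hMM]; linarith
      _ = 246 * d * C3 * q := by field_simp; ring
      _ ≤ _ := by
          rw [le_div_iff₀ hq] at hqB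
          rw [hZ, le_div_iff₀ hZ0]
          linarith
  obtain ⟨R⟩ := P.ex_Res (by rw [hPN, hK1]; omega)
  rw [diffCoeff, Qform]
  refine le_iInf fun f => ?_
  have main := P.main3 R rfl hμ hε f.2
  set E := energy 2 (e1R d) (condOcc μ) f.1
  have hdr := P.Dr_prob R hq (by linarith) hμ
  have hkl := P.KK_le (by omega : 1 ≤ d)
  rw [← hK1] at hdr
  rw [← hK2] at hkl
  have hX : ((162 * P.N : ℕ) : ℝ) ≤ (1 / q) ^ 3 := by
    push_cast
    calc (162 * P.N : ℝ) ≤ (162 * C3) * (1 / q * (1 / q)) := by linarith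
      _ ≤ (1 / q) * (1 / q * (1 / q)) := mul_le_mul_of_nonneg_right hiq (by positivity)
      _ = _ := by ring
  have hkk : 48 * (P.KK * E) ≤ ENNReal.ofReal ((1 / q) ^ (3 * (K2 * P.N + 1))) * E := by
    rw [← mul_assoc]
    gcongr
    calc 48 * P.KK ≤ ((162 * P.N : ℕ) : ℝ≥0∞) * (((162 * P.N) ^ (K2 * P.N) : ℕ) : ℝ≥0∞) := by
          gcongr
          · have : 48 ≤ 162 * P.N := by have := P.N10; omega
            exact_mod_cast this
      _ = (((162 * P.N) ^ (K2 * P.N + 1) : ℕ) : ℝ≥0∞) := by rw [pow_succ]; push_cast; ring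
      _ ≤ _ := by
          rw [← ENNReal.ofReal_natCast]
          apply ENNReal.ofReal_le_ofReal
          rw [pow_mul, Nat.cast_pow]
          exact pow_le_pow_left₀ (by positivity) hX _
  have h3 := (pow_le_pow_left' hdr 2).trans (main.trans hkk)
  set b := (1 / q) ^ (3 * (K2 * P.N + 1)) with hb
  have hb0 : 0 < b := by positivity
  have h4 : ENNReal.ofReal b * ENNReal.ofReal (Real.exp (-(m * C3 * L ^ d * h))) ≤ ENNReal.ofReal b * E := by
    refine le_trans ?_ h3
    rw [← ENNReal.ofReal_mul hb0.le, ← ENNReal.ofReal_pow (by positivity)]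
    apply ENNReal.ofReal_le_ofReal
    have e5 : Real.exp (-(m * C3 * L ^ d * h)) ≤ Real.exp (-L) ^ (m * P.N) := by
      rw [← Real.exp_nat_mul]
      apply Real.exp_le_exp.2
      push_cast
      have : L * L ≤ L ^ d := by rw [← pow_two]; exact pow_le_pow_right₀ hL1 hd
      have : (P.N : ℝ) * L ≤ C3 * (L ^ d * h) := by
        calc (P.N : ℝ) * L ≤ C3 * (L * h) * L := mul_le_mul_of_nonneg_right hN (by linarith)
          _ = C3 * ((L * L) * h) := by ring
          _ ≤ _ := by gcongr
      have := mul_le_mul_of_nonneg_left this (Nat.cast_nonneg (α := ℝ) m)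
      linarith
    rw [hLe'] at e5
    have e6 : q ^ (m * P.N) ≤ q ^ (2 * (K1 * P.N) * 2 + 3 * (K2 * P.N + 1)) := by
      apply pow_le_pow_of_le_one hq.le (by linarith)
      have := P.N10
      rw [hm]; nlinarith
    calc b * Real.exp (-(m * C3 * L ^ d * h)) ≤ b * q ^ (2 * (K1 * P.N) * 2 + 3 * (K2 * P.N + 1)) :=
          mul_le_mul_of_nonneg_left (e5.trans e6) hb0.le
      _ = _ := by rw [hb, pow_add, ← pow_mul, one_div, inv_pow]; field_simp
  exact (ENNReal.mul_le_mul_iff_right (by simpa using hb0) ENNReal.ofReal_ne_top).1 h4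
end

section
/-- `Jn H x y`: `x` and `y` belong to the same component of the closure of `H`. -/
inductive Jn (H : Set (Site d)) : Site d → Site d → Prop
  | base {h : Site d} : h ∈ H → Jn H h h
  | glue {x y z w : Site d} : Jn H x y → Jn H z w → (∀ i, |y i - z i| ≤ 5) → Jn H x w
  | symm {x y : Site d} : Jn H x y → Jn H y x
  | box {x y u : Site d} : Jn H x y → (∀ i, min (x i) (y i) ≤ u i ∧ u i ≤ max (x i) (y i)) → Jn H x u

lemma Jn.trans {H : Set (Site d)} {x y z : Site d} (h : Jn H x y) (h' : Jn H y z) : Jn H x z :=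
  Jn.glue h h' (by simp)

lemma Jn.left {H : Set (Site d)} {x y : Site d} (h : Jn H x y) : Jn H x x := h.trans h.symm

lemma Jn.of_sub {H H' : Set (Site d)} (hs : ∀ h ∈ H, Jn H' h h) {x y : Site d} (h : Jn H x y) : Jn H' x y := by
  induction h with
  | base h => exact hs _ h
  | glue _ _ h a b => exact Jn.glue a b h
  | symm _ a => exact a.symm
  | box _ h a => exact a.box h

lemma Jn.mono {H H' : Set (Site d)} (hs : H ⊆ H') {x y : Site d} (h : Jn H x y) : Jn H' x y :=
  h.of_sub fun _ h => Jn.base (hs h)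

lemma Jn.loc {H V : Set (Site d)} {x y : Site d} (h : Jn H x y) (hV : ∀ u, Jn H x u → u ∈ V) : Jn (H ∩ V) x y := by
  induction h with
  | base h => exact Jn.base ⟨h, hV _ (Jn.base h)⟩
  | glue h1 h2 h a b => exact Jn.glue (a hV) (b fun u hu => hV u (Jn.glue h1 hu h)) h
  | symm h a => exact (a fun u hu => hV u (h.symm.trans hu)).symm
  | box _ h a => exact (a hV).box h

lemma Jn.transl {H H' : Set (Site d)} (v : Site d) (hH : ∀ h ∈ H, h + v ∈ H') {x y : Site d} (h : Jn H x y) :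
    Jn H' (x + v) (y + v) := by
  induction h with
  | base h => exact Jn.base (hH _ h)
  | glue _ _ h a b => exact Jn.glue a b (by simpa using h)
  | symm _ a => exact a.symm
  | box _ h a => 
    refine a.box fun i => ?_
    have := h i
    simp only [Pi.add_apply]
    omega

/-- empty sites -/
def holes (η : Config d) : Set (Site d) := {x | η x = false}

/-- the cube -/
def cube (d : ℕ) (m : ℤ) : Set (Site d) := {x | ∀ i, |x i| ≤ m}

/-- near component -/
def Nc (H : Set (Site d)) : Set (Site d) := {u | ∃ p, (∀ i, |p i| ≤ 3) ∧ Jn H p u}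

lemma adj_cases {x y : Site d} (h : adj x y) : ∃ i, |x i - y i| = 1 ∧ ∀ j, j ≠ i → x j = y j := by
  have h' := mem_neighbors.2 h
  simp only [neighbors, Finset.mem_image, Finset.mem_univ, true_and, Prod.exists] at h'
  obtain ⟨i, b, rfl⟩ := h'
  refine ⟨i, ?_, fun j hj => by simp [hj]⟩
  cases b <;> simp

lemma adj_abs {x y : Site d} (h : adj x y) (i : Fin d) : |x i - y i| ≤ 1 := by
  obtain ⟨j, h1, h2⟩ := adj_cases h
  by_cases hij : i = j
  · subst hij; omega
  · rw [h2 i hij]; simp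

/-- the key geometric fact -/
lemma adj_box {x y w : Site d} (h : adj x y) (h' : adj y w) (hw : w ≠ x) (i : Fin d) :
    min (x i) (w i) ≤ y i ∧ y i ≤ max (x i) (w i) := by
  obtain ⟨j, h1, h2⟩ := adj_cases h
  obtain ⟨j', h1', h2'⟩ := adj_cases h'
  by_cases hij : i = j
  · by_cases hij' : i = j'
    · subst hij; subst hij'
      have hne : w i ≠ x i := by
        intro hh; apply hw; funext t
        by_cases ht : t = i
        · rw [ht, hh]
        · rw [h2 t ht, h2' t ht]
      rcases (abs_eq (by norm_num)).1 h1 with a | a <;> rcases (abs_eq (by norm_num)).1 h1' with b | b <;> omega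
    · have := h2' i hij'; omega
  · have := h2 i hij; omega

lemma Jn.swap_aux {H : Set (Site d)} {x y w : Site d} (hx : x ∈ H) (hxy : adj x y) (hyw : adj y w) (hw : w ≠ x)
    (hwH : w ∈ H) : Jn H y y := by
  have h1 : Jn H x w := Jn.glue (Jn.base hx) (Jn.base hwH) (fun i => by
    have a := abs_le.1 (adj_abs hxy i); have b := abs_le.1 (adj_abs hyw i)
    rw [abs_le]; constructor <;> omega)
  have h2 : Jn H x y := h1.box (adj_box hxy hyw hw)
  exact h2.symm.left

/-- invariance of the closure under a legal swap -/
lemma Jn.swap_sub {η : Config d} {V : Set (Site d)} {x y : Site d} (hxy : adj x y)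
    (hc : constraint 2 η x y) (hV : ∀ z, (adj x z ∨ adj y z) → z ∈ V) (hxV : x ∈ V) (hyV : y ∈ V) :
    ∀ h ∈ holes η ∩ V, Jn (holes (swap η x y) ∩ V) h h := by
  rw [constraint_two] at hc
  obtain ⟨⟨z, hz, hzy, hzh⟩, ⟨w, hw, hwx, hwh⟩⟩ := hc
  have hzV := hV z (Or.inl hz)
  have hwV := hV w (Or.inr hw)
  have hz' : z ∈ holes (swap η x y) ∩ V := ⟨by
    simp only [holes, Set.mem_setOf_eq, swap]
    rw [if_neg (fun h => adj_ne hz h.symm), if_neg hzy]; exact hzh, hzV⟩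
  have hw' : w ∈ holes (swap η x y) ∩ V := ⟨by
    simp only [holes, Set.mem_setOf_eq, swap]
    rw [if_neg hwx, if_neg (fun h => adj_ne hw h.symm)]; exact hwh, hwV⟩
  rintro h ⟨hh, hhV⟩
  by_cases h1 : h = x
  · subst h1
    have : y ∈ holes (swap η h y) ∩ V := ⟨by
      simp only [holes, Set.mem_setOf_eq, swap]
      rw [if_neg (fun e => adj_ne hxy e.symm), if_pos trivial]; exact hh, hyV⟩
    exact Jn.swap_aux this ((adj_comm).1 hxy) hz hzy hz'
  by_cases h2 : h = y
  · subst h2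
    have : x ∈ holes (swap η x h) ∩ V := ⟨by
      simp only [holes, Set.mem_setOf_eq, swap]
      rw [if_pos trivial]; exact hh, hxV⟩
    exact Jn.swap_aux this hxy hw hwx hw'
  · exact Jn.base ⟨by simp only [holes, Set.mem_setOf_eq, swap]; rw [if_neg h1, if_neg h2]; exact hh, hhV⟩
end

section
lemma Jn.swap_iff {η : Config d} {V : Set (Site d)} {x y : Site d} (hxy : adj x y)
    (hc : constraint 2 η x y) (hV : ∀ z, (adj x z ∨ adj y z) → z ∈ V) {p u : Site d} :
    Jn (holes (swap η x y) ∩ V) p u ↔ Jn (holes η ∩ V) p u := by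
  have hxV : x ∈ V := hV x (Or.inr (adj_comm.1 hxy))
  have hyV : y ∈ V := hV y (Or.inl hxy)
  constructor
  · intro h
    refine h.of_sub ?_
    have := Jn.swap_sub (η := swap η x y) hxy (constraint_swap.2 hc) hV hxV hyV
    rwa [swap_swap] at this
  · exact fun h => h.of_sub (Jn.swap_sub hxy hc hV hxV hyV)

lemma Jn.cube {H : Set (Site d)} {m : ℤ} (hH : H ⊆ cube d m) {x y : Site d} (h : Jn H x y) :
    x ∈ KA.cube d m ∧ y ∈ KA.cube d m := by
  induction h with
  | base h => exact ⟨hH h, hH h⟩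
  | glue _ _ _ a b => exact ⟨a.1, b.2⟩
  | symm _ a => exact ⟨a.2, a.1⟩
  | box _ h a =>
    refine ⟨a.1, fun i => ?_⟩
    have h1 := abs_le.1 (a.1 i); have h2 := abs_le.1 (a.2 i)
    have := h i
    rw [abs_le]; constructor <;> omega

lemma cube_mono {m m' : ℤ} (h : m ≤ m') : cube d m ⊆ cube d m' := fun _ hx i => (hx i).trans h

/-- the test function -/
def ft (m : ℤ) (η : Config d) : ℝ := -(sSup (dotZ (e1R d) '' Nc (holes η ∩ cube d m)))

/-- the bad event -/
def BadE (m : ℤ) : Set (Config d) := {η | ¬ Nc (holes η ∩ cube d (m + 2)) ⊆ cube d (m - 1)}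

lemma Nc_eq {H : Set (Site d)} {z : Site d} (hz : z ∈ H) (h3 : ∀ i, |z i| ≤ 2) : Nc H = {u | Jn H z u} := by
  ext u
  constructor
  · rintro ⟨p, hp, h⟩
    refine Jn.glue (Jn.base hz) h fun i => ?_
    have a := abs_le.1 (hp i); have b := abs_le.1 (h3 i)
    rw [abs_le]; constructor <;> omega
  · intro h
    exact ⟨z, fun i => (h3 i).trans (by norm_num), h⟩

lemma Nc_loc {H V : Set (Site d)} (h : Nc H ⊆ V) : Nc (H ∩ V) = Nc H := by
  ext u
  constructor
  · rintro ⟨p, hp, hu⟩; exact ⟨p, hp, hu.mono Set.inter_subset_left⟩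
  · rintro ⟨p, hp, hu⟩
    exact ⟨p, hp, hu.loc fun v hv => h ⟨p, hp, hv⟩⟩

lemma ft_local {m : ℤ} {η η' : Config d} (h : ∀ x ∈ cube d m, η x = η' x) : ft m η = ft m η' := by
  have : holes η ∩ cube d m = holes η' ∩ cube d m := by
    ext x
    simp only [holes, Set.mem_inter_iff, Set.mem_setOf_eq]
    constructor
    · rintro ⟨a, b⟩; exact ⟨(h x b) ▸ a, b⟩
    · rintro ⟨a, b⟩; exact ⟨(h x b).symm ▸ a, b⟩
  rw [ft, ft, this]

lemma inter_cube (H : Set (Site d)) {m m' : ℤ} (h : m ≤ m') : (H ∩ cube d m') ∩ cube d m = H ∩ cube d m := by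
  rw [Set.inter_assoc, Set.inter_eq_right.2 (cube_mono h)]

lemma adj_cube {x y : Site d} {m : ℤ} (h : adj x y) (hx : x ∈ cube d m) : y ∈ cube d (m + 1) := fun i => by
  have a := abs_le.1 (adj_abs h i); have b := abs_le.1 (hx i)
  rw [abs_le]; constructor <;> omega

lemma ft_env_far {m : ℤ} {η : Config d} {x y : Site d} (hx : x ∉ cube d m) (hy : y ∉ cube d m) :
    ft m (swap η x y) = ft m η := by
  apply ft_local
  intro z hz
  exact swap_of_ne _ (fun h => hx (h ▸ hz)) (fun h => hy (h ▸ hz))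

lemma ft_env {m : ℤ} {η : Config d} {x y : Site d} (hxy : adj x y) (hc : constraint 2 η x y) (hB : η ∉ BadE m) :
    ft m (swap η x y) = ft m η := by
  by_cases hx : x ∉ cube d m ∧ y ∉ cube d m
  · exact ft_env_far hx.1 hx.2
  have hx1 : x ∈ cube d (m + 1) ∧ y ∈ cube d (m + 1) := by
    by_cases h : x ∈ cube d m
    · exact ⟨cube_mono (by omega) h, adj_cube hxy h⟩
    · have : y ∈ cube d m := by tauto
      exact ⟨adj_cube (adj_comm.1 hxy) this, cube_mono (by omega) this⟩
  have hV : ∀ z, (adj x z ∨ adj y z) → z ∈ cube d (m + 2) := by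
    rintro z (h | h)
    · have := adj_cube h hx1.1; rwa [add_assoc] at this
    · have := adj_cube h hx1.2; rwa [add_assoc] at this
  have hN : Nc (holes (swap η x y) ∩ cube d (m + 2)) = Nc (holes η ∩ cube d (m + 2)) := by
    ext u
    simp only [Nc, Set.mem_setOf_eq, Jn.swap_iff hxy hc hV]
  have hB' : Nc (holes η ∩ cube d (m + 2)) ⊆ cube d (m - 1) := by simpa [BadE] using hB
  have hB1 := hB'.trans (cube_mono (show m - 1 ≤ m by omega))
  have e1 := Nc_loc hB1
  have e2 := Nc_loc (hN ▸ hB1)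
  rw [inter_cube _ (by omega)] at e1 e2
  rw [ft, ft, e1, e2, hN]

lemma sSup_neg_add {S : Set ℝ} (hS : S.Nonempty) (hb : BddAbove S) (c : ℝ) :
    sSup ((fun x => x + c) '' S) = sSup S + c := by
  have := (OrderIso.addRight c).map_csSup' hS hb
  simpa using this.symm

lemma dot_e1 (hd : 1 ≤ d) (x : Site d) : dotZ (e1R d) x = x ⟨0, by omega⟩ := by
  unfold dotZ e1R
  rw [Finset.sum_eq_single (⟨0, by omega⟩ : Fin d)]
  · simp
  · intro b _ hb
    have : (b : ℕ) ≠ 0 := fun h => hb (Fin.ext h)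
    simp [this]
  · simp

lemma dot_abs (hd : 1 ≤ d) {x : Site d} {m : ℤ} (hx : x ∈ cube d m) : |dotZ (e1R d) x| ≤ m := by
  rw [dot_e1 hd]
  exact_mod_cast hx _

lemma Nc_sub {H : Set (Site d)} {m : ℤ} (hH : H ⊆ cube d m) : Nc H ⊆ cube d m := by
  rintro u ⟨p, _, h⟩; exact (h.cube hH).2

lemma ft_abs (hd : 1 ≤ d) {m : ℤ} (hm : 0 ≤ m) (η : Config d) : |ft m η| ≤ m := by
  have h : ∀ r ∈ dotZ (e1R d) '' Nc (holes η ∩ cube d m), |r| ≤ m := by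
    rintro r ⟨u, hu, rfl⟩
    exact dot_abs hd (Nc_sub Set.inter_subset_right hu)
  have hm' : (0 : ℝ) ≤ m := by exact_mod_cast hm
  rw [ft, abs_neg]
  rcases Set.eq_empty_or_nonempty (dotZ (e1R d) '' Nc (holes η ∩ cube d m)) with h0 | ⟨r, hr⟩
  · rw [h0]; simpa using hm'
  · rw [abs_le]
    refine ⟨?_, csSup_le ⟨r, hr⟩ fun b hb => (abs_le.1 (h b hb)).2⟩
    exact (abs_le.1 (h r hr)).1.trans (le_csSup ⟨m, fun b hb => (abs_le.1 (h b hb)).2⟩ hr)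

lemma ft_tag (hd : 1 ≤ d) {m : ℤ} (hm : 3 ≤ m) {η : Config d} {y : Site d} (hy : adj origin y)
    (hc : constraint 2 η origin y) (hB : η ∉ BadE m) :
    dotZ (e1R d) y + ft m (shift y (swap η origin y)) - ft m η = 0 := by
  have ho : (origin : Site d) ∈ cube d 0 := fun i => by simp [origin]
  have hy1 : y ∈ cube d 1 := by simpa using adj_cube hy ho
  have hV : ∀ z, (adj origin z ∨ adj y z) → z ∈ cube d (m + 2) := by
    rintro z (h | h)
    · exact cube_mono (by omega) (adj_cube h ho)
    · exact cube_mono (by omega) (adj_cube h hy1)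
  have hB' : Nc (holes η ∩ cube d (m + 2)) ⊆ cube d (m - 1) := by simpa [BadE] using hB
  obtain ⟨⟨z, hz, hzy, hzh⟩, -⟩ := constraint_two.1 hc
  have hz1 : z ∈ cube d 1 := by simpa using adj_cube hz ho
  have hzs : swap η origin y z = false := by rw [swap_of_ne _ (adj_ne hz).symm hzy]; exact hzh
  have hzH : z ∈ holes η ∩ cube d (m + 2) := ⟨hzh, cube_mono (by omega) hz1⟩
  have e0 := Nc_eq hzH (fun i => (hz1 i).trans (by norm_num))
  have hB1 := hB'.trans (cube_mono (show m - 1 ≤ m by omega))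
  have e1 := Nc_loc hB1
  rw [inter_cube _ (by omega), e0] at e1
  -- the shifted configuration
  have hzy2 : ∀ i, |(z + y) i| ≤ 2 := fun i => by
    have a := abs_le.1 (hz1 i); have b := abs_le.1 (hy1 i)
    rw [Pi.add_apply, abs_le]; constructor <;> omega
  have hzS : z + y ∈ holes (shift y (swap η origin y)) ∩ cube d m := ⟨by
    simp only [holes, shift, Set.mem_setOf_eq, add_sub_cancel_right]; exact hzs,
    fun i => (hzy2 i).trans (by omega)⟩
  have e2 := Nc_eq hzS hzy2
  have key : ∀ u, Jn (holes (shift y (swap η origin y)) ∩ cube d m) (z + y) (u + y) ↔ Jn (holes η ∩ cube d (m + 2)) z u := by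
    intro u
    rw [← Jn.swap_iff hy hc hV]
    constructor
    · intro h
      have := h.transl (H' := holes (swap η origin y) ∩ cube d (m + 2)) (-y) ?_
      · simpa using this
      · rintro x ⟨hx1, hx2⟩
        refine ⟨?_, fun i => ?_⟩
        · simpa [holes, shift, sub_eq_add_neg] using hx1
        · have a := abs_le.1 (hx2 i); have b := abs_le.1 (hy1 i)
          rw [Pi.add_apply, Pi.neg_apply, abs_le]; constructor <;> omega
    · intro h
      have h' := h.loc (V := {x | x + y ∈ cube d m}) ?_
      · refine h'.transl y ?_
        rintro x ⟨⟨hx1, _⟩, hx3⟩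
        refine ⟨?_, hx3⟩
        simpa [holes, shift] using hx1
      · intro v hv
        rw [Jn.swap_iff hy hc hV] at hv
        have hv' : v ∈ cube d (m - 1) := hB' (e0 ▸ hv)
        intro i
        have a := abs_le.1 (hv' i); have b := abs_le.1 (hy1 i)
        rw [Pi.add_apply, abs_le]; constructor <;> omega
  have e3 : Nc (holes (shift y (swap η origin y)) ∩ cube d m) = (fun u => u + y) '' {u | Jn (holes η ∩ cube d (m + 2)) z u} := by
    rw [e2]
    ext u
    simp only [Set.mem_setOf_eq, Set.mem_image]
    constructor
    · intro h
      exact ⟨u - y, (key _).1 (by simpa using h), by simp⟩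
    · rintro ⟨v, hv, rfl⟩; exact (key _).2 hv
  have e4 : dotZ (e1R d) '' ((fun u => u + y) '' {u | Jn (holes η ∩ cube d (m + 2)) z u}) =
      (fun x => x + dotZ (e1R d) y) '' (dotZ (e1R d) '' {u | Jn (holes η ∩ cube d (m + 2)) z u}) := by
    rw [Set.image_image, Set.image_image]
    apply Set.image_congr
    intro u _
    simp [dot_e1 hd]
  rw [ft, ft, e1, e3, e4, sSup_neg_add]
  · ring
  · exact ⟨_, z, Jn.base hzH, rfl⟩
  · refine ⟨m, ?_⟩
    rintro r ⟨u, hu, rfl⟩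
    exact (abs_le.1 (dot_abs hd (hB1 (e0 ▸ hu)))).2
end

section
lemma le_at {a b : Site d} (h : a ≤ b) (i : Fin d) : a i ≤ b i := h i

/-- boxes generated by `H` -/
inductive Bgx (H : Set (Site d)) : Site d → Site d → Prop
  | single {h : Site d} : h ∈ H → Bgx H h h
  | merge {a b a' b' y z : Site d} : Bgx H a b → Bgx H a' b' → (a ≤ y ∧ y ≤ b) → (a' ≤ z ∧ z ≤ b') →
      (∀ i, |y i - z i| ≤ 5) → Bgx H (a ⊓ a') (b ⊔ b')

lemma Jn.toBgx {H : Set (Site d)} {x y : Site d} (h : Jn H x y) :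
    ∃ a b, Bgx H a b ∧ (a ≤ x ∧ x ≤ b) ∧ (a ≤ y ∧ y ≤ b) := by
  induction h with
  | @base h hh => exact ⟨h, h, Bgx.single hh, ⟨le_rfl, le_rfl⟩, ⟨le_rfl, le_rfl⟩⟩
  | glue _ _ h ih ih' =>
    obtain ⟨a, b, h1, h2, h3⟩ := ih
    obtain ⟨a', b', h1', h2', h3'⟩ := ih'
    exact ⟨a ⊓ a', b ⊔ b', Bgx.merge h1 h1' h3 h2' h, ⟨inf_le_left.trans h2.1, h2.2.trans le_sup_left⟩,
      ⟨inf_le_right.trans h3'.1, h3'.2.trans le_sup_right⟩⟩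
  | symm _ ih =>
    obtain ⟨a, b, h1, h2, h3⟩ := ih
    exact ⟨a, b, h1, h3, h2⟩
  | @box x y u _ h ih =>
    obtain ⟨a, b, h1, h2, h3⟩ := ih
    refine ⟨a, b, h1, h2, fun i => ?_, fun i => ?_⟩
    · show a i ≤ u i
      have := h i; have := le_at h2.1 i; have := le_at h3.1 i; omega
    · show u i ≤ b i
      have := h i; have := le_at h2.2 i; have := le_at h3.2 i; omega

lemma Bgx.cube {H : Set (Site d)} {m : ℤ} (hH : H ⊆ cube d m) {a b : Site d} (h : Bgx H a b) :
    a ∈ KA.cube d m ∧ b ∈ KA.cube d m := by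
  induction h with
  | single h => exact ⟨hH h, hH h⟩
  | merge _ _ _ _ _ ih ih' =>
    constructor <;> intro i
    · have h1 := abs_le.1 (ih.1 i); have h2 := abs_le.1 (ih'.1 i)
      rw [Pi.inf_apply, abs_le]; constructor <;> omega
    · have h1 := abs_le.1 (ih.2 i); have h2 := abs_le.1 (ih'.2 i)
      rw [Pi.sup_apply, abs_le]; constructor <;> omega

lemma Bgx.AL {H : Set (Site d)} {k : ℤ} (hk : 1 ≤ k) {a b : Site d} (h : Bgx H a b) (hs : ∃ i, k ≤ b i - a i) :
    ∃ a b, Bgx H a b ∧ (∃ i, k ≤ b i - a i) ∧ ∀ i, b i - a i ≤ 2 * k + 5 := by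
  induction h with
  | single h => obtain ⟨i, hi⟩ := hs; simp at hi; omega
  | @merge a b a' b' y z h1 h2 hy hz hyz ih ih' =>
    by_cases c1 : ∃ i, k ≤ b i - a i
    · exact ih c1
    by_cases c2 : ∃ i, k ≤ b' i - a' i
    · exact ih' c2
    push Not at c1 c2
    refine ⟨_, _, Bgx.merge h1 h2 hy hz hyz, hs, fun i => ?_⟩
    have := c1 i; have := c2 i; have := le_at hy.1 i; have := le_at hy.2 i; have := le_at hz.1 i; have := le_at hz.2 i
    have := abs_le.1 (hyz i)
    simp only [Pi.inf_apply, Pi.sup_apply]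
    omega

lemma Bgx.dense {H : Set (Site d)} {a b : Site d} (h : Bgx H a b) (i : Fin d) :
    (∃ h ∈ H, a ≤ h ∧ h ≤ b ∧ h i = a i) ∧ (∃ h ∈ H, a ≤ h ∧ h ≤ b ∧ h i = b i) ∧
    ∀ t, a i ≤ t → t ≤ b i → ∃ h ∈ H, a ≤ h ∧ h ≤ b ∧ |h i - t| ≤ 5 := by
  induction h with
  | @single h hh =>
    refine ⟨⟨h, hh, le_rfl, le_rfl, rfl⟩, ⟨h, hh, le_rfl, le_rfl, rfl⟩, fun t h1 h2 => ⟨h, hh, le_rfl, le_rfl, ?_⟩⟩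
    rw [le_antisymm h1 h2]; simp
  | @merge a b a' b' y z h1 h2 hy hz hyz ih ih' =>
    obtain ⟨⟨l, lH, l1, l2, l3⟩, ⟨r, rH, r1, r2, r3⟩, hd⟩ := ih
    obtain ⟨⟨l', lH', l1', l2', l3'⟩, ⟨r', rH', r1', r2', r3'⟩, hd'⟩ := ih'
    have A : ∀ u, a ≤ u → a ⊓ a' ≤ u := fun u hu => inf_le_left.trans hu
    have A' : ∀ u, a' ≤ u → a ⊓ a' ≤ u := fun u hu => inf_le_right.trans hu
    have B : ∀ u, u ≤ b → u ≤ b ⊔ b' := fun u hu => hu.trans le_sup_left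
    have B' : ∀ u, u ≤ b' → u ≤ b ⊔ b' := fun u hu => hu.trans le_sup_right
    refine ⟨?_, ?_, ?_⟩
    · rcases le_total (a i) (a' i) with h | h
      · exact ⟨l, lH, A _ l1, B _ l2, by rw [l3, Pi.inf_apply]; omega⟩
      · exact ⟨l', lH', A' _ l1', B' _ l2', by rw [l3', Pi.inf_apply]; omega⟩
    · rcases le_total (b i) (b' i) with h | h
      · exact ⟨r', rH', A' _ r1', B' _ r2', by rw [r3', Pi.sup_apply]; omega⟩
      · exact ⟨r, rH, A _ r1, B _ r2, by rw [r3, Pi.sup_apply]; omega⟩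
    · intro t ht1 ht2
      by_cases c : a i ≤ t ∧ t ≤ b i
      · obtain ⟨h, hH, h1, h2, h3⟩ := hd t c.1 c.2
        exact ⟨h, hH, A _ h1, B _ h2, h3⟩
      by_cases c' : a' i ≤ t ∧ t ≤ b' i
      · obtain ⟨h, hH, h1, h2, h3⟩ := hd' t c'.1 c'.2
        exact ⟨h, hH, A' _ h1, B' _ h2, h3⟩
      have := le_at hy.1 i; have := le_at hy.2 i; have := le_at hz.1 i; have := le_at hz.2 i
      have := abs_le.1 (hyz i)
      simp only [Pi.inf_apply, Pi.sup_apply] at ht1 ht2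
      by_cases c2 : t < a i
      · exact ⟨l, lH, A _ l1, B _ l2, by rw [l3, abs_le]; constructor <;> omega⟩
      · exact ⟨r, rH, A _ r1, B _ r2, by rw [r3, abs_le]; constructor <;> omega⟩

/-- slabs -/
def slab (a b : Site d) (i : Fin d) (j : ℕ) : Finset (Site d) :=
  Finset.Icc (Function.update a i (a i + 11 * j)) (Function.update b i (a i + 11 * j + 10))

lemma mem_slab {a b x : Site d} {i : Fin d} {j : ℕ} (h1 : a ≤ x) (h2 : x ≤ b)
    (h3 : |x i - (a i + 11 * j + 5)| ≤ 5) : x ∈ slab a b i j := by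
  rw [slab, Finset.mem_Icc]
  have := abs_le.1 h3
  constructor
  · intro l
    by_cases hl : l = i
    · subst hl; simp; omega
    · simp [hl, h1 l]
  · intro l
    by_cases hl : l = i
    · subst hl; simp; omega
    · simp [hl, h2 l]

lemma slab_disj {a b : Site d} {i : Fin d} {j j' : ℕ} (h : j ≠ j') :
    Disjoint (slab a b i j : Set (Site d)) (slab a b i j') := by
  rw [Set.disjoint_left]
  intro x hx hx'
  simp only [slab, Finset.coe_Icc, Set.mem_Icc] at hx hx'
  have h1 := hx.1 i; have h2 := hx.2 i; have h3 := hx'.1 i; have h4 := hx'.2 i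
  simp at h1 h2 h3 h4
  omega

lemma slab_card {a b : Site d} {i : Fin d} {j : ℕ} {n : ℕ} (h : ∀ l, b l - a l + 1 ≤ n) :
    (slab a b i j).card ≤ 11 * n ^ (d - 1) := by
  rw [slab, Pi.card_Icc, ← Finset.mul_prod_erase _ _ (Finset.mem_univ i)]
  apply Nat.mul_le_mul
  · simp; omega
  · refine (Finset.prod_le_pow_card _ _ n ?_).trans ?_
    · intro l hl
      have hl' : l ≠ i := Finset.ne_of_mem_erase hl
      have := h l
      simp [hl']; omega
    · rw [Finset.card_erase_of_mem (Finset.mem_univ _)]; simp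

/-- slab hit event -/
def hit (T : Finset (Site d)) : Set (Config d) := {η | ∃ x ∈ T, η x = false}

lemma hit_dep (T : Finset (Site d)) : DepOn (T : Set (Site d)) (hit T) := by
  intro ω ω' h
  constructor
  · rintro ⟨x, hx, e⟩; exact ⟨x, hx, by rw [← h x hx]; exact e⟩
  · rintro ⟨x, hx, e⟩; exact ⟨x, hx, by rw [h x hx]; exact e⟩

lemma hit_meas (T : Finset (Site d)) : MeasurableSet (hit T) :=
  measurableSet_finite T _ (fun η η' h => hit_dep T η η' h)

lemma hit_prob {q : ℝ} {μ : Measure (Config d)} (hμ : IsBernoulliProduct q μ) (T : Finset (Site d)) :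
    μ (hit T) ≤ T.card * ENNReal.ofReal q := by
  have : hit T ⊆ ⋃ x ∈ T, {η : Config d | η x = false} := by
    rintro η ⟨x, hx, e⟩; simp only [Set.mem_iUnion]; exact ⟨x, hx, e⟩
  refine (measure_mono this).trans ((measure_biUnion_finset_le _ _).trans ?_)
  rw [← nsmul_eq_mul]
  refine Finset.sum_le_card_nsmul _ _ _ fun x _ => ?_
  have := hμ.2 {x} (fun _ => false)
  simp at this
  exact this.le

lemma slabs_prob {q : ℝ} {μ : Measure (Config d)} (hμ : IsBernoulliProduct q μ) {a b : Site d} (i : Fin d)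
    {n : ℕ} (h : ∀ l, b l - a l + 1 ≤ n) (J : ℕ) :
    μ (⋂ j ∈ Finset.range J, hit (slab a b i j)) ≤ ((11 * n ^ (d - 1) : ℕ) * ENNReal.ofReal q) ^ J := by
  have := indep_fin hμ (Finset.range J) (fun j => (slab a b i j : Set (Site d))) (fun j => hit (slab a b i j))
    (fun j => hit_meas _) (fun j => hit_dep _) (fun j _ j' _ hne => slab_disj hne)
    ((11 * n ^ (d - 1) : ℕ) * ENNReal.ofReal q) (fun j _ => (hit_prob hμ _).trans (by
      gcongr; exact slab_card h))
  simpa using this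

/-- finite cube -/
def fcube (d : ℕ) (m : ℕ) : Finset (Site d) := Finset.Icc (fun _ => -(m : ℤ)) (fun _ => (m : ℤ))

lemma mem_fcube {m : ℕ} {x : Site d} : x ∈ fcube d m ↔ x ∈ cube d m := by
  simp only [fcube, Finset.mem_Icc, cube, Set.mem_setOf_eq, abs_le, Pi.le_def]
  exact ⟨fun h i => ⟨h.1 i, h.2 i⟩, fun h => ⟨fun i => (h i).1, fun i => (h i).2⟩⟩

lemma card_fcube (m : ℕ) : (fcube d m).card = (2 * m + 1) ^ d := by
  rw [fcube, Pi.card_Icc]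
  simp
  congr 1; omega

lemma Bad_sub {m : ℕ} (hm : 4 ≤ m) : (BadE (m : ℤ) : Set (Config d)) ⊆
    ⋃ t ∈ ((Finset.univ : Finset (Fin d)) ×ˢ (fcube d (m + 2) ×ˢ fcube d (m + 2))).filter
      (fun t => ∀ l, t.2.2 l - t.2.1 l + 1 ≤ ((2 * m : ℕ) : ℤ)),
      ⋂ j ∈ Finset.range ((m - 3) / 11), hit (slab t.2.1 t.2.2 t.1 j) := by
  intro η hη
  simp only [BadE, Set.mem_setOf_eq, Set.not_subset] at hη
  obtain ⟨u, ⟨p, hp, hJ⟩, hu⟩ := hη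
  simp only [cube, Set.mem_setOf_eq, not_forall, not_le] at hu
  obtain ⟨i, hi⟩ := hu
  obtain ⟨a, b, hB, hpb, hub⟩ := hJ.toBgx
  obtain ⟨a, b, hB, ⟨i, hi⟩, hs⟩ := hB.AL (k := (m : ℤ) - 3) (by omega) ⟨i, by
    have := le_at hpb.1 i; have := le_at hpb.2 i; have := le_at hub.1 i; have := le_at hub.2 i
    have := abs_le.1 (hp i)
    rw [lt_abs] at hi
    omega⟩
  have hcb := hB.cube Set.inter_subset_right
  simp only [Set.mem_iUnion]
  refine ⟨(i, a, b), ?_, ?_⟩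
  · simp only [Finset.mem_filter, Finset.mem_product, Finset.mem_univ, true_and, mem_fcube]
    refine ⟨⟨by exact_mod_cast hcb.1, by exact_mod_cast hcb.2⟩, fun l => ?_⟩
    have := hs l
    push_cast; omega
  · simp only [Set.mem_iInter]
    intro j hj
    have hj' := Finset.mem_range.1 hj
    have hj2 : 11 * (j + 1) ≤ m - 3 := by
      have := Nat.div_mul_le_self (m - 3) 11; omega
    obtain ⟨h, hH, h1, h2, h3⟩ := (hB.dense i).2.2 (a i + 11 * j + 5) (by omega) (by omega)
    exact ⟨h, mem_slab h1 h2 h3, hH.1⟩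

lemma Bad_prob {q : ℝ} {μ : Measure (Config d)} (hμ : IsBernoulliProduct q μ) {m : ℕ} (hm : 4 ≤ m) :
    μ (BadE (m : ℤ)) ≤ (d * (2 * m + 5) ^ (2 * d) : ℕ) *
      ((11 * (2 * m) ^ (d - 1) : ℕ) * ENNReal.ofReal q) ^ ((m - 3) / 11) := by
  refine (measure_mono (Bad_sub hm)).trans ((measure_biUnion_finset_le _ _).trans ?_)
  refine (Finset.sum_le_card_nsmul _ _ _ fun t ht => slabs_prob hμ t.1 (Finset.mem_filter.1 ht).2 _).trans ?_
  rw [nsmul_eq_mul]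
  gcongr
  refine (Finset.card_filter_le _ _).trans ?_
  simp only [Finset.card_product, card_fcube, Finset.card_univ, Fintype.card_fin]
  apply le_of_eq
  rw [two_mul d, pow_add]
  ring
end

section
lemma BadE_meas (m : ℕ) : MeasurableSet (BadE (m : ℤ) : Set (Config d)) := by
  refine measurableSet_finite (fcube d (m + 2)) _ fun η η' h => ?_
  have : holes η ∩ cube d ((m : ℤ) + 2) = holes η' ∩ cube d ((m : ℤ) + 2) := by
    ext x
    have hx : x ∈ cube d ((m : ℤ) + 2) → η x = η' x := fun hx => h x (mem_fcube.2 (by exact_mod_cast hx))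
    simp only [holes, Set.mem_inter_iff, Set.mem_setOf_eq]
    constructor
    · rintro ⟨a, b⟩; exact ⟨(hx b) ▸ a, b⟩
    · rintro ⟨a, b⟩; exact ⟨(hx b).symm ▸ a, b⟩
  simp only [BadE, Set.mem_setOf_eq, this]

lemma ft_isLocal (m : ℕ) : IsLocal (ft (m : ℤ) : Config d → ℝ) :=
  ⟨fcube d m, fun η η' h => ft_local fun x hx => h x (mem_fcube.2 hx)⟩

lemma tsum_le_fin {α : Type*} (s : Finset α) (g : α → ℝ≥0∞) (b : ℝ≥0∞) (h1 : ∀ a ∈ s, g a ≤ b) (h2 : ∀ a ∉ s, g a = 0) :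
    ∑' a, g a ≤ s.card * b := by
  rw [tsum_eq_sum (s := s) h2, ← nsmul_eq_mul]
  exact Finset.sum_le_card_nsmul _ _ _ h1

lemma sq_bd {x : ℝ} {n : ℕ} (h : |x| ≤ n) : ENNReal.ofReal (x ^ 2) ≤ ((n ^ 2 : ℕ) : ℝ≥0∞) := by
  rw [← ENNReal.ofReal_natCast]
  apply ENNReal.ofReal_le_ofReal
  push_cast
  exact sq_le_sq' (abs_le.1 h).1 (abs_le.1 h).2

lemma cval_mul_le (k : ℕ) (η : Config d) (x y : Site d) (r : ℝ≥0∞) : cval k η x y * r ≤ r := by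
  unfold cval; split_ifs <;> simp

lemma env_bd (hd : 1 ≤ d) (m : ℕ) (η : Config d) :
    envTerm 2 (ft (m : ℤ)) η ≤ (BadE (m : ℤ)).indicator (fun _ => (((2 * m + 3) ^ (2 * d + 2) : ℕ) : ℝ≥0∞)) η := by
  by_cases hB : η ∈ BadE (m : ℤ)
  · rw [Set.indicator_of_mem hB]
    refine (tsum_le_fin (fcube d (m + 1) ×ˢ fcube d (m + 1)) _ (((2 * m + 1) ^ 2 : ℕ) : ℝ≥0∞) ?_ ?_).trans ?_
    · intro p _
      split_ifs
      · refine (cval_mul_le _ _ _ _ _).trans (sq_bd ?_)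
        have h1 := abs_le.1 (ft_abs hd (Int.natCast_nonneg m) (swap η p.1 p.2))
        have h2 := abs_le.1 (ft_abs hd (Int.natCast_nonneg m) η)
        push_cast at *
        rw [abs_le]; constructor <;> linarith [h1.1, h1.2, h2.1, h2.2]
      · exact zero_le
    · intro p hp
      split_ifs with hc
      · have : ft (m : ℤ) (swap η p.1 p.2) = ft (m : ℤ) η := by
          apply ft_env_far
          · intro h
            apply hp
            simp only [Finset.mem_product, mem_fcube]
            push_cast
            exact ⟨cube_mono (by omega) h, adj_cube hc.2 h⟩
          · intro h
            apply hp
            simp only [Finset.mem_product, mem_fcube]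
            push_cast
            exact ⟨adj_cube (adj_comm.1 hc.2) h, cube_mono (by omega) h⟩
        rw [this]; simp
      · rfl
    · rw [Finset.card_product, card_fcube, ← Nat.cast_mul]
      norm_cast
      calc (2 * (m + 1) + 1) ^ d * (2 * (m + 1) + 1) ^ d * (2 * m + 1) ^ 2
          ≤ (2 * m + 3) ^ d * (2 * m + 3) ^ d * (2 * m + 3) ^ 2 := by
            apply Nat.mul_le_mul (le_of_eq (by ring)) (Nat.pow_le_pow_left (by omega) _)
        _ = _ := by ring
  · rw [Set.indicator_of_notMem hB]
    apply le_of_eq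
    refine ENNReal.tsum_eq_zero.2 fun p => ?_
    split_ifs with h
    · by_cases hc : constraint 2 η p.1 p.2
      · rw [ft_env h.2 hc hB]; simp
      · simp [cval, hc]
    · rfl

lemma tag_bd (hd : 1 ≤ d) (m : ℕ) (hm : 3 ≤ m) (η : Config d) :
    tagTerm 2 (e1R d) (ft (m : ℤ)) η ≤ (BadE (m : ℤ)).indicator (fun _ => (((2 * m + 3) ^ (2 * d + 2) : ℕ) : ℝ≥0∞)) η := by
  by_cases hB : η ∈ BadE (m : ℤ)
  · rw [Set.indicator_of_mem hB]
    have ho : (origin : Site d) ∈ cube d 0 := fun i => by simp [origin]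
    refine (tsum_le_fin (fcube d 1) _ (((2 * m + 1) ^ 2 : ℕ) : ℝ≥0∞) ?_ ?_).trans ?_
    · intro y _
      split_ifs with hy
      · have hy1 : y ∈ cube d 1 := by simpa using adj_cube hy ho
        refine (cval_mul_le _ _ _ _ _).trans (sq_bd ?_)
        have h1 := abs_le.1 (ft_abs hd (Int.natCast_nonneg m) (shift y (swap η origin y)))
        have h2 := abs_le.1 (ft_abs hd (Int.natCast_nonneg m) η)
        have h3 := abs_le.1 (dot_abs hd hy1)
        push_cast at *
        rw [abs_le]; constructor <;> linarith [h1.1, h1.2, h2.1, h2.2, h3.1, h3.2]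
      · exact zero_le
    · intro y hy
      rw [if_neg]
      intro h
      apply hy
      rw [mem_fcube]
      simpa using adj_cube h ho
    · rw [card_fcube, ← Nat.cast_mul]
      norm_cast
      calc (2 * 1 + 1) ^ d * (2 * m + 1) ^ 2
          ≤ (2 * m + 3) ^ (2 * d) * (2 * m + 3) ^ 2 := by
            apply Nat.mul_le_mul _ (Nat.pow_le_pow_left (by omega) _)
            exact (Nat.pow_le_pow_left (by omega) _).trans (Nat.pow_le_pow_right (by omega) (by omega))
        _ = _ := by ring
  · rw [Set.indicator_of_notMem hB]
    apply le_of_eq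
    refine ENNReal.tsum_eq_zero.2 fun y => ?_
    split_ifs with h
    · by_cases hc : constraint 2 η origin y
      · rw [ft_tag hd (by omega) h hc hB]; simp
      · simp [cval, hc]
    · rfl

lemma cond_le {q : ℝ} (hq2 : q ≤ 1 / 2) {μ : Measure (Config d)} (hμ : IsBernoulliProduct q μ)
    (A : Set (Config d)) : condOcc μ A ≤ 2 * μ A := by
  rw [condOcc, ProbabilityTheory.cond_apply (measurableSet_occ _ _)]
  have h := hμ.2 {origin} (fun _ => true)
  simp only [Finset.mem_singleton, forall_eq, Finset.prod_singleton, if_true] at h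
  rw [h]
  refine mul_le_mul' ?_ (measure_mono Set.inter_subset_right)
  rw [ENNReal.inv_le_iff_inv_le]
  have : (2 : ℝ≥0∞)⁻¹ = ENNReal.ofReal (2⁻¹) := by
    rw [ENNReal.ofReal_inv_of_pos (by norm_num)]; norm_num
  rw [this]
  apply ENNReal.ofReal_le_ofReal
  norm_num at hq2 ⊢
  linarith

lemma upper1 (hd : 1 ≤ d) {q : ℝ} (hq0 : 0 ≤ q) (hq2 : q ≤ 1 / 2) {μ : Measure (Config d)} (hμ : IsBernoulliProduct q μ)
    {m : ℕ} (hm : 4 ≤ m) :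
    diffCoeff 2 μ ≤ ENNReal.ofReal (4 * d * (2 * m + 5) ^ (4 * d + 2) *
      (11 * (2 * m) ^ (d - 1) * q) ^ ((m - 3) / 11)) := by
  haveI := hμ.1
  have h1 : diffCoeff 2 μ ≤ energy 2 (e1R d) (condOcc μ) (ft (m : ℤ)) :=
    iInf_le (fun f : {f : Config d → ℝ // IsLocal f} => energy 2 (e1R d) (condOcc μ) f.1) ⟨_, ft_isLocal m⟩
  refine h1.trans ?_
  have h2 : energy 2 (e1R d) (condOcc μ) (ft (m : ℤ)) ≤
      ∫⁻ η, (BadE (m : ℤ)).indicator (fun _ => 2 * (((2 * m + 3) ^ (2 * d + 2) : ℕ) : ℝ≥0∞)) η ∂(condOcc μ) := by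
    apply lintegral_mono
    intro η
    refine (add_le_add (env_bd hd m η) (tag_bd hd m (by omega) η)).trans ?_
    by_cases hB : η ∈ BadE (m : ℤ)
    · simp only [Set.indicator_of_mem hB, two_mul]; exact le_rfl
    · simp [Set.indicator_of_notMem hB]
  refine h2.trans ?_
  rw [lintegral_indicator_const (BadE_meas m)]
  refine (mul_le_mul_right ((cond_le hq2 hμ _).trans (mul_le_mul_right (Bad_prob hμ hm) _)) _).trans ?_
  have e : ((11 * (2 * m) ^ (d - 1) : ℕ) : ℝ≥0∞) * ENNReal.ofReal q = ENNReal.ofReal (11 * (2 * m) ^ (d - 1) * q) := by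
    rw [← ENNReal.ofReal_natCast, ← ENNReal.ofReal_mul (by positivity)]; push_cast; rfl
  rw [e, ← ENNReal.ofReal_pow (by positivity), ENNReal.ofReal_mul (by positivity)]
  rw [← mul_assoc, ← mul_assoc]
  gcongr
  have e2 : (4 * d * (2 * m + 5) ^ (4 * d + 2) : ℝ) = ((4 * d * (2 * m + 5) ^ (4 * d + 2) : ℕ) : ℝ) := by push_cast; rfl
  rw [e2, ENNReal.ofReal_natCast]
  have : 2 * (2 * m + 3) ^ (2 * d + 2) * 2 * (d * (2 * m + 5) ^ (2 * d)) ≤ 4 * d * (2 * m + 5) ^ (4 * d + 2) := by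
    calc 2 * (2 * m + 3) ^ (2 * d + 2) * 2 * (d * (2 * m + 5) ^ (2 * d))
        ≤ 2 * (2 * m + 5) ^ (2 * d + 2) * 2 * (d * (2 * m + 5) ^ (2 * d)) := by gcongr; omega
      _ = _ := by ring
  exact_mod_cast this

theorem upper (hd : 2 ≤ d) : ∃ c q₀ : ℝ, 0 < c ∧ 0 < q₀ ∧ q₀ < 1 ∧ ∀ q : ℝ, 0 < q → q < q₀ →
    ∀ μ : Measure (Config d), IsBernoulliProduct q μ →
      diffCoeff 2 μ ≤ ENNReal.ofReal (Real.exp (-(c * q ^ (-(1 : ℝ) / ((d : ℝ) - 1))))) := by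
  have hd2 : (2 : ℝ) ≤ d := by exact_mod_cast hd
  obtain ⟨n, hn⟩ : ∃ n, n = 4 * d + 2 := ⟨_, rfl⟩
  obtain ⟨K, hK⟩ : ∃ K : ℝ, K = 4 * d * Real.exp 2 * 154 ^ n := ⟨_, rfl⟩
  have hK0 : 0 < K := by rw [hK]; positivity
  have hlim := Real.tendsto_pow_mul_exp_neg_atTop_nhds_zero n
  have hev : ∀ᶠ x : ℝ in Filter.atTop, x ^ n * Real.exp (-x) < 1 / K :=
    hlim.eventually (gt_mem_nhds (by positivity))
  obtain ⟨Y, hY⟩ := Filter.eventually_atTop.1 hev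
  obtain ⟨H0, hH0⟩ : ∃ H0 : ℝ, H0 = max 400 (2904 * Y) := ⟨_, rfl⟩
  have hH1 : 400 ≤ H0 := hH0 ▸ le_max_left _ _
  have hH2 : 2904 * Y ≤ H0 := hH0 ▸ le_max_right _ _
  refine ⟨1 / 2904, min (1 / 2) (1 / H0 ^ (d - 1)), by norm_num, ?_, ?_, ?_⟩
  · apply lt_min (by norm_num); positivity
  · exact (min_le_left _ _).trans_lt (by norm_num)
  intro q hq hq0 μ hμ
  have hq2 : q ≤ 1 / 2 := (hq0.trans_le (min_le_left _ _)).le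
  have hq3 := hq0.trans_le (min_le_right _ _)
  set h := q ^ (-(1 : ℝ) / ((d : ℝ) - 1)) with hh
  have hh0 : 0 < h := Real.rpow_pos_of_pos hq _
  have hd1 : ((d - 1 : ℕ) : ℝ) = (d : ℝ) - 1 := by rw [Nat.cast_sub (by omega)]; simp
  have hhp : h ^ (d - 1) = 1 / q := by
    rw [hh, ← Real.rpow_natCast, ← Real.rpow_mul hq.le, hd1, div_mul_cancel₀ _ (by linarith), Real.rpow_neg_one]
    simp
  have hhH : H0 ≤ h := by
    refine le_of_lt (lt_of_pow_lt_pow_left₀ (d - 1) hh0.le ?_)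
    rw [hhp, lt_div_iff₀ hq]
    rw [lt_div_iff₀ (by positivity)] at hq3
    linarith
  obtain ⟨m, hm⟩ : ∃ m : ℕ, m = ⌊h / 66⌋₊ := ⟨_, rfl⟩
  have hm1 : (m : ℝ) ≤ h / 66 := hm ▸ Nat.floor_le (by positivity)
  have hm2 : h / 66 - 1 < m := hm ▸ Nat.sub_one_lt_floor _
  have hm3 : h / 132 ≤ m := by linarith
  have hm4 : 4 ≤ m := by
    have : (4 : ℝ) < m := by linarith
    exact_mod_cast this.le
  refine (upper1 (by omega) hq.le hq2 hμ hm4).trans (ENNReal.ofReal_le_ofReal ?_)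
  have hr : 11 * (2 * (m : ℝ)) ^ (d - 1) * q ≤ Real.exp (-1) := by
    have a1 : (2 * (m : ℝ)) ^ (d - 1) ≤ (1 / 33) ^ (d - 1) * h ^ (d - 1) := by
      rw [← mul_pow]; exact pow_le_pow_left₀ (by positivity) (by linarith) _
    have a2 : ((1 : ℝ) / 33) ^ (d - 1) ≤ 1 / 33 := pow_le_of_le_one (by norm_num) (by norm_num) (by omega)
    have a3 : (2 * (m : ℝ)) ^ (d - 1) ≤ 1 / 33 * (1 / q) := by
      rw [hhp] at a1
      exact a1.trans (mul_le_mul_of_nonneg_right a2 (by positivity))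
    have a4 : 11 * (2 * (m : ℝ)) ^ (d - 1) * q ≤ 1 / 3 := by
      calc 11 * (2 * (m : ℝ)) ^ (d - 1) * q ≤ 11 * (1 / 33 * (1 / q)) * q := by gcongr
        _ = 1 / 3 := by field_simp; norm_num
    have a5 : Real.exp (-1) ≥ 1 / 3 := by
      rw [Real.exp_neg, ge_iff_le, one_div]
      exact inv_anti₀ (Real.exp_pos _) (by linarith [Real.exp_one_lt_d9])
    linarith
  have hJ : ((m : ℝ) / 11 - 2) ≤ (((m - 3) / 11 : ℕ) : ℝ) := by
    have : m ≤ 11 * ((m - 3) / 11) + 22 := by omega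
    have : (m : ℝ) ≤ 11 * (((m - 3) / 11 : ℕ) : ℝ) + 22 := by exact_mod_cast this
    linarith
  have hp : (11 * (2 * (m : ℝ)) ^ (d - 1) * q) ^ ((m - 3) / 11) ≤ Real.exp 2 * Real.exp (-((m : ℝ) / 11)) := by
    refine (pow_le_pow_left₀ (by positivity) hr _).trans ?_
    rw [← Real.exp_nat_mul, ← Real.exp_add]
    apply Real.exp_le_exp.2
    linarith
  have hy := hY ((m : ℝ) / 22) (by linarith)
  have hm5 : (4 : ℝ) ≤ m := by exact_mod_cast hm4
  have h25 : (2 * (m : ℝ) + 5) ^ n ≤ 154 ^ n * ((m : ℝ) / 22) ^ n := by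
    rw [← mul_pow]; exact pow_le_pow_left₀ (by positivity) (by linarith) _
  rw [lt_div_iff₀ hK0] at hy
  have hsplit : Real.exp (-((m : ℝ) / 11)) = Real.exp (-((m : ℝ) / 22)) * Real.exp (-((m : ℝ) / 22)) := by
    rw [← Real.exp_add]; congr 1; ring
  rw [← hn]
  calc 4 * d * (2 * (m : ℝ) + 5) ^ n * (11 * (2 * (m : ℝ)) ^ (d - 1) * q) ^ ((m - 3) / 11)
      ≤ 4 * d * (154 ^ n * ((m : ℝ) / 22) ^ n) * (Real.exp 2 * Real.exp (-((m : ℝ) / 11))) := by gcongr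
    _ = (((m : ℝ) / 22) ^ n * Real.exp (-((m : ℝ) / 22)) * K) * Real.exp (-((m : ℝ) / 22)) := by
        rw [hsplit, hK]; ring
    _ ≤ 1 * Real.exp (-((m : ℝ) / 22)) := by gcongr
    _ ≤ _ := by
        rw [one_mul]; apply Real.exp_le_exp.2; linarith
end

/-- For `d ≥ 2`, `k = 2`, there are constants `c, c' > 0`
depending only on `d` and a `q₀ ∈ (0,1)` such that for all `0 < q < q₀`,
`exp(-c (log(1/q))^d q^{-1/(d-1)}) ≤ D(q) ≤ exp(-c' q^{-1/(d-1)})`. -/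
theorem statement0 (d : ℕ) (hd : 2 ≤ d) :
    ∃ c c' q₀ : ℝ, 0 < c ∧ 0 < c' ∧ 0 < q₀ ∧ q₀ < 1 ∧
      ∀ q : ℝ, 0 < q → q < q₀ →
        ∀ μ : Measure (Config d), IsBernoulliProduct q μ →
          ENNReal.ofReal
              (Real.exp (-(c * (Real.log (1 / q)) ^ d * q ^ (-(1 : ℝ) / ((d : ℝ) - 1))))) ≤
            diffCoeff 2 μ ∧
          diffCoeff 2 μ ≤
            ENNReal.ofReal (Real.exp (-(c' * q ^ (-(1 : ℝ) / ((d : ℝ) - 1))))) := by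
  obtain ⟨c, q1, hc, h1, h1', hl⟩ := lower hd
  obtain ⟨c', q2, hc', h2, h2', hu⟩ := upper hd
  exact ⟨c, c', min q1 q2, hc, hc', lt_min h1 h2, (min_le_left _ _).trans_lt h1', fun q hq hq0 μ hμ =>
    ⟨hl q hq (hq0.trans_le (min_le_left _ _)) μ hμ, hu q hq (hq0.trans_le (min_le_right _ _)) μ hμ⟩⟩

end KA
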